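/- Key integral representation (Proposition 2.1): For every κ > 0 there is a constant C = C(κ) > 0 such that the following holds. Let f belong to the class C(κ), let x be real with x ≥ C, let y be real with 10 ≤ y ≤ √x, set η = 1/log y and c₀ = 1 + 1/log x, and let T be real with 1 ≤ T ≤ x^{9/10}. Then | ∫_{α=0}^{η} ∫_{β=0}^{η} (1/π) ∫_{t=−T}^{T} 𝒮(s−α−β)·ℒ(s+β)·( ∑_{y < m < x/y} Λ_ℓ(m)·m^{−(s−β)} )·( ∑_{y < n < x/y} Λ_ℓ(n)·n^{−(s+β)} )·x^{s−α−β}/(s−α−β) dt dβ dα − ∑_{n ≤ x} f(n) | ≤ C · ( x·(log y)^κ/log x + x·(log x)^κ/T ), where s = c₀ + it in the inner integral. -/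

import Mathlib

open Complex MeasureTheory
open scoped Classical

noncomputable section

/-- Membership of `f` in the class `C(κ)`, witnessed by `Λf`. -/
structure IsHalaszClass (κ : ℝ) (f : ℕ → ℂ) (Λf : ℕ → ℂ) : Prop where
  map_one : f 1 = 1
  mult : ∀ m n : ℕ, Nat.Coprime m n → f (m * n) = f m * f n
  supp : ∀ n : ℕ, ¬ IsPrimePow n → Λf n = 0
  bound : ∀ n : ℕ, 1 ≤ n → ‖Λf n‖ ≤ κ * ArithmeticFunction.vonMangoldt n
  conv : ∀ n : ℕ, 1 ≤ n →
    f n * (Real.log n : ℂ) = ∑ d ∈ n.divisors, Λf d * f (n / d)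
  abs_conv : ∀ σ : ℝ, 1 < σ → Summable (fun n : ℕ => ‖f n‖ / (n : ℝ) ^ σ)

/-- The Dirichlet series `F(s) = ∑ f(n) n^{-s}`. -/
def Fser (f : ℕ → ℂ) (s : ℂ) : ℂ := ∑' n : ℕ, f n / (n : ℂ) ^ s

/-- The part of `f` supported on `y`-smooth numbers: `s(n) = f(n)` if all prime
factors of `n` are `≤ y`, and `0` otherwise. -/
def sPart (f : ℕ → ℂ) (y : ℝ) (n : ℕ) : ℂ :=
  if ∀ p ∈ n.primeFactors, (p : ℝ) ≤ y then f n else 0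

/-- The part of `f` supported on `y`-rough numbers: `ℓ(n) = f(n)` if all prime
factors of `n` are `> y`, and `0` otherwise. -/
def lPart (f : ℕ → ℂ) (y : ℝ) (n : ℕ) : ℂ :=
  if ∀ p ∈ n.primeFactors, y < (p : ℝ) then f n else 0

/-- `𝒮(w) = ∑ s(n) n^{-w}`. -/
def Sdir (f : ℕ → ℂ) (y : ℝ) (w : ℂ) : ℂ := ∑' n : ℕ, sPart f y n / (n : ℂ) ^ w

/-- `ℒ(w) = ∑ ℓ(n) n^{-w}`. -/
def Ldir (f : ℕ → ℂ) (y : ℝ) (w : ℂ) : ℂ := ∑' n : ℕ, lPart f y n / (n : ℂ) ^ w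

/-- `Λ_ℓ(n) = Λ_f(n)` if `n` is a power of a prime `> y`, and `0` otherwise. -/
def ΛlPart (Λf : ℕ → ℂ) (y : ℝ) (n : ℕ) : ℂ :=
  if ∀ p ∈ n.primeFactors, y < (p : ℝ) then Λf n else 0

section ArithmeticFunctionTools

open ArithmeticFunction

variable {R : Type*} [CommRing R]

/-- The arithmetic function `n ↦ n ^ (-θ) • u n`. -/
def twist [Algebra ℝ R] (θ : ℝ) (u : ArithmeticFunction R) : ArithmeticFunction R :=
  ⟨fun n => ((n : ℝ) ^ (-θ)) • u n, by simp⟩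

/-- The arithmetic function `n ↦ log n • u n`. -/
def logMul [Algebra ℝ R] (u : ArithmeticFunction R) : ArithmeticFunction R :=
  ⟨fun n => Real.log n • u n, by simp⟩

/-- The restriction of `u` to the integers all of whose prime factors satisfy `P`. -/
def restrictPrimes (P : ℕ → Prop) (u : ArithmeticFunction R) : ArithmeticFunction R :=
  ⟨fun n => if ∀ p ∈ n.primeFactors, P p then u n else 0, by simp⟩

/-- The pointwise norm of a complex arithmetic function. -/
def normAF (u : ArithmeticFunction ℂ) : ArithmeticFunction ℝ := ⟨fun n => ‖u n‖, by simp⟩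

lemma twist_apply [Algebra ℝ R] (θ : ℝ) (u : ArithmeticFunction R) (n : ℕ) :
    twist θ u n = ((n : ℝ) ^ (-θ)) • u n := rfl

lemma logMul_apply [Algebra ℝ R] (u : ArithmeticFunction R) (n : ℕ) : logMul u n =
    Real.log n • u n := rfl

lemma restrictPrimes_apply (P : ℕ → Prop) (u : ArithmeticFunction R) (n : ℕ) :
    restrictPrimes P u n = if ∀ p ∈ n.primeFactors, P p then u n else 0 := rfl

@[simp] lemma normAF_apply (u : ArithmeticFunction ℂ) (n : ℕ) : normAF u n = ‖u n‖ := rfl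

lemma normAF_twist (θ : ℝ) (u : ArithmeticFunction ℂ) :
    normAF (twist θ u) = twist θ (normAF u) := by
  ext n
  simp [twist_apply, abs_of_nonneg (Real.rpow_nonneg (Nat.cast_nonneg n) _)]

lemma twist_mul [Algebra ℝ R] (θ : ℝ) (u v : ArithmeticFunction R) :
    twist θ (u * v) = twist θ u * twist θ v := by
  ext n
  rw [twist_apply, mul_apply, mul_apply, Finset.smul_sum]
  refine Finset.sum_congr rfl fun p hp => ?_
  obtain ⟨h, -⟩ := Nat.mem_divisorsAntidiagonal.mp hp
  rw [← h, twist_apply, twist_apply, smul_mul_smul_comm, Nat.cast_mul,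
    Real.mul_rpow (Nat.cast_nonneg _) (Nat.cast_nonneg _)]

lemma twist_twist [Algebra ℝ R] (θ φ : ℝ) (u : ArithmeticFunction R) :
    twist θ (twist φ u) = twist (θ + φ) u := by
  ext n
  rcases Nat.eq_zero_or_pos n with rfl | hn
  · simp
  · rw [twist_apply, twist_apply, twist_apply, smul_smul, ← Real.rpow_add (by positivity)]
    congr 2; ring

@[simp] lemma twist_zero [Algebra ℝ R] (u : ArithmeticFunction R) : twist 0 u = u := by
  ext n
  simp [twist_apply]

lemma twist_apply_one [Algebra ℝ R] (θ : ℝ) (u : ArithmeticFunction R) : twist θ u 1 = u 1 := by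
  simp [twist_apply]

lemma logMul_mul [Algebra ℝ R] (u v : ArithmeticFunction R) :
    logMul (u * v) = logMul u * v + u * logMul v := by
  ext n
  rw [logMul_apply, ArithmeticFunction.add_apply, mul_apply, mul_apply, mul_apply, Finset.smul_sum,
    ← Finset.sum_add_distrib]
  refine Finset.sum_congr rfl fun p hp => ?_
  obtain ⟨h, h0⟩ := Nat.mem_divisorsAntidiagonal.mp hp
  have h1 : p.1 ≠ 0 := by
    rintro h1
    simp [h1] at h
    exact h0 h.symm
  have h2 : p.2 ≠ 0 := by
    rintro h1
    simp [h1] at h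
    exact h0 h.symm
  rw [← h, logMul_apply, logMul_apply, Nat.cast_mul,
    Real.log_mul (by exact_mod_cast h1) (by exact_mod_cast h2), add_smul, smul_mul_assoc,
    mul_smul_comm]

lemma logMul_twist [Algebra ℝ R] (θ : ℝ) (u : ArithmeticFunction R) :
    logMul (twist θ u) = twist θ (logMul u) := by
  ext n
  rw [logMul_apply, twist_apply, twist_apply, logMul_apply, smul_comm]

lemma restrictPrimes_mul (P : ℕ → Prop) (u v : ArithmeticFunction R) :
    restrictPrimes P (u * v) = restrictPrimes P u * restrictPrimes P v := by
  ext n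
  rw [restrictPrimes_apply, mul_apply, mul_apply]
  have key : ∀ p ∈ n.divisorsAntidiagonal, ((∀ q ∈ n.primeFactors, P q) ↔
      (∀ q ∈ p.1.primeFactors, P q) ∧ (∀ q ∈ p.2.primeFactors, P q)) := by
    intro p hp
    obtain ⟨h, h0⟩ := Nat.mem_divisorsAntidiagonal.mp hp
    have h1 : p.1 ≠ 0 := by
      rintro h1
      simp [h1] at h
      exact h0 h.symm
    have h2 : p.2 ≠ 0 := by
      rintro h1
      simp [h1] at h
      exact h0 h.symm
    rw [← h, Nat.primeFactors_mul h1 h2]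
    simp only [Finset.mem_union, or_imp, forall_and]
  split_ifs with hn
  · refine Finset.sum_congr rfl fun p hp => ?_
    rw [restrictPrimes_apply, restrictPrimes_apply, if_pos ((key p hp).mp hn).1,
      if_pos ((key p hp).mp hn).2]
  · symm
    refine Finset.sum_eq_zero fun p hp => ?_
    have := (key p hp).not.mp hn
    rw [not_and_or] at this
    rcases this with h | h
    · rw [restrictPrimes_apply, if_neg h, zero_mul]
    · rw [restrictPrimes_apply _ _ p.2, if_neg h, mul_zero]

lemma logMul_restrictPrimes [Algebra ℝ R] (P : ℕ → Prop) (u : ArithmeticFunction R) :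
    logMul (restrictPrimes P u) = restrictPrimes P (logMul u) := by
  ext n
  rw [logMul_apply, restrictPrimes_apply, restrictPrimes_apply, logMul_apply]
  split_ifs <;> simp

lemma isMultiplicative_restrictPrimes (P : ℕ → Prop) {u : ArithmeticFunction R}
    (hu : u.IsMultiplicative) : (restrictPrimes P u).IsMultiplicative := by
  refine ⟨by simp [restrictPrimes_apply, hu.1], fun {m n} hmn => ?_⟩
  rw [restrictPrimes_apply, restrictPrimes_apply, restrictPrimes_apply,
    hu.2 hmn, hmn.primeFactors_mul]
  simp only [Finset.mem_union, or_imp, forall_and]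
  rw [ite_zero_mul_ite_zero]

/-- A multiplicative function factors along any splitting of the primes. -/
lemma restrictPrimes_mul_restrictPrimes_not (P : ℕ → Prop) {u : ArithmeticFunction R}
    (hu : u.IsMultiplicative) :
    restrictPrimes P u * restrictPrimes (fun p => ¬ P p) u = u := by
  have h1 := isMultiplicative_restrictPrimes P hu
  have h2 := isMultiplicative_restrictPrimes (fun p => ¬ P p) hu
  rw [IsMultiplicative.eq_iff_eq_on_prime_powers _ (h1.mul h2) _ hu]
  intro p i hp
  rcases Nat.eq_zero_or_pos i with rfl | hi
  · rw [pow_zero, (h1.mul h2).1, hu.1]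
  rw [mul_apply]
  have hpi : p ^ i ≠ 0 := pow_ne_zero _ hp.ne_zero
  have hfac : ∀ d, d ∣ p ^ i → ∀ q ∈ d.primeFactors, q = p := fun d hd q hq =>
    (Nat.prime_dvd_prime_iff_eq (Nat.prime_of_mem_primeFactors hq) hp).mp
      ((Nat.prime_of_mem_primeFactors hq).dvd_of_dvd_pow
        ((Nat.dvd_of_mem_primeFactors hq).trans hd))
  have hmem : ∀ d, d ∣ p ^ i → d ≠ 1 → p ∈ d.primeFactors := fun d hd hd1 => by
    obtain ⟨q, hq⟩ := Nat.nonempty_primeFactors.mpr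
      (lt_of_le_of_ne (Nat.pos_of_dvd_of_pos hd (Nat.pos_of_ne_zero hpi)) (Ne.symm hd1))
    rwa [← hfac d hd q hq]
  by_cases hP : P p
  · rw [Finset.sum_eq_single (p ^ i, 1)]
    · rw [h2.1, mul_one, restrictPrimes_apply, if_pos]
      intro q hq
      rwa [hfac _ dvd_rfl q hq]
    · intro b hb hne
      obtain ⟨h, -⟩ := Nat.mem_divisorsAntidiagonal.mp hb
      have hb1 : b.2 ≠ 1 := by
        intro hb1
        exact hne (Prod.ext (by simpa [hb1] using h) hb1)
      rw [restrictPrimes_apply _ _ b.2, if_neg, mul_zero]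
      push Not
      exact ⟨p, hmem _ ⟨b.1, by rw [← h, mul_comm]⟩ hb1, hP⟩
    · intro h
      exact absurd (Nat.mem_divisorsAntidiagonal.mpr ⟨by simp, hpi⟩) h
  · rw [Finset.sum_eq_single (1, p ^ i)]
    · rw [h1.1, one_mul, restrictPrimes_apply, if_pos]
      intro q hq
      rwa [hfac _ dvd_rfl q hq]
    · intro b hb hne
      obtain ⟨h, -⟩ := Nat.mem_divisorsAntidiagonal.mp hb
      have hb1 : b.1 ≠ 1 := by
        intro hb1
        exact hne (Prod.ext hb1 (by simpa [hb1] using h))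
      rw [restrictPrimes_apply _ _ b.1, if_neg, zero_mul]
      push Not
      exact ⟨p, hmem _ ⟨b.2, h.symm⟩ hb1, hP⟩
    · intro h
      exact absurd (Nat.mem_divisorsAntidiagonal.mpr ⟨by simp, hpi⟩) h

lemma norm_mul_apply_le (u v : ArithmeticFunction ℂ) (n : ℕ) :
    ‖(u * v) n‖ ≤ (normAF u * normAF v) n := by
  rw [mul_apply, mul_apply]
  refine (norm_sum_le _ _).trans (Finset.sum_le_sum fun p _ => ?_)
  rw [norm_mul]; rfl

lemma mul_apply_nonneg {u v : ArithmeticFunction ℝ} (hu : ∀ n, 0 ≤ u n) (hv : ∀ n, 0 ≤ v n)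
    (n : ℕ) : 0 ≤ (u * v) n := by
  rw [mul_apply]
  exact Finset.sum_nonneg fun p _ => mul_nonneg (hu _) (hv _)

lemma mul_apply_le_mul_apply {u v u' v' : ArithmeticFunction ℝ} (hv : ∀ n, 0 ≤ v n)
    (hu' : ∀ n, 0 ≤ u' n) (huu' : ∀ n, u n ≤ u' n) (hvv' : ∀ n, v n ≤ v' n) (n : ℕ) :
    (u * v) n ≤ (u' * v') n := by
  rw [mul_apply, mul_apply]
  exact Finset.sum_le_sum fun p _ => mul_le_mul (huu' _) (hvv' _) (hv _) (hu' _)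

lemma twist_nonneg {u : ArithmeticFunction ℝ} (θ : ℝ) (hu : ∀ n, 0 ≤ u n) (n : ℕ) :
    0 ≤ twist θ u n := mul_nonneg (Real.rpow_nonneg (Nat.cast_nonneg n) _) (hu n)

lemma twist_le_twist {u v : ArithmeticFunction ℝ} (θ : ℝ) (h : ∀ n, u n ≤ v n) (n : ℕ) :
    twist θ u n ≤ twist θ v n :=
  mul_le_mul_of_nonneg_left (h n) (Real.rpow_nonneg (Nat.cast_nonneg n) _)

lemma twist_anti {u : ArithmeticFunction ℝ} {θ φ : ℝ} (h : θ ≤ φ) (hu : ∀ n, 0 ≤ u n) (n : ℕ) :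
    twist φ u n ≤ twist θ u n := by
  rcases Nat.eq_zero_or_pos n with rfl | hn
  · simp
  · refine mul_le_mul_of_nonneg_right ?_ (hu n)
    exact Real.rpow_le_rpow_of_exponent_le (by exact_mod_cast hn) (by linarith)

lemma sum_mul_apply_le {u v : ArithmeticFunction ℝ} (hu : ∀ n, 0 ≤ u n) (hv : ∀ n, 0 ≤ v n)
    (N : ℕ) : ∑ n ∈ Finset.Ioc 0 N, (u * v) n ≤
      (∑ n ∈ Finset.Ioc 0 N, u n) * ∑ n ∈ Finset.Ioc 0 N, v n := by
  rw [sum_Ioc_mul_eq_sum_sum, Finset.sum_mul]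
  refine Finset.sum_le_sum fun n _ => mul_le_mul_of_nonneg_left ?_ (hu n)
  exact Finset.sum_le_sum_of_subset_of_nonneg
    (Finset.Ioc_subset_Ioc_right (Nat.div_le_self _ _)) fun _ _ _ => hv _

/-- Partial sums of a nonnegative function `g` with `g(n) log n ≤ (λ ∗ g)(n)` are bounded by the
exponential of the corresponding partial sum of `λ(d) / log d`. -/
lemma sum_le_exp_sum_div_log {g lam : ArithmeticFunction ℝ} (hg : ∀ n, 0 ≤ g n)
    (hl : ∀ n, 0 ≤ lam n) (hg1 : g 1 = 1) (hl1 : lam 1 = 0)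
    (h : ∀ n, logMul g n ≤ (lam * g) n) (N : ℕ) :
    ∑ n ∈ Finset.Ioc 0 N, g n ≤ Real.exp (∑ d ∈ Finset.Ioc 0 N, lam d / Real.log d) := by
  rcases Nat.eq_zero_or_pos N with rfl | hN
  · simp
  set Φ : ℝ → ℝ := fun θ => ∑ n ∈ Finset.Ioc 0 N, g n * (n : ℝ) ^ (-θ) with hΦ
  set P : ℝ → ℝ := fun θ => ∑ n ∈ Finset.Ioc 0 N, lam n / Real.log n * (n : ℝ) ^ (-θ) with hP
  have hpow : ∀ (c : ℕ → ℝ) (θ : ℝ),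
      HasDerivAt (fun θ => ∑ n ∈ Finset.Ioc 0 N, c n * (n : ℝ) ^ (-θ))
      (∑ n ∈ Finset.Ioc 0 N, c n * (-(Real.log n * (n : ℝ) ^ (-θ)))) θ := by
    intro c θ
    refine HasDerivAt.fun_sum fun n hn => HasDerivAt.const_mul _ ?_
    have hn0 : (0:ℝ) < n := by exact_mod_cast (Finset.mem_Ioc.mp hn).1
    have := (hasDerivAt_neg θ).const_rpow hn0
    exact this.congr_deriv (by ring)
  have hΦ1 : ∀ θ, 1 ≤ Φ θ := by
    intro θ
    have h1 : (1:ℕ) ∈ Finset.Ioc 0 N := Finset.mem_Ioc.mpr ⟨one_pos, hN⟩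
    refine le_trans ?_ (Finset.single_le_sum (f := fun n : ℕ => g n * (n : ℝ) ^ (-θ))
      (fun n _ => mul_nonneg (hg n) (Real.rpow_nonneg (Nat.cast_nonneg n) _)) h1)
    simp [hg1]
  have hmono : Monotone fun θ => Real.log (Φ θ) - P θ := by
    refine monotone_of_hasDerivAt_nonneg (f' := fun θ =>
      (∑ n ∈ Finset.Ioc 0 N, g n * (-(Real.log n * (n : ℝ) ^ (-θ)))) / Φ θ -
      (∑ n ∈ Finset.Ioc 0 N, lam n / Real.log n * (-(Real.log n * (n : ℝ) ^ (-θ))))) ?_ ?_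
    · intro θ
      exact ((hpow _ θ).log (by linarith [hΦ1 θ] : Φ θ ≠ 0)).sub (hpow _ θ)
    · intro θ
      have hpos : 0 < Φ θ := by linarith [hΦ1 θ]
      have e1 : ∑ n ∈ Finset.Ioc 0 N, lam n / Real.log n * (-(Real.log n * (n : ℝ) ^ (-θ))) =
          -∑ n ∈ Finset.Ioc 0 N, twist θ lam n := by
        rw [← Finset.sum_neg_distrib]
        refine Finset.sum_congr rfl fun n hn => ?_
        rw [twist_apply, smul_eq_mul]
        rcases eq_or_ne n 1 with rfl | hn1
        · simp [hl1]
        · have hn0 := (Finset.mem_Ioc.mp hn).1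
          have : Real.log n ≠ 0 := (Real.log_pos (by exact_mod_cast (by omega : 1 < n))).ne'
          field_simp
      have e2 : ∑ n ∈ Finset.Ioc 0 N, g n * (-(Real.log n * (n : ℝ) ^ (-θ))) =
          -∑ n ∈ Finset.Ioc 0 N, twist θ (logMul g) n := by
        rw [← Finset.sum_neg_distrib]
        refine Finset.sum_congr rfl fun n hn => ?_
        rw [twist_apply, logMul_apply, smul_eq_mul, smul_eq_mul]
        ring
      have e3 : Φ θ = ∑ n ∈ Finset.Ioc 0 N, twist θ g n :=
        Finset.sum_congr rfl fun n _ => by rw [twist_apply, smul_eq_mul, mul_comm]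
      have e4 : ∑ n ∈ Finset.Ioc 0 N, twist θ (logMul g) n ≤
          (∑ n ∈ Finset.Ioc 0 N, twist θ lam n) * Φ θ := by
        rw [e3]
        refine le_trans (Finset.sum_le_sum fun n _ => twist_le_twist θ h n) ?_
        rw [twist_mul]
        exact sum_mul_apply_le (twist_nonneg θ hl) (twist_nonneg θ hg) N
      simp only [Pi.zero_apply]
      rw [e1, e2, sub_neg_eq_add, neg_div, neg_add_eq_sub, sub_nonneg, div_le_iff₀ hpos]
      exact e4
  have hlim : Filter.Tendsto (fun θ => Real.log (Φ θ) - P θ) Filter.atTop (nhds 0) := by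
    have hsum : ∀ c : ℕ → ℝ, Filter.Tendsto
        (fun θ : ℝ => ∑ n ∈ Finset.Ioc 0 N, c n * (n : ℝ) ^ (-θ)) Filter.atTop (nhds (c 1)) := by
      intro c
      have h1 : c 1 = ∑ n ∈ Finset.Ioc 0 N, if n = 1 then c 1 else 0 := by
        rw [Finset.sum_ite_eq' , if_pos (Finset.mem_Ioc.mpr ⟨one_pos, hN⟩)]
      rw [h1]
      refine tendsto_finsetSum _ fun n hn => ?_
      split_ifs with hn1
      · subst hn1; simp
      · have hn0 := (Finset.mem_Ioc.mp hn).1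
        have : Filter.Tendsto (fun θ : ℝ => (n : ℝ) ^ (-θ)) Filter.atTop (nhds 0) := by
          have h2 : (1:ℝ) < n := by exact_mod_cast (by omega : 1 < n)
          exact (tendsto_rpow_atBot_of_base_gt_one _ h2).comp Filter.tendsto_neg_atTop_atBot
        simpa using this.const_mul (c n)
    have h1 := hsum (fun n => g n)
    have h2 := hsum (fun n => lam n / Real.log n)
    simp only [hg1, hl1, zero_div] at h1 h2
    simpa using (h1.log one_ne_zero).sub h2
  have h0 := hmono.ge_of_tendsto hlim 0
  have hΦ0 : Φ 0 = ∑ n ∈ Finset.Ioc 0 N, g n := by simp [hΦ]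
  have hP0 : P 0 = ∑ n ∈ Finset.Ioc 0 N, lam n / Real.log n := by simp [hP]
  simp only [hΦ0, hP0] at h0
  rw [← Real.log_le_iff_le_exp (by rw [← hΦ0]; linarith [hΦ1 0])]
  linarith

end ArithmeticFunctionTools

lemma integral_Ioi_id_mul_cexp {z : ℂ} (hz : 0 < z.re) :
    IntegrableOn (fun v : ℝ => (v : ℂ) * Complex.exp (-(z * v))) (Set.Ioi 0) ∧
    ∫ v in Set.Ioi (0:ℝ), (v : ℂ) * Complex.exp (-(z * v)) = 1 / z ^ 2 := by
  have hz0 : z ≠ 0 := by rintro rfl; simp at hz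
  have hint : IntegrableOn (fun v : ℝ => (v : ℂ) * Complex.exp (-(z * v))) (Set.Ioi 0) := by
    have h := Real.GammaIntegral_convergent (s := 2) (by norm_num)
    have h2 : IntegrableOn (fun v : ℝ => v * Real.exp (-(z.re * v))) (Set.Ioi 0) := by
      have := integrableOn_rpow_mul_exp_neg_mul_rpow (p := 1) (s := 1) (b := z.re)
        (by norm_num) one_pos hz
      refine this.congr_fun (fun v hv => ?_) measurableSet_Ioi
      simp
    refine Integrable.mono' h2 (by fun_prop) ?_
    filter_upwards [ae_restrict_mem measurableSet_Ioi] with v hv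
    rw [norm_mul, Complex.norm_exp, Complex.norm_real, Real.norm_of_nonneg (le_of_lt hv)]
    simp
  refine ⟨hint, ?_⟩
  have hderiv : ∀ v ∈ Set.Ici (0:ℝ), HasDerivAt
      (fun v : ℝ => -((v : ℂ) / z + 1 / z ^ 2) * Complex.exp (-(z * v)))
      ((v : ℂ) * Complex.exp (-(z * v))) v := by
    intro v _
    have h1 : HasDerivAt (fun v : ℝ => (v : ℂ)) 1 v := Complex.ofRealCLM.hasDerivAt
    have h2 := (((h1.div_const z).add_const (1 / z ^ 2)).neg).mul ((h1.const_mul z).neg.cexp)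
    refine HasDerivAt.congr_deriv h2 ?_
    simp only [Pi.neg_apply, mul_one]
    field_simp
    ring
  have htend : Filter.Tendsto (fun v : ℝ => -((v : ℂ) / z + 1 / z ^ 2) * Complex.exp (-(z * v)))
      Filter.atTop (nhds 0) := by
    rw [tendsto_zero_iff_norm_tendsto_zero]
    have h1 : Filter.Tendsto (fun v : ℝ => (v ^ (1:ℝ) * Real.exp (-z.re * v)) * ‖(1 / z)‖ +
        (v ^ (0:ℝ) * Real.exp (-z.re * v)) * ‖1 / z ^ 2‖) Filter.atTop (nhds 0) := by
      simpa only [Real.rpow_one, Real.rpow_zero, zero_mul, add_zero] using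
          ((tendsto_rpow_mul_exp_neg_mul_atTop_nhds_zero 1 z.re hz).mul_const ‖(1 / z)‖).add
        ((tendsto_rpow_mul_exp_neg_mul_atTop_nhds_zero 0 z.re hz).mul_const ‖1 / z ^ 2‖)
    refine squeeze_zero' (Filter.Eventually.of_forall fun _ => norm_nonneg _) ?_ h1
    filter_upwards [Filter.eventually_ge_atTop 0] with v hv
    rw [norm_mul, norm_neg, Complex.norm_exp]
    have : (-(z * (v:ℂ))).re = -z.re * v := by simp
    rw [this]
    have h3 : ‖(v : ℂ) / z + 1 / z ^ 2‖ ≤ v * ‖1 / z‖ + ‖1 / z ^ 2‖ := by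
      refine (norm_add_le _ _).trans ?_
      rw [div_eq_mul_one_div, norm_mul, Complex.norm_real, Real.norm_of_nonneg hv]
    calc _ ≤ (v * ‖1 / z‖ + ‖1 / z ^ 2‖) * Real.exp (-z.re * v) := by gcongr
      _ = _ := by rw [Real.rpow_one, Real.rpow_zero]; ring
  rw [integral_Ioi_of_hasDerivAt_of_tendsto' hderiv hint htend]
  simp

/-- The inverse Fourier transform of `(c + it)⁻²`. -/
lemma integral_cexp_div_sq {c : ℝ} (hc : 0 < c) (L : ℝ) :
    ∫ t : ℝ, Complex.exp ((c + t * I) * L) / (c + t * I) ^ 2 =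
        ((2 * Real.pi * max L 0 : ℝ) : ℂ) := by
  set φ : ℝ → ℂ := fun v => (max v 0 : ℝ) * Complex.exp (-(c * v)) with hφ
  have hcont : Continuous φ := by fun_prop
  have hcst : (0:ℝ) < (c : ℂ).re := by simpa
  have hind : ∀ z : ℂ, (fun v : ℝ => (max v 0 : ℝ) * Complex.exp (-(z * v))) =
      Set.indicator (Set.Ioi (0:ℝ)) (fun v : ℝ => (v : ℂ) * Complex.exp (-(z * v))) := by
    intro z
    ext v
    by_cases hv : 0 < v
    · simp [Set.indicator, hv, hv.le]
    · simp [Set.indicator, hv, max_eq_right (not_lt.mp hv)]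
  have hint : Integrable φ := by
    rw [hφ, hind c, integrable_indicator_iff measurableSet_Ioi]
    exact (integral_Ioi_id_mul_cexp hcst).1
  have hF : FourierTransform.fourier φ = fun w : ℝ =>
      1 / ((c : ℂ) + (2 * Real.pi * w : ℝ) * I) ^ 2 := by
    ext w
    rw [Real.fourier_real_eq_integral_exp_smul]
    have hz : 0 < ((c : ℂ) + (2 * Real.pi * w : ℝ) * I).re := by simpa
    rw [← (integral_Ioi_id_mul_cexp hz).2, ← integral_indicator measurableSet_Ioi, ← hind]
    congr 1
    ext v
    simp only [hφ, smul_eq_mul]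
    rw [mul_left_comm, ← Complex.exp_add]
    congr 2
    push_cast
    ring
  have hint2 : Integrable (fun t : ℝ => 1 / ((c : ℂ) + t * I) ^ 2) := by
    have h := (integrable_inv_one_add_sq).comp_div hc.ne'
    refine Integrable.mono' (h.const_mul (1 / c ^ 2)) ?_ (Filter.Eventually.of_forall fun t => ?_)
    · refine Continuous.aestronglyMeasurable ?_
      refine continuous_const.div (by fun_prop) fun t => pow_ne_zero 2 fun h => ?_
      have := congrArg Complex.re h
      simp at this
      exact hc.ne' this
    · rw [norm_div, norm_pow, ← Complex.normSq_eq_norm_sq, Complex.normSq_add_mul_I]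
      simp only [norm_one]
      apply le_of_eq
      field_simp
  have hF2 : Integrable (FourierTransform.fourier φ) := by
    rw [hF]
    exact hint2.comp_mul_left' (g := fun t : ℝ => 1 / ((c : ℂ) + t * I) ^ 2) (by positivity)
  have hinv := congrFun (hcont.fourierInv_fourier_eq hint hF2) L
  rw [hF, Real.fourierInv_eq'] at hinv
  have key : ∫ v : ℝ, Complex.exp (((2 * Real.pi * inner ℝ v L : ℝ) : ℂ) * I) •
      (1 / ((c : ℂ) + (2 * Real.pi * v : ℝ) * I) ^ 2) =
      |(2 * Real.pi)⁻¹| • ∫ t : ℝ, Complex.exp (t * L * I) / ((c : ℂ) + t * I) ^ 2 := by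
    rw [← Measure.integral_comp_mul_left (fun t : ℝ =>
        Complex.exp (t * L * I) / ((c : ℂ) + t * I) ^ 2)
      (2 * Real.pi)]
    congr 1
    ext v
    simp only [smul_eq_mul, mul_one_div]
    congr 3
    simp
    ring
  rw [key, abs_of_pos (by positivity)] at hinv
  have h3 : ∫ t : ℝ, Complex.exp (t * L * I) / ((c : ℂ) + t * I) ^ 2 = 2 * Real.pi * φ L := by
    rw [← hinv, Complex.real_smul, ← mul_assoc]
    have : (Real.pi : ℂ) ≠ 0 := by exact_mod_cast Real.pi_ne_zero
    have h5 : (2 * Real.pi : ℂ) * (((2 * Real.pi)⁻¹ : ℝ) : ℂ) = 1 := by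
      push_cast
      field_simp
    rw [h5, one_mul]
  have h4 : ∀ t : ℝ, Complex.exp ((c + t * I) * L) / (c + t * I) ^ 2 =
      Complex.exp (c * L) * (Complex.exp (t * L * I) / ((c : ℂ) + t * I) ^ 2) := by
    intro t
    rw [← mul_div_assoc, ← Complex.exp_add]
    congr 2
    ring
  simp_rw [h4]
  rw [integral_const_mul, h3, hφ]
  simp only []
  rw [mul_comm, mul_assoc, mul_assoc, mul_assoc, ← Complex.exp_add]
  simp
  ring

lemma norm_integral_cexp_div_sub_le {c T L : ℝ} (hc : 0 < c) (hT : 0 < T) (hL : L ≠ 0) :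
    ‖(∫ t in (-T)..T, Complex.exp ((c + t * I) * L) / (c + t * I)) -
      (if 0 ≤ L then 2 * Real.pi else 0 : ℝ)‖ ≤ 4 * Real.exp (c * L) / (T * |L|) := by
  have hne : ∀ t : ℝ, (c : ℂ) + t * I ≠ 0 := fun t h => by
    have := congrArg Complex.re h
    simp at this
    exact hc.ne' this
  have hLc : (L : ℂ) ≠ 0 := by exact_mod_cast hL
  set g : ℝ → ℂ := fun t => Complex.exp ((c + t * I) * L) / (c + t * I) ^ 2 with hg
  set b : ℝ → ℂ := fun t => Complex.exp ((c + t * I) * L) / (c + t * I) / (I * L) with hb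
  have hgc : Continuous g := Continuous.div (by fun_prop) (by fun_prop)
      fun t => pow_ne_zero 2 (hne t)
  have hfc : Continuous (fun t : ℝ => Complex.exp ((c + t * I) * L) / ((c : ℂ) + t * I)) :=
    Continuous.div (by fun_prop) (by fun_prop) hne
  have hnormexp : ∀ t : ℝ, ‖Complex.exp (((c : ℂ) + t * I) * L)‖ = Real.exp (c * L) := by
    intro t
    rw [Complex.norm_exp]
    simp
  have hnorm2 : ∀ t : ℝ, ‖(c : ℂ) + t * I‖ ^ 2 = c ^ 2 + t ^ 2 := fun t => by
    rw [← Complex.normSq_eq_norm_sq, Complex.normSq_add_mul_I]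
  have hnormT : ∀ t : ℝ, |t| ≤ ‖(c : ℂ) + t * I‖ := fun t => by
    simpa using Complex.abs_im_le_norm ((c : ℂ) + t * I)
  have hgbound : ∀ t : ℝ, ‖g t‖ = Real.exp (c * L) / (c ^ 2 + t ^ 2) := fun t => by
    simp only [hg]
    rw [norm_div, norm_pow, hnormexp, hnorm2]
  have hgint : Integrable g := by
    have h := (integrable_inv_one_add_sq).comp_div hc.ne'
    refine Integrable.mono' (h.const_mul (Real.exp (c * L) / c ^ 2)) hgc.aestronglyMeasurable
      (Filter.Eventually.of_forall fun t => ?_)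
    rw [hgbound]
    apply le_of_eq
    field_simp
  have hderiv : ∀ t ∈ Set.uIcc (-T) T, HasDerivAt b
      (Complex.exp ((c + t * I) * L) / (c + t * I) - g t / L) t := by
    intro t _
    have h1 : HasDerivAt (fun t : ℝ => (c : ℂ) + t * I) I t := by
      have := ((Complex.ofRealCLM.hasDerivAt (x := t)).mul_const I).const_add (c : ℂ)
      simpa using this
    refine (((h1.mul_const (L : ℂ)).cexp.div h1 (hne t)).div_const (I * L)).congr_deriv ?_
    simp only [hg]
    have := hne t
    have := I_ne_zero
    field_simp
  have hFTC := intervalIntegral.integral_eq_sub_of_hasDerivAt hderiv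
    ((hfc.sub (hgc.div_const (L : ℂ))).intervalIntegrable _ _)
  rw [intervalIntegral.integral_sub (hfc.intervalIntegrable _ _)
    ((hgc.div_const (L : ℂ)).intervalIntegrable _ _), intervalIntegral.integral_div] at hFTC
  have hsplit : ∫ t in (-T)..T, g t = (∫ t, g t) -
      ((∫ t in Set.Iic (-T), g t) + ∫ t in Set.Ioi T, g t) := by
    rw [intervalIntegral.integral_of_le (by linarith),
        ← intervalIntegral.integral_Iic_add_Ioi (b := T) hgint.integrableOn hgint.integrableOn,
      ← Set.Iic_union_Ioc_eq_Iic (by linarith : -T ≤ T), setIntegral_union (by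
        exact Set.disjoint_left.mpr fun x hx hx2 => absurd hx2.1 (not_lt.mpr hx)) measurableSet_Ioc
            hgint.integrableOn hgint.integrableOn]
    ring
  have htail1 : ‖∫ t in Set.Ioi T, g t‖ ≤ Real.exp (c * L) / T := by
    have hI := integral_Ioi_rpow_of_lt (a := -2) (by norm_num) hT
    have hI2 := integrableOn_Ioi_rpow_of_lt (a := -2) (by norm_num) hT
    have : ‖∫ t in Set.Ioi T, g t‖ ≤ ∫ t in Set.Ioi T, Real.exp (c * L) * t ^ (-2 : ℝ) := by
      refine norm_integral_le_of_norm_le (hI2.const_mul _) ?_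
      filter_upwards [ae_restrict_mem measurableSet_Ioi] with t ht
      have ht0 : 0 < t := hT.trans ht
      rw [hgbound, div_eq_mul_inv, Real.rpow_neg ht0.le]
      gcongr
      · norm_num
        nlinarith
    refine this.trans ?_
    rw [integral_const_mul, hI]
    norm_num
    rw [Real.rpow_neg_one]
    rfl
  have htail2 : ‖∫ t in Set.Iic (-T), g t‖ ≤ Real.exp (c * L) / T := by
    rw [← integral_comp_neg_Ioi]
    have hI := integral_Ioi_rpow_of_lt (a := -2) (by norm_num) hT
    have hI2 := integrableOn_Ioi_rpow_of_lt (a := -2) (by norm_num) hT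
    have : ‖∫ t in Set.Ioi T, g (-t)‖ ≤ ∫ t in Set.Ioi T, Real.exp (c * L) * t ^ (-2 : ℝ) := by
      refine norm_integral_le_of_norm_le (hI2.const_mul _) ?_
      filter_upwards [ae_restrict_mem measurableSet_Ioi] with t ht
      have ht0 : 0 < t := hT.trans ht
      rw [hgbound, div_eq_mul_inv, Real.rpow_neg ht0.le]
      gcongr
      · norm_num
        nlinarith
    refine this.trans ?_
    rw [integral_const_mul, hI]
    norm_num
    rw [Real.rpow_neg_one]
    rfl
  have hbT : ∀ t : ℝ, |t| = T → ‖b t‖ ≤ Real.exp (c * L) / (T * |L|) := by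
    intro t ht
    simp only [hb]
    rw [norm_div, norm_div, hnormexp, norm_mul, norm_I, one_mul, Complex.norm_real, div_div]
    rw [Real.norm_eq_abs]
    have := abs_pos.mpr hL
    gcongr
    rw [← ht]
    exact hnormT t
  have hmain : (∫ t, g t) / L = (if 0 ≤ L then 2 * Real.pi else 0 : ℝ) := by
    rw [hg, integral_cexp_div_sq hc]
    split_ifs with h
    · rw [max_eq_left h]
      push_cast
      field_simp
    · rw [max_eq_right (not_le.mp h).le]
      simp
  rw [hsplit, sub_div, hmain] at hFTC
  have hfin : (∫ t in (-T)..T, Complex.exp ((c + t * I) * L) / (c + t * I)) -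
      (if 0 ≤ L then 2 * Real.pi else 0 : ℝ) =
      (b T - b (-T)) - ((∫ t in Set.Iic (-T), g t) + ∫ t in Set.Ioi T, g t) / L := by
    linear_combination hFTC
  rw [hfin]
  have hLp := abs_pos.mpr hL
  calc _ ≤ (‖b T‖ + ‖b (-T)‖) + (‖∫ t in Set.Iic (-T), g t‖ + ‖∫ t in Set.Ioi T, g t‖) / |L| := by
        refine (norm_sub_le _ _).trans (add_le_add (norm_sub_le _ _) ?_)
        rw [norm_div, Complex.norm_real, Real.norm_eq_abs]
        gcongr
        exact norm_add_le _ _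
    _ ≤ (Real.exp (c * L) / (T * |L|) + Real.exp (c * L) / (T * |L|)) +
        (Real.exp (c * L) / T + Real.exp (c * L) / T) / |L| := by
        gcongr
        · exact hbT _ (abs_of_pos hT)
        · exact hbT _ (by rw [abs_neg, abs_of_pos hT])
    _ = _ := by field_simp; ring

lemma norm_integral_cexp_div_le {c T L : ℝ} (hc : 0 < c) (hT : 0 < T) (hL : T * |L| ≤ 1) :
    ‖∫ t in (-T)..T, Complex.exp ((c + t * I) * L) / (c + t * I)‖ ≤ 6 * Real.exp (c * L) := by
  set F : ℝ → ℂ := fun t => Complex.exp ((c + t * I) * L) / (c + t * I) with hF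
  have hne : ∀ t : ℝ, (c : ℂ) + t * I ≠ 0 := by
    intro t h
    have := congrArg Complex.re h
    simp at this
    exact hc.ne' this
  have hFc : Continuous F := by
    refine Continuous.div (by fun_prop) (by fun_prop) hne
  have hsym : ∫ t in (-T)..T, F (-t) = ∫ t in (-T)..T, F t := by
    rw [intervalIntegral.integral_comp_neg, neg_neg]
  have htwo : 2 * ∫ t in (-T)..T, F t = ∫ t in (-T)..T, (F t + F (-t)) := by
    have hFn : Continuous fun t => F (-t) := hFc.comp continuous_neg
    rw [intervalIntegral.integral_add (hFc.intervalIntegrable _ _)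
      (hFn.intervalIntegrable _ _), hsym]
    ring
  have hb : ∀ t : ℝ, ‖F t + F (-t)‖ ≤ Real.exp (c * L) * (2 * c / (c ^ 2 + t ^ 2) + 2 * |L|) := by
    intro t
    have hpos : 0 < c ^ 2 + t ^ 2 := by positivity
    have e : F t + F (-t) = ((Real.exp (c * L) * ((2 * c * Real.cos (t * L) +
        2 * t * Real.sin (t * L)) / (c ^ 2 + t ^ 2)) : ℝ) : ℂ) := by
      have h1 := hne t
      have h2 : (c : ℂ) + (-t : ℝ) * I ≠ 0 := hne (-t)
      have h3 : (c : ℂ) ^ 2 + (t : ℂ) ^ 2 ≠ 0 := by exact_mod_cast hpos.ne'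
      have hE : Complex.exp ((c + t * I) * L) =
          Complex.exp (c * L) * (Complex.cos (t * L) + Complex.sin (t * L) * I) := by
        rw [← Complex.exp_mul_I, ← Complex.exp_add]; congr 1; ring
      have hE' : Complex.exp ((c + (-t : ℝ) * I) * L) =
          Complex.exp (c * L) * (Complex.cos (t * L) - Complex.sin (t * L) * I) := by
        have : Complex.cos (t * L) - Complex.sin (t * L) * I =
            Complex.cos (-(t * L)) + Complex.sin (-(t * L)) * I := by
          rw [Complex.cos_neg, Complex.sin_neg]; ring
        rw [this, ← Complex.exp_mul_I, ← Complex.exp_add]; congr 1; push_cast; ring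
      simp only [hF]
      rw [hE, hE', div_add_div _ _ h1 h2]
      push_cast
      have h4 : ((c : ℂ) + t * I) * (c + (-(t:ℂ)) * I) = (c : ℂ) ^ 2 + (t : ℂ) ^ 2 := by
        linear_combination (-(t:ℂ)^2) * Complex.I_sq
      rw [h4, mul_div_assoc']
      congr 1
      linear_combination (-2 * Complex.exp (c * L) * t * Complex.sin (t * L)) * Complex.I_sq
    rw [e, Complex.norm_real, Real.norm_eq_abs, abs_mul, abs_of_pos (Real.exp_pos _)]
    refine mul_le_mul_of_nonneg_left ?_ (Real.exp_pos _).le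
    rw [abs_div, abs_of_pos hpos, div_le_iff₀ hpos, add_mul, div_mul_cancel₀ _ hpos.ne']
    refine (abs_add_le _ _).trans (add_le_add ?_ ?_)
    · rw [abs_mul, abs_of_pos (by positivity : 0 < 2 * c)]
      nlinarith [Real.abs_cos_le_one (t * L)]
    · rw [abs_mul, abs_mul, abs_two]
      have h5 : |Real.sin (t * L)| ≤ |t| * |L| := by
        rw [← abs_mul]; exact Real.abs_sin_le_abs
      calc 2 * |t| * |Real.sin (t * L)| ≤ 2 * |t| * (|t| * |L|) := by gcongr
        _ = 2 * |L| * t ^ 2 := by rw [← sq_abs t]; ring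
        _ ≤ 2 * |L| * (c ^ 2 + t ^ 2) := by gcongr; nlinarith
  have hder : ∀ t ∈ Set.uIcc (-T) T, HasDerivAt
      (fun t => Real.exp (c * L) * (2 * Real.arctan (t / c) + 2 * |L| * t))
      (Real.exp (c * L) * (2 * c / (c ^ 2 + t ^ 2) + 2 * |L|)) t := by
    intro t _
    have h := (((((hasDerivAt_id t).div_const c).arctan).const_mul 2).add
      ((hasDerivAt_id t).const_mul (2 * |L|))).const_mul (Real.exp (c * L))
    refine h.congr_deriv ?_
    simp only [id]
    have hpos : 0 < c ^ 2 + t ^ 2 := by positivity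
    have : 1 + (t / c) ^ 2 ≠ 0 := by positivity
    field_simp
  have hgc : Continuous (fun t : ℝ => Real.exp (c * L) * (2 * c / (c ^ 2 + t ^ 2) + 2 * |L|)) := by
    refine continuous_const.mul (Continuous.add (Continuous.div (by fun_prop) (by fun_prop)
        ?_) continuous_const)
    intro t; positivity
  have hI := intervalIntegral.integral_eq_sub_of_hasDerivAt hder (hgc.intervalIntegrable _ _)
  have h6 : ‖∫ t in (-T)..T, (F t + F (-t))‖ ≤
      ∫ t in (-T)..T, Real.exp (c * L) * (2 * c / (c ^ 2 + t ^ 2) + 2 * |L|) :=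
    intervalIntegral.norm_integral_le_of_norm_le (by linarith)
      (Filter.Eventually.of_forall fun t _ => hb t) (hgc.intervalIntegrable _ _)
  rw [hI, ← htwo, norm_mul, neg_div, Real.arctan_neg] at h6
  have h7 := Real.arctan_lt_pi_div_two (T / c)
  have h8 := Real.pi_lt_four
  simp only [Complex.norm_ofNat] at h6
  have hE := Real.exp_pos (c * L)
  change ‖∫ t in (-T)..T, F t‖ ≤ _
  nlinarith [mul_le_mul_of_nonneg_left hL hE.le, mul_lt_mul_of_pos_left h7 hE]

/-- Truncated Perron formula for a single term, with a bound uniform in all parameters. -/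
lemma norm_perron_kernel_sub_le {c T : ℝ} (L : ℝ) (hc : 0 < c) (hT : 0 < T) :
    ‖(∫ t in (-T)..T, Complex.exp ((c + t * I) * L) / (c + t * I)) -
      (if 0 ≤ L then 2 * Real.pi else 0 : ℝ)‖ ≤ 28 * Real.exp (c * L) / (1 + T * |L|) := by
  have hpos : 0 ≤ T * |L| := by positivity
  rcases le_or_gt (T * |L|) 1 with h | h
  · have h1 := norm_integral_cexp_div_le hc hT h
    have h2 : ‖((if 0 ≤ L then 2 * Real.pi else 0 : ℝ) : ℂ)‖ ≤ 8 * Real.exp (c * L) := by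
      split_ifs with h0
      · rw [Complex.norm_real, Real.norm_of_nonneg (by positivity)]
        have : 1 ≤ Real.exp (c * L) := Real.one_le_exp (by positivity)
        nlinarith [Real.pi_le_four]
      · simp
        positivity
    refine (norm_sub_le _ _).trans ((add_le_add h1 h2).trans ?_)
    rw [le_div_iff₀ (by positivity)]
    nlinarith [Real.exp_pos (c * L)]
  · have hL : L ≠ 0 := by
      rintro rfl
      simp at h
      linarith
    refine (norm_integral_cexp_div_sub_le hc hT hL).trans ?_
    rw [div_le_div_iff₀ (by linarith) (by linarith)]
    nlinarith [Real.exp_pos (c * L)]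

section PrimeSums

open ArithmeticFunction

/-- Partial summation against a nonnegative decreasing weight. -/
lemma sum_mul_le_of_sum_le {a B φ : ℕ → ℝ} (hA : ∀ n, ∑ k ∈ Finset.Ioc 0 n, a k ≤ B n)
    (hφ : ∀ n, 1 ≤ n → φ (n + 1) ≤ φ n) (M : ℕ) (hφ0 : 0 ≤ φ (max M 1)) :
    ∑ n ∈ Finset.Ioc 0 M, a n * φ n ≤
      B 0 * φ 1 + ∑ n ∈ Finset.Ioc 0 M, (B n - B (n - 1)) * φ n := by
  have key : ∑ n ∈ Finset.Ioc 0 M, a n * φ n ≤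
      B 0 * φ 1 + ∑ n ∈ Finset.Ioc 0 M, (B n - B (n - 1)) * φ n -
      (B M - ∑ n ∈ Finset.Ioc 0 M, a n) * φ (max M 1) := by
    clear hφ0
    induction M with
    | zero => simp
    | succ M ih =>
      rw [Finset.sum_Ioc_succ_top (Nat.zero_le M), Finset.sum_Ioc_succ_top (Nat.zero_le M),
        Finset.sum_Ioc_succ_top (Nat.zero_le M), Nat.add_sub_cancel, max_eq_left (by omega)]
      have h1 : φ (M + 1) ≤ φ (max M 1) := by
        rcases Nat.eq_zero_or_pos M with rfl | h
        · simp
        · rw [max_eq_left h]; exact hφ M h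
      nlinarith [mul_le_mul_of_nonneg_left h1 (sub_nonneg.mpr (hA M))]
  have := mul_nonneg (sub_nonneg.mpr (hA M)) hφ0
  linarith

lemma sum_vonMangoldt_le (N : ℕ) : ∑ n ∈ Finset.Ioc 0 N, Λ n ≤ 6 * N := by
  have h := Chebyshev.psi_le_const_mul_self (Nat.cast_nonneg (α := ℝ) N)
  rw [Chebyshev.psi, Nat.floor_natCast] at h
  refine h.trans (mul_le_mul_of_nonneg_right ?_ (Nat.cast_nonneg N))
  have : Real.log 4 = 2 * Real.log 2 := by
    rw [show (4:ℝ) = 2 ^ 2 by norm_num, Real.log_pow]; norm_num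
  linarith [Real.log_two_lt_d9]

lemma sum_vonMangoldt_mul_le {φ : ℕ → ℝ} (hφ : ∀ n, 1 ≤ n → φ (n + 1) ≤ φ n)
    (hφ0 : ∀ n, 0 ≤ φ n) (M : ℕ) :
    ∑ n ∈ Finset.Ioc 0 M, Λ n * φ n ≤ 6 * ∑ n ∈ Finset.Ioc 0 M, φ n := by
  refine (sum_mul_le_of_sum_le (B := fun n => 6 * (n : ℝ)) sum_vonMangoldt_le hφ M
    (hφ0 _)).trans (le_of_eq ?_)
  rw [Nat.cast_zero, mul_zero, zero_mul, zero_add, Finset.mul_sum]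
  refine Finset.sum_congr rfl fun n hn => ?_
  rw [Nat.cast_pred (Finset.mem_Ioc.mp hn).1]
  ring

/-- Mertens' upper bound. -/
lemma sum_vonMangoldt_div_le (N : ℕ) :
    ∑ n ∈ Finset.Ioc 0 N, Λ n / n ≤ Real.log N + 6 := by
  rcases Nat.eq_zero_or_pos N with rfl | hN
  · simp
  have h1 := sum_Ioc_mul_zeta_eq_sum Λ N
  rw [vonMangoldt_mul_zeta] at h1
  have h2 : ∑ n ∈ Finset.Ioc 0 N, ArithmeticFunction.log n ≤ N * Real.log N := by
    calc _ ≤ ∑ n ∈ Finset.Ioc 0 N, Real.log N := Finset.sum_le_sum fun n hn => by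
          obtain ⟨h, h'⟩ := Finset.mem_Ioc.mp hn
          rw [ArithmeticFunction.log_apply]
          exact Real.log_le_log (by exact_mod_cast h) (by exact_mod_cast h')
      _ = _ := by simp
  have h3 : ∑ n ∈ Finset.Ioc 0 N, Λ n * (N / n - 1 : ℝ) ≤ N * Real.log N := by
    rw [h1] at h2
    refine le_trans (Finset.sum_le_sum fun n hn => ?_) h2
    have hn0 : (0:ℝ) < n := by exact_mod_cast (Finset.mem_Ioc.mp hn).1
    refine mul_le_mul_of_nonneg_left ?_ vonMangoldt_nonneg
    rw [← Nat.floor_div_eq_div (K := ℝ)]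
    linarith [Nat.lt_floor_add_one ((N:ℝ) / n)]
  have h4 : ∑ n ∈ Finset.Ioc 0 N, Λ n * (N / n - 1 : ℝ) =
      N * (∑ n ∈ Finset.Ioc 0 N, Λ n / n) - ∑ n ∈ Finset.Ioc 0 N, Λ n := by
    rw [Finset.mul_sum, ← Finset.sum_sub_distrib]
    refine Finset.sum_congr rfl fun n _ => by ring
  have hN0 : (0:ℝ) < N := by exact_mod_cast hN
  have h5 := sum_vonMangoldt_le N
  have : (N:ℝ) * (∑ n ∈ Finset.Ioc 0 N, Λ n / n) ≤ N * (Real.log N + 6) := by nlinarith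
  exact le_of_mul_le_mul_left this hN0

lemma log_sub_log_mul_rpow_le {θ a b : ℝ} (hθ : 0 < θ) (ha : 0 < a) (hab : a ≤ b) :
    (Real.log b - Real.log a) * b ^ (-θ) ≤ (a ^ (-θ) - b ^ (-θ)) / θ := by
  have hb := ha.trans_le hab
  rw [le_div_iff₀ hθ]
  have h1 : a ^ (-θ) = Real.exp (θ * (Real.log b - Real.log a)) * b ^ (-θ) := by
    rw [Real.rpow_def_of_pos ha, Real.rpow_def_of_pos hb, ← Real.exp_add]
    ring_nf
  have h2 := Real.add_one_le_exp (θ * (Real.log b - Real.log a))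
  have h3 := Real.rpow_pos_of_pos hb (-θ)
  rw [h1]
  nlinarith

lemma sum_Ioc_sub_pred (W : ℕ → ℝ) {m M : ℕ} (h : m ≤ M) :
    ∑ n ∈ Finset.Ioc m M, (W n - W (n - 1)) = W M - W m := by
  induction M, h using Nat.le_induction with
  | base => simp
  | succ M hM ih => rw [Finset.sum_Ioc_succ_top hM, ih, Nat.add_sub_cancel]; ring

/-- The upper bound `log ζ(1 + θ) ≤ log (1 / θ) + O(1)`, for truncated sums. -/
lemma sum_vonMangoldt_div_log_le {θ : ℝ} (hθ : 0 < θ) (hθ1 : θ ≤ 1) (M : ℕ) :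
    ∑ n ∈ Finset.Ioc 0 M, Λ n / Real.log n * (n : ℝ) ^ (-1 - θ) ≤ Real.log (1 / θ) + 12 := by
  have hl2 := Real.log_two_gt_d9
  have hl2' := Real.log_two_lt_d9
  have hlθ : 0 ≤ Real.log (1 / θ) := Real.log_nonneg (by rw [le_div_iff₀ hθ]; linarith)
  set φ : ℕ → ℝ := fun n => ((max n 2 : ℕ) : ℝ) ^ (-θ) / Real.log (max n 2 : ℕ) with hφdef
  have hφ0 : ∀ n, 0 ≤ φ n := fun n => by positivity
  have hφ : ∀ n, 1 ≤ n → φ (n + 1) ≤ φ n := by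
    intro n _
    have h1 : (2:ℝ) ≤ (max n 2 : ℕ) := by exact_mod_cast le_max_right n 2
    have h2 : ((max n 2 : ℕ) : ℝ) ≤ (max (n + 1) 2 : ℕ) := by
      exact_mod_cast max_le_max (Nat.le_succ n) le_rfl
    have h3 : 0 < Real.log (max n 2 : ℕ) := Real.log_pos (by linarith)
    exact div_le_div₀ (by positivity) (Real.rpow_le_rpow_of_nonpos (by linarith) h2 (by linarith))
      h3 (Real.log_le_log (by linarith) h2)
  have hφ1 : φ 1 ≤ 3 / 2 := by
    simp only [hφdef, show max 1 2 = 2 from rfl, Nat.cast_ofNat]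
    rw [div_le_iff₀ (by linarith)]
    have : (2:ℝ) ^ (-θ) ≤ 1 := Real.rpow_le_one_of_one_le_of_nonpos (by norm_num) (by linarith)
    linarith
  have h1 := sum_mul_le_of_sum_le (a := fun n => Λ n / n) (B := fun n => Real.log n + 6)
    sum_vonMangoldt_div_le hφ M (hφ0 _)
  have h2 : ∑ n ∈ Finset.Ioc 0 M, Λ n / Real.log n * (n : ℝ) ^ (-1 - θ) =
      ∑ n ∈ Finset.Ioc 0 M, Λ n / n * φ n := by
    refine Finset.sum_congr rfl fun n hn => ?_
    have hn0 := (Finset.mem_Ioc.mp hn).1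
    rcases eq_or_ne n 1 with rfl | hn1
    · simp
    · simp only [hφdef]
      rw [max_eq_left (by omega), sub_eq_add_neg, Real.rpow_add (by exact_mod_cast hn0),
        Real.rpow_neg_one]
      ring
  rw [h2]
  refine h1.trans ?_
  set V : ℕ → ℝ := fun n => min (Real.log (Real.log n)) (Real.log (1 / θ)) - (n : ℝ) ^ (-θ)
  have hterm : ∀ n : ℕ, 3 ≤ n → (Real.log n - Real.log (n - 1 : ℕ)) * φ n ≤ V n - V (n - 1) := by
    intro n hn
    have hn1 : (2:ℝ) ≤ (n - 1 : ℕ) := by exact_mod_cast (by omega : 2 ≤ n - 1)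
    have hn2 : ((n - 1 : ℕ) : ℝ) ≤ n := by exact_mod_cast Nat.sub_le n 1
    have hl1 : 0 < Real.log (n - 1 : ℕ) := Real.log_pos (by linarith)
    have hl3 : Real.log (n - 1 : ℕ) ≤ Real.log n := Real.log_le_log (by linarith) hn2
    have hl0 : 0 < Real.log n := by linarith
    have hll : Real.log (Real.log (n - 1 : ℕ)) ≤ Real.log (Real.log n) := Real.log_le_log hl1 hl3
    have hr : (n : ℝ) ^ (-θ) ≤ ((n - 1 : ℕ) : ℝ) ^ (-θ) :=
      Real.rpow_le_rpow_of_nonpos (by linarith) hn2 (by linarith)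
    simp only [hφdef, V, max_eq_left (by omega : 2 ≤ n)]
    have hrle : (n : ℝ) ^ (-θ) ≤ 1 :=
      Real.rpow_le_one_of_one_le_of_nonpos (by linarith) (by linarith)
    have hr0 : 0 ≤ (n : ℝ) ^ (-θ) := by positivity
    rcases le_or_gt (θ * Real.log n) 1 with h | h
    · have e1 : Real.log (Real.log n) ≤ Real.log (1 / θ) :=
        Real.log_le_log hl0 (by rw [le_div_iff₀ hθ]; linarith)
      rw [min_eq_left e1, min_eq_left (hll.trans e1)]
      have e2 : (Real.log n - Real.log (n - 1 : ℕ)) / Real.log n ≤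
          Real.log (Real.log n) - Real.log (Real.log (n - 1 : ℕ)) := by
        have := Real.log_le_sub_one_of_pos (div_pos hl1 hl0)
        rw [Real.log_div hl1.ne' hl0.ne'] at this
        rw [sub_div, div_self hl0.ne']
        linarith
      have e3 : (Real.log n - Real.log (n - 1 : ℕ)) * ((n : ℝ) ^ (-θ) / Real.log n) ≤
          (Real.log n - Real.log (n - 1 : ℕ)) / Real.log n := by
        rw [mul_div_assoc']
        gcongr
        nlinarith
      linarith
    · have e1 : min (Real.log (Real.log (n - 1 : ℕ))) (Real.log (1 / θ)) ≤
        min (Real.log (Real.log n)) (Real.log (1 / θ)) := min_le_min_right _ hll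
      have e2 := log_sub_log_mul_rpow_le hθ (by linarith : (0:ℝ) < (n - 1 : ℕ)) hn2
      have e3 : (Real.log n - Real.log (n - 1 : ℕ)) * ((n : ℝ) ^ (-θ) / Real.log n) ≤
          ((n - 1 : ℕ) : ℝ) ^ (-θ) - (n : ℝ) ^ (-θ) := by
        rw [le_div_iff₀ hθ] at e2
        rw [mul_div_assoc', div_le_iff₀ hl0]
        have e4 : 0 ≤ (Real.log n - Real.log (n - 1 : ℕ)) * (n : ℝ) ^ (-θ) :=
          mul_nonneg (by linarith) hr0
        nlinarith
      linarith
  have hsum : ∑ n ∈ Finset.Ioc 0 M, (Real.log (n : ℕ) + 6 - (Real.log (n - 1 : ℕ) + 6)) * φ n ≤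
      Real.log (1 / θ) + 3 := by
    rcases le_or_gt M 2 with hM | hM
    · have : ∑ n ∈ Finset.Ioc 0 M, (Real.log (n : ℕ) + 6 - (Real.log (n - 1 : ℕ) + 6)) * φ n ≤
          ∑ n ∈ Finset.Ioc 0 2, (Real.log (n : ℕ) + 6 - (Real.log (n - 1 : ℕ) + 6)) * φ n := by
        refine Finset.sum_le_sum_of_subset_of_nonneg (Finset.Ioc_subset_Ioc_right hM)
          fun n hn _ => mul_nonneg ?_ (hφ0 n)
        obtain ⟨h3, h4⟩ := Finset.mem_Ioc.mp hn
        interval_cases n <;> norm_num; linarith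
      refine this.trans (le_trans (b := 3 / 2) ?_ (by linarith))
      rw [show Finset.Ioc 0 2 = {1, 2} from rfl, Finset.sum_pair (by norm_num)]
      have : φ 2 = φ 1 := rfl
      norm_num [this]
      nlinarith [hφ0 1]
    · rw [← Finset.sum_Ioc_consecutive _ (Nat.zero_le 2) hM.le]
      have e1 : ∑ n ∈ Finset.Ioc 0 2,
          (Real.log (n : ℕ) + 6 - (Real.log (n - 1 : ℕ) + 6)) * φ n ≤ 3 / 2 := by
        rw [show Finset.Ioc 0 2 = {1, 2} from rfl, Finset.sum_pair (by norm_num)]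
        have : φ 2 = φ 1 := rfl
        norm_num [this]
        nlinarith [hφ0 1]
      have e2 : ∑ n ∈ Finset.Ioc 2 M, (Real.log (n : ℕ) + 6 - (Real.log (n - 1 : ℕ) + 6)) * φ n ≤
          V M - V 2 := by
        rw [← sum_Ioc_sub_pred V hM.le]
        refine Finset.sum_le_sum fun n hn => ?_
        have := hterm n (Finset.mem_Ioc.mp hn).1
        rwa [add_sub_add_right_eq_sub]
      have e3 : V M ≤ Real.log (1 / θ) := by
        have : 0 ≤ (M : ℝ) ^ (-θ) := by positivity
        have := min_le_right (Real.log (Real.log M)) (Real.log (1 / θ))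
        simp only [V]; linarith
      have e4 : -(3 / 2) ≤ V 2 := by
        have h2 : (2:ℝ) ^ (-θ) ≤ 1 :=
            Real.rpow_le_one_of_one_le_of_nonpos (by norm_num) (by linarith)
        have h3 : -(1 / 2) ≤ Real.log (Real.log 2) := by
          have := Real.one_sub_inv_le_log_of_pos (by linarith : 0 < Real.log 2)
          have h4 : (Real.log 2)⁻¹ ≤ 3 / 2 := by
            rw [inv_le_comm₀ (by linarith) (by norm_num)]; linarith
          linarith
        have h5 : -(1 / 2) ≤ min (Real.log (Real.log 2)) (Real.log (1 / θ)) :=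
          le_min h3 (by linarith)
        simp only [V, Nat.cast_ofNat]
        linarith
      linarith
  simp only [Nat.cast_zero, Real.log_zero, zero_add]
  linarith

lemma sum_Ioc_le_add {u W : ℕ → ℝ} (h : ∀ n, 2 ≤ n → u n ≤ W n - W (n - 1)) {M : ℕ} (hM : 1 ≤ M) :
    ∑ n ∈ Finset.Ioc 0 M, u n ≤ u 1 + (W M - W 1) := by
  rw [← Finset.sum_Ioc_consecutive _ (Nat.zero_le 1) hM, ← sum_Ioc_sub_pred W hM]
  refine add_le_add (by simp) (Finset.sum_le_sum fun n hn => h n (Finset.mem_Ioc.mp hn).1)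

lemma one_div_le_log_sub_log {n : ℕ} (hn : 2 ≤ n) :
    1 / (n : ℝ) ≤ Real.log n - Real.log (n - 1 : ℕ) := by
  have h1 : (1:ℝ) ≤ (n - 1 : ℕ) := by exact_mod_cast (by omega : 1 ≤ n - 1)
  have h0 : (0:ℝ) < n := by exact_mod_cast (by omega : 0 < n)
  rw [← Real.log_div h0.ne' (by linarith)]
  have := Real.one_sub_inv_le_log_of_pos (div_pos h0 (by linarith : (0:ℝ) < (n - 1 : ℕ)))
  rw [inv_div, Nat.cast_pred (by omega), sub_div, div_self h0.ne'] at this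
  rw [Nat.cast_pred (by omega)]
  linarith

lemma sum_rpow_neg_one_sub_le {θ : ℝ} (hθ : 0 < θ) (M : ℕ) :
    ∑ n ∈ Finset.Ioc 0 M, (n : ℝ) ^ (-1 - θ) ≤ 1 + 1 / θ := by
  rcases Nat.eq_zero_or_pos M with rfl | hM
  · simp; positivity
  have := sum_Ioc_le_add (u := fun n => (n : ℝ) ^ (-1 - θ))
      (W := fun n => -((n : ℝ) ^ (-θ) / θ)) ?_ hM
  · refine this.trans ?_
    have h : 0 ≤ (M : ℝ) ^ (-θ) / θ := by positivity
    simp only [Nat.cast_one, Real.one_rpow]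
    linarith
  · intro n hn
    have h0 : (0:ℝ) < n := by exact_mod_cast (by omega : 0 < n)
    have h1 : (0:ℝ) < (n - 1 : ℕ) := by exact_mod_cast (by omega : 0 < n - 1)
    have h2 := log_sub_log_mul_rpow_le hθ h1
        (by exact_mod_cast Nat.sub_le n 1 : ((n - 1 : ℕ) : ℝ) ≤ n)
    have h3 := one_div_le_log_sub_log hn
    rw [sub_eq_add_neg, Real.rpow_add h0, Real.rpow_neg_one, ← one_div]
    have := mul_le_mul_of_nonneg_right h3 (Real.rpow_nonneg h0.le (-θ))
    rw [sub_div] at h2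
    linarith

lemma sum_one_div_le {M : ℕ} (hM : 1 ≤ M) :
    ∑ n ∈ Finset.Ioc 0 M, 1 / (n : ℝ) ≤ 1 + Real.log M := by
  have := sum_Ioc_le_add (u := fun n => 1 / (n : ℝ)) (W := fun n => Real.log n)
    (fun n hn => one_div_le_log_sub_log hn) hM
  simpa using this

lemma sum_rpow_neg_one_add_le {β L : ℝ} (hβ : 0 ≤ β) (hβ1 : β ≤ 1) (hL : 1 ≤ L) {M : ℕ}
    (hM : 1 ≤ M) (hML : Real.log M ≤ L) :
    ∑ n ∈ Finset.Ioc 0 M, (n : ℝ) ^ (-1 + β) ≤ 4 * (M : ℝ) ^ β / (β + 1 / L) := by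
  have hM1 : (1:ℝ) ≤ M := by exact_mod_cast hM
  have hMβ : 1 ≤ (M : ℝ) ^ β := Real.one_le_rpow hM1 hβ
  have hL0 : 0 < L := by linarith
  rw [le_div_iff₀ (by positivity)]
  rcases le_or_gt β (1 / L) with h | h
  · have h1 : ∑ n ∈ Finset.Ioc 0 M, (n : ℝ) ^ (-1 + β) ≤ (M : ℝ) ^ β * (1 + Real.log M) := by
      refine le_trans ?_ (mul_le_mul_of_nonneg_left (sum_one_div_le hM) (by positivity))
      rw [Finset.mul_sum]
      refine Finset.sum_le_sum fun n hn => ?_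
      obtain ⟨h2, h3⟩ := Finset.mem_Ioc.mp hn
      rw [Real.rpow_add (by exact_mod_cast h2), Real.rpow_neg_one, one_div, mul_comm]
      gcongr
    have h2 : (M : ℝ) ^ β * (1 + Real.log M) ≤ (M : ℝ) ^ β * (2 * L) := by
      gcongr; linarith
    calc _ ≤ ((M : ℝ) ^ β * (2 * L)) * (β + 1 / L) := by gcongr; exact h1.trans h2
      _ ≤ ((M : ℝ) ^ β * (2 * L)) * (1 / L + 1 / L) := by gcongr
      _ = 4 * (M : ℝ) ^ β := by field_simp; norm_num
  · have hβ0 : 0 < β := lt_trans (by positivity) h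
    have h1 := sum_Ioc_le_add (u := fun n => (n : ℝ) ^ (-1 + β))
        (W := fun n => (n : ℝ) ^ β / β) ?_ hM
    · simp only [Nat.cast_one, Real.one_rpow] at h1
      have h2 : 1 ≤ 1 / β := by rw [le_div_iff₀ hβ0]; linarith
      calc _ ≤ ((M : ℝ) ^ β / β) * (β + β) := by
            gcongr
            linarith
        _ = 2 * (M : ℝ) ^ β := by field_simp; norm_num
        _ ≤ _ := by linarith
    · intro n hn
      have h0 : (0:ℝ) < n := by exact_mod_cast (by omega : 0 < n)
      have h2 : (1:ℝ) ≤ n := by exact_mod_cast (by omega : 1 ≤ n)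
      have h3 := rpow_one_add_le_one_add_mul_self (s := -(1 / (n : ℝ))) (p := β)
        (by rw [neg_le_neg_iff, div_le_one h0]; exact h2) hβ hβ1
      have h4 : ((n - 1 : ℕ) : ℝ) ^ β = (n : ℝ) ^ β * (1 + -(1 / (n : ℝ))) ^ β := by
        rw [← Real.mul_rpow h0.le (by rw [← sub_eq_add_neg, sub_nonneg, div_le_one h0]; exact h2),
          Nat.cast_pred (by omega)]
        congr 1
        field_simp
        ring
      rw [Real.rpow_add h0, Real.rpow_neg_one, ← sub_div, le_div_iff₀ hβ0, h4]
      have h5 := mul_le_mul_of_nonneg_left h3 (Real.rpow_nonneg h0.le β)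
      have e : (n : ℝ) ^ β * (1 + β * -(1 / (n : ℝ))) =
          (n : ℝ) ^ β - (n : ℝ)⁻¹ * (n : ℝ) ^ β * β := by
        rw [one_div]; ring
      linarith

lemma vonMangoldt_div_log_le_one (n : ℕ) : Λ n / Real.log n ≤ 1 :=
  div_le_one_of_le₀ vonMangoldt_le_log (Real.log_natCast_nonneg n)

lemma vonMangoldt_div_log_nonneg (n : ℕ) : 0 ≤ Λ n / Real.log n :=
  div_nonneg vonMangoldt_nonneg (Real.log_natCast_nonneg n)

lemma log_le_two_mul_sqrt {Z : ℝ} (hZ : 0 < Z) : Real.log Z ≤ 2 * √Z := by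
  have := Real.log_le_sub_one_of_pos (Real.sqrt_pos.mpr hZ)
  rw [Real.log_sqrt hZ.le] at this
  linarith

/-- Chebyshev's bound for the prime power counting function. -/
lemma sum_vonMangoldt_div_log_le_div {Z : ℝ} (hZ : 1 < Z) :
    ∑ n ∈ Finset.Ioc 0 ⌊Z⌋₊, Λ n / Real.log n ≤ 14 * (Z / Real.log Z) := by
  have hZ0 : 0 < Z := by linarith
  have hl : 0 < Real.log Z := Real.log_pos hZ
  have hs : 1 < √Z := by rw [Real.lt_sqrt (by norm_num)]; linarith
  have hss := Real.mul_self_sqrt hZ0.le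
  have h1 : ∀ n ∈ Finset.Ioc 0 ⌊Z⌋₊, Λ n / Real.log n ≤
      (if n ∈ Finset.Ioc 0 ⌊√Z⌋₊ then 1 else 0) + 2 / Real.log Z * Λ n := by
    intro n hn
    have hΛ : 0 ≤ Λ n := vonMangoldt_nonneg
    split_ifs with h
    · have := vonMangoldt_div_log_le_one n
      have : 0 ≤ 2 / Real.log Z * Λ n := by positivity
      linarith
    · have hn0 := (Finset.mem_Ioc.mp hn).1
      have h2 : √Z < n := by
        by_contra h3
        exact h (Finset.mem_Ioc.mpr ⟨hn0, Nat.le_floor (not_lt.mp h3)⟩)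
      have h3 : Real.log Z / 2 ≤ Real.log n := by
        rw [← Real.log_sqrt hZ0.le]
        exact Real.log_le_log (by linarith) h2.le
      rw [zero_add, div_eq_mul_inv, mul_comm]
      gcongr
      rw [inv_le_comm₀ (by linarith) (by positivity), inv_div]
      exact h3
  refine (Finset.sum_le_sum h1).trans ?_
  rw [Finset.sum_add_distrib, ← Finset.mul_sum, Finset.sum_ite_mem,
    Finset.inter_eq_right.mpr (Finset.Ioc_subset_Ioc_right (Nat.floor_mono (by nlinarith)))]
  have h2 := sum_vonMangoldt_le ⌊Z⌋₊
  have h3 : (⌊Z⌋₊ : ℝ) ≤ Z := Nat.floor_le hZ0.le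
  have h4 : (⌊√Z⌋₊ : ℝ) ≤ √Z := Nat.floor_le (by positivity)
  have h5 : √Z ≤ 2 * (Z / Real.log Z) := by
    rw [mul_div_assoc', le_div_iff₀ hl]
    nlinarith [log_le_two_mul_sqrt hZ0]
  have h6 : 2 / Real.log Z * ∑ n ∈ Finset.Ioc 0 ⌊Z⌋₊, Λ n ≤ 2 / Real.log Z * (6 * Z) := by
    gcongr
    linarith
  have h7 : 2 / Real.log Z * (6 * Z) = 12 * (Z / Real.log Z) := by ring
  simp only [Finset.sum_const, Nat.card_Ioc, nsmul_eq_mul, mul_one, tsub_zero]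
  linarith

end PrimeSums

section SmoothRough

open ArithmeticFunction

lemma log_ge_of_ten_le {y : ℝ} (hy : 10 ≤ y) : 2.3 ≤ Real.log y := by
  refine le_trans ?_ (Real.log_le_log (by norm_num) hy)
  rw [Real.le_log_iff_exp_le (by norm_num), show (2.3:ℝ) = 23 * (1 / 10) by norm_num,
    Real.exp_mul, ← Real.le_rpow_inv_iff_of_pos (by positivity) (by norm_num) (by norm_num)]
  have : Real.exp 23 = Real.exp 1 ^ 23 := by rw [← Real.exp_nat_mul]; norm_num
  rw [this, show ((1 / 10 : ℝ))⁻¹ = (10 : ℕ) by norm_num, Real.rpow_natCast]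
  calc Real.exp 1 ^ 23 ≤ 2.7182818286 ^ 23 := by gcongr; exact Real.exp_one_lt_d9.le
    _ ≤ _ := by norm_num

lemma inv_log_le {y : ℝ} (hy : 10 ≤ y) : 1 / Real.log y ≤ 0.435 := by
  have := log_ge_of_ten_le hy
  rw [div_le_iff₀ (by linarith)]
  linarith

/-- Higher powers of primes `p ≤ y` contribute `O(1)` even slightly to the left of the line `1`. -/
lemma sum_prime_pow_rpow_le {y σ : ℝ} (hy : 10 ≤ y) (hσ : σ = 1 - 2 * (1 / Real.log y)) (N : ℕ) :
    ∑ d ∈ (Finset.Icc 2 ⌊y⌋₊ ×ˢ Finset.Ico 2 (N + 1)).image (fun q : ℕ × ℕ => q.1 ^ q.2),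
      (d : ℝ) ^ (-σ) ≤ 25 * Real.exp 4 := by
  have hly := log_ge_of_ten_le hy
  have hσ1 : 0.13 ≤ σ := by have := inv_log_le hy; linarith
  refine (Finset.sum_image_le_of_nonneg fun _ _ => by positivity).trans ?_
  rw [Finset.sum_product]
  have h1 : ∀ p ∈ Finset.Icc 2 ⌊y⌋₊, ∑ k ∈ Finset.Ico 2 (N + 1), ((p ^ k : ℕ) : ℝ) ^ (-σ) ≤
      12.5 * Real.exp 4 * (p : ℝ) ^ ((-1:ℝ) - 1) := by
    intro p hp
    obtain ⟨hp2, hpy⟩ := Finset.mem_Icc.mp hp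
    have hp2' : (2:ℝ) ≤ p := by exact_mod_cast hp2
    have hp0 : (0:ℝ) < p := by linarith
    have hpy' : (p:ℝ) ≤ y := (Nat.cast_le.mpr hpy).trans (Nat.floor_le (by linarith))
    have hr : (p : ℝ) ^ (-σ) ≤ 0.92 := by
      calc (p : ℝ) ^ (-σ) ≤ 2 ^ (-σ) :=
            Real.rpow_le_rpow_of_nonpos (by norm_num) hp2' (by linarith)
        _ ≤ 2 ^ (-0.13 : ℝ) := Real.rpow_le_rpow_of_exponent_le (by norm_num) (by linarith)
        _ = (Real.exp (0.13 * Real.log 2))⁻¹ := by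
            rw [Real.rpow_def_of_pos (by norm_num), ← Real.exp_neg]; ring_nf
        _ ≤ 0.92 := by
            have h2 := Real.log_two_gt_d9
            have h3 := Real.add_one_le_exp (0.13 * Real.log 2)
            rw [inv_le_comm₀ (Real.exp_pos _) (by norm_num)]
            norm_num at *
            linarith
    have hr0 : 0 ≤ (p : ℝ) ^ (-σ) := by positivity
    have e1 : ∀ k ∈ Finset.Ico 2 (N + 1), ((p ^ k : ℕ) : ℝ) ^ (-σ) = ((p : ℝ) ^ (-σ)) ^ k := by
      intro k _
      push_cast
      rw [← Real.rpow_natCast, ← Real.rpow_natCast, ← Real.rpow_mul hp0.le, ← Real.rpow_mul hp0.le,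
        mul_comm]
    rw [Finset.sum_congr rfl e1]
    refine (geom_sum_Ico_le_of_lt_one hr0 (by linarith)).trans ?_
    have h4 : ((p : ℝ) ^ (-σ)) ^ 2 ≤ Real.exp 4 * (p : ℝ) ^ ((-1:ℝ) - 1) := by
      rw [← Real.rpow_natCast, ← Real.rpow_mul hp0.le, Real.rpow_def_of_pos hp0,
        Real.rpow_def_of_pos hp0, ← Real.exp_add]
      refine Real.exp_le_exp.mpr ?_
      have h5 : Real.log p * (1 / Real.log y) ≤ 1 := by
        rw [mul_one_div, div_le_one (by linarith)]
        exact Real.log_le_log hp0 hpy'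
      rw [hσ]; push_cast
      linarith
    rw [div_le_iff₀ (by linarith)]
    have h6 : 0 ≤ Real.exp 4 * (p : ℝ) ^ ((-1:ℝ) - 1) := by positivity
    have h7 := mul_le_mul_of_nonneg_left hr h6
    generalize (p : ℝ) ^ ((-1:ℝ) - 1) = P at *
    norm_num at *
    linarith
  refine (Finset.sum_le_sum h1).trans ?_
  rw [← Finset.mul_sum]
  have h2 : ∑ p ∈ Finset.Icc 2 ⌊y⌋₊, (p : ℝ) ^ ((-1:ℝ) - 1) ≤ 2 := by
    refine le_trans ?_ ((sum_rpow_neg_one_sub_le one_pos ⌊y⌋₊).trans (by norm_num))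
    refine Finset.sum_le_sum_of_subset_of_nonneg (fun p hp => ?_) fun _ _ _ => by positivity
    have := Finset.mem_Icc.mp hp
    exact Finset.mem_Ioc.mpr ⟨by omega, this.2⟩
  refine (mul_le_mul_of_nonneg_left h2 (by positivity)).trans (le_of_eq ?_)
  ring

lemma rpow_sub_rpow_neg_le {d η θ : ℝ} (hd : 1 ≤ d) (hη : 0 ≤ η) (hθ : θ ≤ η)
    (h : η * Real.log d ≤ 1) :
    d ^ (2 * η) - d ^ (-θ) ≤ (2 * Real.exp 2 + 1) * η * Real.log d := by
  have hd0 : 0 < d := by linarith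
  have hl : 0 ≤ Real.log d := Real.log_nonneg hd
  rw [Real.rpow_def_of_pos hd0, Real.rpow_def_of_pos hd0]
  have h1 := Real.add_one_le_exp (Real.log d * -θ)
  have h2 : Real.exp (Real.log d * (2 * η)) - 1 ≤ 2 * (η * Real.log d) * Real.exp 2 := by
    have h3 := Real.one_sub_le_exp_neg (Real.log d * (2 * η))
    have h4 : Real.exp (Real.log d * (2 * η)) ≤ Real.exp 2 := Real.exp_le_exp.mpr (by linarith)
    have h5 : Real.exp (Real.log d * (2 * η)) * Real.exp (-(Real.log d * (2 * η))) = 1 := by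
      rw [← Real.exp_add]; simp
    have h6 : 0 ≤ Real.log d * (2 * η) := by positivity
    have h7 := Real.exp_pos (Real.log d * (2 * η))
    nlinarith
  nlinarith

/-- The von Mangoldt sum over `y`-smooth prime powers changes by `O(1)` between the abscissae
`1 - 2 / log y` and `1 + θ`, `θ ≤ 1 / log y`. -/
lemma sum_smooth_vonMangoldt_le {y θ : ℝ} (hy : 10 ≤ y) (hθ : θ ≤ 1 / Real.log y) (N : ℕ) :
    ∑ d ∈ Finset.Ioc 0 N, restrictPrimes (fun p => (p : ℝ) ≤ y) Λ d / Real.log d *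
        (d : ℝ) ^ (-(1 - 2 * (1 / Real.log y))) ≤
      ∑ d ∈ Finset.Ioc 0 N, restrictPrimes (fun p => (p : ℝ) ≤ y) Λ d / Real.log d *
        (d : ℝ) ^ (-(1 + θ)) + (4 * (2 * Real.exp 2 + 1) + 25 * Real.exp 4) := by
  have hly := log_ge_of_ten_le hy
  set η := 1 / Real.log y with hη
  have hη0 : 0 < η := by positivity
  have hη1 : η ≤ 0.435 := inv_log_le hy
  set V := restrictPrimes (fun p => (p : ℝ) ≤ y) Λ with hV
  set A := (Finset.Icc 2 ⌊y⌋₊ ×ˢ Finset.Ico 2 (N + 1)).image (fun q : ℕ × ℕ => q.1 ^ q.2) with hA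
  have key : ∀ d ∈ Finset.Ioc 0 N, V d / Real.log d * (d : ℝ) ^ (-(1 - 2 * η)) ≤
      V d / Real.log d * (d : ℝ) ^ (-(1 + θ)) +
      ((if d ∈ Finset.Ioc 0 ⌊y⌋₊ then (2 * Real.exp 2 + 1) * η * (Λ d / d) else 0) +
        (if d ∈ A then (d : ℝ) ^ (-(1 - 2 * η)) else 0)) := by
    intro d hd
    obtain ⟨hd0, hdN⟩ := Finset.mem_Ioc.mp hd
    have hd1 : (1:ℝ) ≤ d := by exact_mod_cast hd0
    have hl : 0 ≤ Real.log d := Real.log_nonneg hd1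
    have hV0 : 0 ≤ V d := by
      rw [hV, restrictPrimes_apply]; split_ifs; exacts [vonMangoldt_nonneg, le_rfl]
    have hVΛ : V d ≤ Λ d := by
      rw [hV, restrictPrimes_apply]; split_ifs; exacts [le_rfl, vonMangoldt_nonneg]
    have hA0 : 0 ≤ if d ∈ A then (d : ℝ) ^ (-(1 - 2 * η)) else 0 := by
      split_ifs <;> positivity
    by_cases hdy : d ∈ Finset.Ioc 0 ⌊y⌋₊
    · rw [if_pos hdy]
      have hdy' : (d:ℝ) ≤ y :=
        (Nat.cast_le.mpr (Finset.mem_Ioc.mp hdy).2).trans (Nat.floor_le (by linarith))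
      have h1 := rpow_sub_rpow_neg_le hd1 hη0.le hθ (by
        rw [hη, one_div, inv_mul_le_iff₀ (by linarith), mul_one]
        exact Real.log_le_log (by linarith) hdy')
      have e1 : (d : ℝ) ^ (-(1 - 2 * η)) = (d:ℝ)⁻¹ * (d:ℝ) ^ (2 * η) := by
        rw [← Real.rpow_neg_one, ← Real.rpow_add (by linarith)]; ring_nf
      have e2 : (d : ℝ) ^ (-(1 + θ)) = (d:ℝ)⁻¹ * (d:ℝ) ^ (-θ) := by
        rw [← Real.rpow_neg_one, ← Real.rpow_add (by linarith)]; ring_nf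
      rw [e1] at hA0 ⊢
      rw [e2]
      have h2 : V d / Real.log d * Real.log d ≤ Λ d := by
        rcases hl.eq_or_lt with h | h
        · rw [← h, mul_zero]; exact vonMangoldt_nonneg
        · rw [div_mul_cancel₀ _ h.ne']; exact hVΛ
      have h3 : V d / Real.log d * (d:ℝ)⁻¹ * ((d:ℝ) ^ (2 * η) - (d:ℝ) ^ (-θ)) ≤
          V d / Real.log d * (d:ℝ)⁻¹ * ((2 * Real.exp 2 + 1) * η * Real.log d) := by gcongr
      have h4 : V d / Real.log d * (d:ℝ)⁻¹ * ((2 * Real.exp 2 + 1) * η * Real.log d) ≤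
          (2 * Real.exp 2 + 1) * η * (Λ d / d) := by
        rw [show V d / Real.log d * (d:ℝ)⁻¹ * ((2 * Real.exp 2 + 1) * η * Real.log d) =
          (2 * Real.exp 2 + 1) * η * ((V d / Real.log d * Real.log d) / d) by ring]
        gcongr
      linarith
    · rw [if_neg hdy, zero_add]
      by_cases hV1 : V d = 0
      · rw [hV1, zero_div, zero_mul, zero_mul, zero_add]; exact hA0
      have hsm : ∀ p ∈ d.primeFactors, (p:ℝ) ≤ y := by
        by_contra h
        exact hV1 (by rw [hV, restrictPrimes_apply, if_neg h])
      have hpp : IsPrimePow d := by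
        by_contra h
        refine hV1 (le_antisymm ?_ hV0)
        rwa [vonMangoldt_apply, if_neg h] at hVΛ
      obtain ⟨p, k, hp, hk, rfl⟩ := (isPrimePow_nat_iff d).mp hpp
      have hpy : (p:ℝ) ≤ y := hsm p (by simp [Nat.primeFactors_prime_pow hk.ne' hp])
      have hpy' : p ≤ ⌊y⌋₊ := Nat.le_floor hpy
      have hk2 : 2 ≤ k := by
        by_contra h
        obtain rfl : k = 1 := by omega
        exact hdy (Finset.mem_Ioc.mpr ⟨hd0, by simpa using hpy'⟩)
      have hmem : p ^ k ∈ A := by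
        refine Finset.mem_image.mpr ⟨(p, k), Finset.mem_product.mpr ⟨Finset.mem_Icc.mpr
          ⟨hp.two_le, hpy'⟩, Finset.mem_Ico.mpr ⟨hk2, ?_⟩⟩, rfl⟩
        exact Nat.lt_succ_of_lt ((Nat.lt_pow_self hp.one_lt).trans_le hdN)
      rw [if_pos hmem]
      have h1 : V (p ^ k) / Real.log (p ^ k : ℕ) ≤ 1 :=
        (div_le_div_of_nonneg_right hVΛ hl).trans (vonMangoldt_div_log_le_one _)
      have h2 : 0 ≤ V (p ^ k) / Real.log (p ^ k : ℕ) := by positivity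
      have h3 : 0 ≤ V (p ^ k) / Real.log (p ^ k : ℕ) * ((p ^ k : ℕ) : ℝ) ^ (-(1 + θ)) := by
        positivity
      have h4 : 0 ≤ ((p ^ k : ℕ) : ℝ) ^ (-(1 - 2 * η)) := by positivity
      nlinarith
  refine (Finset.sum_le_sum key).trans ?_
  rw [Finset.sum_add_distrib, Finset.sum_add_distrib]
  refine add_le_add le_rfl (add_le_add ?_ ?_)
  · rw [Finset.sum_ite_mem]
    calc _ ≤ ∑ d ∈ Finset.Ioc 0 ⌊y⌋₊, (2 * Real.exp 2 + 1) * η * (Λ d / d) :=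
          Finset.sum_le_sum_of_subset_of_nonneg Finset.inter_subset_right fun d _ _ =>
            mul_nonneg (by positivity) (div_nonneg vonMangoldt_nonneg (by positivity))
      _ ≤ (2 * Real.exp 2 + 1) * η * (Real.log y + 6) := by
          rw [← Finset.mul_sum]
          refine mul_le_mul_of_nonneg_left ((sum_vonMangoldt_div_le _).trans ?_) (by positivity)
          gcongr
          · exact Nat.cast_pos.mpr (Nat.floor_pos.mpr (by linarith))
          · exact Nat.floor_le (by linarith)
      _ = (2 * Real.exp 2 + 1) * (1 + 6 * η) := by rw [hη]; field_simp
      _ ≤ 4 * (2 * Real.exp 2 + 1) := by nlinarith [Real.exp_pos 2]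
  · rw [Finset.sum_ite_mem]
    refine le_trans ?_ (sum_prime_pow_rpow_le hy rfl N)
    exact Finset.sum_le_sum_of_subset_of_nonneg Finset.inter_subset_right
      fun d _ _ => by positivity

lemma lt_of_rough {y : ℝ} {d : ℕ} (hd : d ≠ 0) (hd1 : d ≠ 1)
    (h : ∀ p ∈ d.primeFactors, y < (p : ℝ)) : y < d := by
  have hp := Nat.minFac_prime hd1
  refine (h _ (Nat.mem_primeFactors.mpr ⟨hp, Nat.minFac_dvd d, hd⟩)).trans_le ?_
  exact_mod_cast Nat.minFac_le (Nat.pos_of_ne_zero hd)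

lemma sum_rough_vonMangoldt_le {y : ℝ} (hy : 10 ≤ y) (N : ℕ) :
    ∑ d ∈ Finset.Ioc 0 N, restrictPrimes (fun p => y < (p : ℝ)) Λ d / Real.log d *
        (d : ℝ) ^ (-(1 + 1 / Real.log y)) ≤ 12 := by
  have hly := log_ge_of_ten_le hy
  set η := 1 / Real.log y with hη
  have hη0 : 0 < η := by positivity
  have hη1 : η ≤ 0.435 := inv_log_le hy
  calc _ ≤ ∑ d ∈ Finset.Ioc 0 N, η * (Λ d * (d : ℝ) ^ (-1 - η)) := by
        refine Finset.sum_le_sum fun d hd => ?_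
        rw [show -(1 + η) = -1 - η by ring, ← mul_assoc]
        refine mul_le_mul_of_nonneg_right ?_ (by positivity)
        rw [restrictPrimes_apply]
        have hΛ : 0 ≤ Λ d := vonMangoldt_nonneg
        split_ifs with h
        · by_cases h1 : d = 1
          · simp [h1]
          have h2 := lt_of_rough (by have := (Finset.mem_Ioc.mp hd).1; omega) h1 h
          rw [hη, div_eq_mul_inv, mul_comm, one_div]
          gcongr
        · rw [zero_div]; positivity
    _ ≤ η * (6 * (1 + 1 / η)) := by
        rw [← Finset.mul_sum]
        refine mul_le_mul_of_nonneg_left ((sum_vonMangoldt_mul_le ?_ ?_ N).trans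
          (mul_le_mul_of_nonneg_left (sum_rpow_neg_one_sub_le hη0 N) (by norm_num))) hη0.le
        · intro n hn
          exact Real.rpow_le_rpow_of_nonpos (by exact_mod_cast hn) (by push_cast; linarith)
            (by linarith)
        · intro n; positivity
    _ ≤ 12 := by
        have : η * (6 * (1 + 1 / η)) = 6 * (1 + η) := by field_simp; ring
        linarith

end SmoothRough

section HalaszPairs

open ArithmeticFunction

/-- A multiplicative function `F` together with the coefficients `L` of `-F'/F`, bounded by
`κ Λ`. -/
structure HalaszPair (κ : ℝ) (F L : ArithmeticFunction ℂ) : Prop where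
  mult : F.IsMultiplicative
  logMul_eq : logMul F = L * F
  norm_le : ∀ n, ‖L n‖ ≤ κ * Λ n

lemma restrictPrimes_nonneg {u : ArithmeticFunction ℝ} (P : ℕ → Prop) (hu : ∀ n, 0 ≤ u n) (n : ℕ) :
    0 ≤ restrictPrimes P u n := by
  rw [restrictPrimes_apply]; split_ifs; exacts [hu n, le_rfl]

lemma restrictPrimes_le {u : ArithmeticFunction ℝ} (P : ℕ → Prop) (hu : ∀ n, 0 ≤ u n) (n : ℕ) :
    restrictPrimes P u n ≤ u n := by
  rw [restrictPrimes_apply]; split_ifs; exacts [le_rfl, hu n]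

lemma normAF_logMul (u : ArithmeticFunction ℂ) : normAF (logMul u) = logMul (normAF u) := by
  ext n
  rw [normAF_apply, logMul_apply, logMul_apply, norm_smul, Real.norm_of_nonneg
    (Real.log_natCast_nonneg n), normAF_apply, smul_eq_mul]

lemma normAF_nonneg (u : ArithmeticFunction ℂ) (n : ℕ) : 0 ≤ normAF u n := norm_nonneg (u n)

lemma sum_twist_norm_le {κ : ℝ} (hκ : 0 ≤ κ) {F L : ArithmeticFunction ℂ}
    {V : ArithmeticFunction ℝ} (hF : F 1 = 1) (h : logMul F = L * F)
    (hV : ∀ n, 0 ≤ V n) (hV1 : V 1 = 0) (hL : ∀ n, ‖L n‖ ≤ κ * V n) (θ : ℝ) (N : ℕ) :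
    ∑ n ∈ Finset.Ioc 0 N, twist θ (normAF F) n ≤
      Real.exp (κ * ∑ d ∈ Finset.Ioc 0 N, V d / Real.log d * (d : ℝ) ^ (-θ)) := by
  have hκV : ∀ n, 0 ≤ (κ • V) n := fun n => mul_nonneg hκ (hV n)
  have hF0 := normAF_nonneg F
  refine (sum_le_exp_sum_div_log (lam := twist θ (κ • V)) (twist_nonneg θ hF0)
    (twist_nonneg θ hκV) ?_ ?_ (fun n => ?_) N).trans (le_of_eq ?_)
  · rw [twist_apply_one]; simp [hF]
  · rw [twist_apply_one]
    show κ * V 1 = 0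
    rw [hV1, mul_zero]
  · rw [logMul_twist, ← normAF_logMul, h, ← twist_mul]
    refine twist_le_twist θ (fun m => ?_) n
    exact (norm_mul_apply_le L F m).trans
      (mul_apply_le_mul_apply hF0 hκV hL (fun _ => le_rfl) m)
  · rw [Finset.mul_sum]
    congr 1
    refine Finset.sum_congr rfl fun d _ => ?_
    rw [twist_apply]
    show (d : ℝ) ^ (-θ) * (κ * V d) / Real.log d = _
    ring

variable {κ y : ℝ} {F L : ArithmeticFunction ℂ}

lemma HalaszPair.logMul_restrictPrimes_eq (h : HalaszPair κ F L) (P : ℕ → Prop) :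
    logMul (restrictPrimes P F) = restrictPrimes P L * restrictPrimes P F := by
  rw [logMul_restrictPrimes, h.logMul_eq, restrictPrimes_mul]

lemma HalaszPair.norm_restrictPrimes_le (h : HalaszPair κ F L) (P : ℕ → Prop) (n : ℕ) :
    ‖restrictPrimes P L n‖ ≤ κ * restrictPrimes P Λ n := by
  rw [restrictPrimes_apply, restrictPrimes_apply]
  split_ifs
  · exact h.norm_le n
  · simp

lemma HalaszPair.sum_twist_restrictPrimes_le (h : HalaszPair κ F L) (hκ : 0 ≤ κ) (P : ℕ → Prop)
    (θ : ℝ) (N : ℕ) :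
    ∑ n ∈ Finset.Ioc 0 N, twist θ (normAF (restrictPrimes P F)) n ≤
      Real.exp (κ * ∑ d ∈ Finset.Ioc 0 N, restrictPrimes P Λ d / Real.log d * (d : ℝ) ^ (-θ)) :=
  sum_twist_norm_le hκ (by simp [restrictPrimes_apply, h.mult.1]) (h.logMul_restrictPrimes_eq P)
    (restrictPrimes_nonneg P fun _ => vonMangoldt_nonneg) (by simp [restrictPrimes_apply])
    (h.norm_restrictPrimes_le P) θ N

/-- The constant in the bounds for the smooth and rough parts of a `HalaszPair`. -/
def halaszConst (κ : ℝ) : ℝ := Real.exp (κ * (12 + (4 * (2 * Real.exp 2 + 1) + 25 * Real.exp 4)))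

lemma halaszConst_pos (κ : ℝ) : 0 < halaszConst κ := Real.exp_pos _

lemma exp_mul_log_add {κ Y B : ℝ} (hY : 0 < Y) :
    Real.exp (κ * (Real.log Y + B)) = Real.exp (κ * B) * Y ^ κ := by
  rw [Real.rpow_def_of_pos hY, ← Real.exp_add]
  ring_nf

/-- The smooth part at abscissa `1 - 2 / log y`. -/
lemma HalaszPair.sum_smooth_le (h : HalaszPair κ F L) (hκ : 0 ≤ κ) (hy : 10 ≤ y) (N : ℕ) :
    ∑ n ∈ Finset.Ioc 0 N, twist (1 - 2 * (1 / Real.log y))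
        (normAF (restrictPrimes (fun p => (p : ℝ) ≤ y) F)) n ≤
      halaszConst κ * Real.log y ^ κ := by
  have hly := log_ge_of_ten_le hy
  refine (h.sum_twist_restrictPrimes_le hκ _ _ N).trans ?_
  rw [halaszConst, ← exp_mul_log_add (by linarith)]
  refine Real.exp_le_exp.mpr (mul_le_mul_of_nonneg_left ?_ hκ)
  refine (sum_smooth_vonMangoldt_le hy le_rfl N).trans ?_
  have h1 := sum_vonMangoldt_div_log_le (θ := 1 / Real.log y) (by positivity)
    ((inv_log_le hy).trans (by norm_num)) N
  rw [one_div_one_div] at h1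
  have h2 : ∑ d ∈ Finset.Ioc 0 N, restrictPrimes (fun p => (p : ℝ) ≤ y) Λ d / Real.log d *
        (d : ℝ) ^ (-(1 + 1 / Real.log y)) ≤
      ∑ n ∈ Finset.Ioc 0 N, Λ n / Real.log n * (n : ℝ) ^ (-1 - 1 / Real.log y) := by
    refine Finset.sum_le_sum fun d _ => ?_
    rw [neg_add']
    gcongr
    · exact restrictPrimes_le _ (fun _ => vonMangoldt_nonneg) d
  linarith

/-- The rough part at abscissa `1 + 1 / log y`. -/
lemma HalaszPair.sum_rough_le (h : HalaszPair κ F L) (hκ : 0 ≤ κ) (hy : 10 ≤ y) (N : ℕ) :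
    ∑ n ∈ Finset.Ioc 0 N, twist (1 + 1 / Real.log y)
        (normAF (restrictPrimes (fun p => y < (p : ℝ)) F)) n ≤ halaszConst κ := by
  refine (h.sum_twist_restrictPrimes_le hκ _ _ N).trans ?_
  refine Real.exp_le_exp.mpr (mul_le_mul_of_nonneg_left ?_ hκ)
  refine (sum_rough_vonMangoldt_le hy N).trans ?_
  have := Real.exp_pos 2
  have := Real.exp_pos 4
  linarith

/-- The product of the smooth part at `1 - 2 / log y` and the rough part at `1 + 1 / log x`. -/
lemma HalaszPair.sum_smooth_mul_sum_rough_le (h : HalaszPair κ F L) (hκ : 0 ≤ κ) {x : ℝ}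
    (hy : 10 ≤ y) (hyx : y ≤ x) (N : ℕ) :
    (∑ n ∈ Finset.Ioc 0 N, twist (1 - 2 * (1 / Real.log y))
        (normAF (restrictPrimes (fun p => (p : ℝ) ≤ y) F)) n) *
      (∑ n ∈ Finset.Ioc 0 N, twist (1 + 1 / Real.log x)
        (normAF (restrictPrimes (fun p => y < (p : ℝ)) F)) n) ≤
      halaszConst κ * Real.log x ^ κ := by
  have hly := log_ge_of_ten_le hy
  have hlx : Real.log y ≤ Real.log x := Real.log_le_log (by linarith) hyx
  have hθ : 1 / Real.log x ≤ 1 / Real.log y := one_div_le_one_div_of_le (by linarith) hlx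
  refine (mul_le_mul (h.sum_twist_restrictPrimes_le hκ _ _ N)
    (h.sum_twist_restrictPrimes_le hκ _ _ N) (Finset.sum_nonneg fun n _ =>
      twist_nonneg _ (normAF_nonneg _) n) (Real.exp_nonneg _)).trans ?_
  rw [halaszConst, ← exp_mul_log_add (by linarith), ← Real.exp_add, ← mul_add]
  refine Real.exp_le_exp.mpr (mul_le_mul_of_nonneg_left ?_ hκ)
  have h1 := sum_smooth_vonMangoldt_le hy hθ N
  have h2 := sum_vonMangoldt_div_log_le (θ := 1 / Real.log x)
    (one_div_pos.mpr (by linarith)) (hθ.trans ((inv_log_le hy).trans (by norm_num))) N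
  rw [one_div_one_div] at h2
  have h3 : ∑ d ∈ Finset.Ioc 0 N, restrictPrimes (fun p => (p : ℝ) ≤ y) Λ d / Real.log d *
        (d : ℝ) ^ (-(1 + 1 / Real.log x)) +
      ∑ d ∈ Finset.Ioc 0 N, restrictPrimes (fun p => y < (p : ℝ)) Λ d / Real.log d *
        (d : ℝ) ^ (-(1 + 1 / Real.log x)) ≤
      ∑ n ∈ Finset.Ioc 0 N, Λ n / Real.log n * (n : ℝ) ^ (-1 - 1 / Real.log x) := by
    rw [← Finset.sum_add_distrib]
    refine Finset.sum_le_sum fun d _ => ?_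
    rw [neg_add', ← add_mul, ← add_div]
    refine mul_le_mul_of_nonneg_right (div_le_div_of_nonneg_right ?_
      (Real.log_natCast_nonneg d)) (by positivity)
    by_cases hd : d ≤ 1
    · interval_cases d <;> simp [restrictPrimes_apply]
    obtain ⟨p, hp, hpd⟩ := Nat.exists_prime_and_dvd (by omega : d ≠ 1)
    have hp' : p ∈ d.primeFactors := Nat.mem_primeFactors.mpr ⟨hp, hpd, by omega⟩
    rw [restrictPrimes_apply, restrictPrimes_apply]
    by_cases hpy : (p : ℝ) ≤ y
    · rw [if_neg (c := ∀ p ∈ d.primeFactors, y < (p:ℝ)) fun h => (h p hp').not_ge hpy, add_zero]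
      split_ifs
      exacts [le_rfl, vonMangoldt_nonneg]
    · rw [if_neg (c := ∀ p ∈ d.primeFactors, (p:ℝ) ≤ y) fun h => hpy (h p hp'), zero_add]
      split_ifs
      exacts [le_rfl, vonMangoldt_nonneg]
  linarith

end HalaszPairs

section DivisorFunctions

open ArithmeticFunction
open scoped ArithmeticFunction.zeta

/-- The `k`-fold divisor function. -/
def divisorAF (k : ℕ) : ArithmeticFunction ℝ := (ζ : ArithmeticFunction ℝ) ^ k

lemma divisorAF_succ (k : ℕ) : divisorAF (k + 1) = (ζ : ArithmeticFunction ℝ) * divisorAF k :=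
  pow_succ' _ _

lemma divisorAF_nonneg (k n : ℕ) : 0 ≤ divisorAF k n := by
  induction k generalizing n with
  | zero => rw [divisorAF, pow_zero, one_apply]; split_ifs <;> norm_num
  | succ k ih =>
    rw [divisorAF_succ]
    refine mul_apply_nonneg (fun m => ?_) ih n
    rw [natCoe_apply]
    positivity

lemma isMultiplicative_divisorAF (k : ℕ) : (divisorAF k).IsMultiplicative := by
  induction k with
  | zero => rw [divisorAF, pow_zero]; exact isMultiplicative_one
  | succ k ih => rw [divisorAF_succ]; exact isMultiplicative_zeta.natCast.mul ih

lemma divisorAF_succ_apply (k n : ℕ) :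
    divisorAF (k + 1) n = ∑ d ∈ n.divisors, divisorAF k d := by
  rw [divisorAF_succ, coe_zeta_mul_apply]

lemma nsmul_arithmeticFunction_apply (k : ℕ) (u : ArithmeticFunction ℝ) (n : ℕ) :
    (k • u) n = k * u n := by
  induction k with
  | zero => simp
  | succ k ih => rw [succ_nsmul, ArithmeticFunction.add_apply, ih]; push_cast; ring

lemma logMul_divisorAF (k : ℕ) : logMul (divisorAF k) = (k • Λ) * divisorAF k := by
  have h1 : logMul (ζ : ArithmeticFunction ℝ) = Λ * ζ := by
    rw [vonMangoldt_mul_zeta]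
    ext n
    rw [logMul_apply, log_apply, natCoe_apply]
    by_cases hn : n = 0
    · simp [hn]
    · simp [zeta_apply_ne hn]
  induction k with
  | zero =>
    rw [divisorAF, pow_zero, zero_nsmul, zero_mul]
    ext n
    rw [logMul_apply, one_apply]
    split_ifs with h <;> simp [h]
  | succ k ih =>
    rw [divisorAF_succ, logMul_mul, h1, ih, succ_nsmul]
    simp only [nsmul_eq_mul]
    ring

/-- A `HalaszPair` with parameter `κ ≤ k` is dominated by the `k`-fold divisor function. -/
lemma HalaszPair.norm_le_divisorAF {κ : ℝ} {F L : ArithmeticFunction ℂ} (h : HalaszPair κ F L)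
    {k : ℕ} (hk : κ ≤ k) (n : ℕ) : ‖F n‖ ≤ divisorAF k n := by
  induction n using Nat.strong_induction_on with
  | _ n ih =>
    rcases Nat.eq_zero_or_pos n with rfl | hn
    · simp
    rcases (Nat.succ_le_of_lt hn).eq_or_lt with rfl | hn1
    · simp [h.mult.1, (isMultiplicative_divisorAF k).1]
    have hl : 0 < Real.log n := Real.log_pos (by exact_mod_cast hn1)
    refine le_of_mul_le_mul_left ?_ hl
    have e1 : Real.log n * ‖F n‖ = ‖(L * F) n‖ := by
      rw [← h.logMul_eq, logMul_apply, norm_smul, Real.norm_of_nonneg hl.le]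
    have e2 : Real.log n * divisorAF k n = ((k • Λ) * divisorAF k) n := by
      rw [← logMul_divisorAF, logMul_apply, smul_eq_mul]
    rw [e1, e2, mul_apply, mul_apply]
    refine (norm_sum_le _ _).trans (Finset.sum_le_sum fun q hq => ?_)
    obtain ⟨hq1, hq0⟩ := Nat.mem_divisorsAntidiagonal.mp hq
    rw [norm_mul, nsmul_arithmeticFunction_apply]
    have hL : ‖L q.1‖ ≤ k * Λ q.1 :=
      (h.norm_le _).trans (mul_le_mul_of_nonneg_right hk vonMangoldt_nonneg)
    by_cases hq2 : q.1 = 1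
    · rw [hq2] at hL ⊢
      simp only [vonMangoldt_apply_one, mul_zero] at hL ⊢
      rw [le_antisymm hL (norm_nonneg _)]
      simp
    · refine mul_le_mul hL (ih _ ?_) (norm_nonneg _)
        (mul_nonneg (Nat.cast_nonneg _) vonMangoldt_nonneg)
      have h1 : q.1 ≠ 0 := by rintro h; simp [h] at hq1; omega
      have h2 : q.2 ≠ 0 := by rintro h; simp [h] at hq1; omega
      have : 2 ≤ q.1 := by omega
      nlinarith [Nat.pos_of_ne_zero h2]

/-- In a factorisation of `n` into `k + 1` factors one factor is at least `n ^ (1 / (k + 1))`. -/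
lemma divisorAF_succ_le (k n : ℕ) :
    divisorAF (k + 1) n ≤
      (k + 1) * ∑ m ∈ n.divisors with m ^ (k + 1) ≤ n ^ k, divisorAF k m := by
  induction k generalizing n with
  | zero =>
    rcases Nat.eq_zero_or_pos n with rfl | hn
    · simp
    rw [divisorAF_succ_apply]
    simp only [divisorAF, pow_zero, Nat.cast_zero, zero_add, pow_one, one_mul]
    rw [Finset.sum_filter]
    refine Finset.sum_le_sum fun m hm => ?_
    rw [one_apply]
    split_ifs <;> first | omega | norm_num
  | succ k ih =>
    rcases Nat.eq_zero_or_pos n with rfl | hn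
    · simp
    have hbig : ∀ d ∈ n.divisors, divisorAF (k + 1) d ≤
        (if d ^ (k + 2) ≤ n ^ (k + 1) then divisorAF (k + 1) d else 0) +
        (k + 1) * ∑ m ∈ d.divisors, if (n / d * m) ^ (k + 2) ≤ n ^ (k + 1) then
          divisorAF k m else 0 := by
      intro d hd
      have hdn := Nat.dvd_of_mem_divisors hd
      have hd0 := Nat.pos_of_mem_divisors hd
      have hnn : 0 ≤ (k + 1 : ℝ) * ∑ m ∈ d.divisors, if (n / d * m) ^ (k + 2) ≤ n ^ (k + 1) then
          divisorAF k m else 0 :=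
        mul_nonneg (by positivity) (Finset.sum_nonneg fun m _ => by
          split_ifs; exacts [divisorAF_nonneg _ _, le_rfl])
      split_ifs with h
      · linarith
      · rw [zero_add]
        refine (ih d).trans (mul_le_mul_of_nonneg_left ?_ (by positivity))
        rw [Finset.sum_filter]
        refine Finset.sum_le_sum fun m _ => ?_
        by_cases hm : m ^ (k + 1) ≤ d ^ k
        · rw [if_pos hm, if_pos]
          obtain ⟨e, rfl⟩ := hdn
          have he0 : 0 < e := Nat.pos_of_mul_pos_left hn
          rw [Nat.mul_div_cancel_left _ hd0]
          have h1 : e ^ (k + 1) < d := by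
            by_contra hc
            apply h
            calc d ^ (k + 2) = d ^ (k + 1) * d := pow_succ _ _
              _ ≤ d ^ (k + 1) * e ^ (k + 1) := Nat.mul_le_mul_left _ (not_lt.mp hc)
              _ = _ := (mul_pow _ _ _).symm
          refine (Nat.pow_le_pow_iff_left (n := k + 1) (by omega)).mp ?_
          calc ((e * m) ^ (k + 2)) ^ (k + 1)
              = e ^ ((k + 2) * (k + 1)) * (m ^ (k + 1)) ^ (k + 2) := by
                rw [mul_pow, mul_pow, ← pow_mul, ← pow_mul, ← pow_mul, mul_comm (k + 1) (k + 2)]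
            _ ≤ e ^ ((k + 2) * (k + 1)) * (d ^ k) ^ (k + 2) := by gcongr
            _ = e ^ ((k + 1) * (k + 1)) * e ^ (k + 1) * d ^ (k * (k + 2)) := by
                rw [← pow_add, ← pow_mul]; ring_nf
            _ ≤ e ^ ((k + 1) * (k + 1)) * d * d ^ (k * (k + 2)) := by gcongr
            _ = _ := by rw [mul_pow, mul_pow, ← pow_mul, ← pow_mul, mul_comm (d ^ _), mul_assoc,
                ← pow_succ']; ring_nf
        · rw [if_neg hm]
          split_ifs; exacts [divisorAF_nonneg _ _, le_rfl]
    rw [divisorAF_succ_apply]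
    refine (Finset.sum_le_sum hbig).trans ?_
    rw [Finset.sum_add_distrib, ← Finset.sum_filter, ← Finset.mul_sum]
    have hswap : ∑ d ∈ n.divisors, ∑ m ∈ d.divisors,
        (if (n / d * m) ^ (k + 2) ≤ n ^ (k + 1) then divisorAF k m else 0) ≤
        ∑ m ∈ n.divisors with m ^ (k + 2) ≤ n ^ (k + 1), divisorAF (k + 1) m := by
      rw [Finset.sum_filter]
      have hsum : ∀ b ∈ n.divisors, (if b ^ (k + 2) ≤ n ^ (k + 1) then divisorAF (k + 1) b else 0) =
          ∑ m ∈ b.divisors, if b ^ (k + 2) ≤ n ^ (k + 1) then divisorAF k m else 0 := by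
        intro b _
        split_ifs
        · exact divisorAF_succ_apply k b
        · simp
      rw [Finset.sum_congr rfl hsum, Finset.sum_sigma', Finset.sum_sigma']
      refine le_of_eq (Finset.sum_nbij'
          (fun q : (_ : ℕ) × ℕ => (⟨n / q.1 * q.2, q.2⟩ : (_ : ℕ) × ℕ))
        (fun q : (_ : ℕ) × ℕ => (⟨n / (q.1 / q.2), q.2⟩ : (_ : ℕ) × ℕ)) ?_ ?_ ?_ ?_ fun _ _ => rfl)
      · rintro ⟨d, m⟩ h
        simp only [Finset.mem_sigma, Nat.mem_divisors] at h ⊢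
        obtain ⟨⟨⟨e, rfl⟩, -⟩, ⟨l, rfl⟩, h0⟩ := h
        have := Nat.pos_of_ne_zero h0
        rw [Nat.mul_div_cancel_left _ this]
        have hm : 0 < m := Nat.pos_of_mul_pos_right this
        have he : 0 < e := Nat.pos_of_mul_pos_left hn
        exact ⟨⟨⟨l, by ring⟩, hn.ne'⟩, ⟨e, by ring⟩, by positivity⟩
      · rintro ⟨b, m⟩ h
        simp only [Finset.mem_sigma, Nat.mem_divisors] at h ⊢
        obtain ⟨⟨⟨e, rfl⟩, -⟩, ⟨l, rfl⟩, h0⟩ := h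
        have := Nat.pos_of_ne_zero h0
        have hm : 0 < m := Nat.pos_of_mul_pos_right this
        have hl : 0 < l := Nat.pos_of_mul_pos_left this
        have he : 0 < e := Nat.pos_of_mul_pos_left hn
        rw [Nat.mul_div_cancel_left _ hm, show m * l * e = l * (m * e) by ring,
          Nat.mul_div_cancel_left _ hl]
        exact ⟨⟨⟨l, by ring⟩, by positivity⟩, ⟨e, rfl⟩, by positivity⟩
      · rintro ⟨d, m⟩ h
        simp only [Finset.mem_sigma, Nat.mem_divisors] at h ⊢
        obtain ⟨⟨⟨e, rfl⟩, -⟩, ⟨l, rfl⟩, h0⟩ := h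
        have := Nat.pos_of_ne_zero h0
        have hm : 0 < m := Nat.pos_of_mul_pos_right this
        have he : 0 < e := Nat.pos_of_mul_pos_left hn
        rw [Nat.mul_div_cancel_left _ this, Nat.mul_div_cancel _ hm, Nat.mul_div_cancel _ he]
      · rintro ⟨b, m⟩ h
        simp only [Finset.mem_sigma, Nat.mem_divisors] at h ⊢
        obtain ⟨⟨⟨e, rfl⟩, -⟩, ⟨l, rfl⟩, h0⟩ := h
        have := Nat.pos_of_ne_zero h0
        have hm : 0 < m := Nat.pos_of_mul_pos_right this
        have hl : 0 < l := Nat.pos_of_mul_pos_left this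
        have he : 0 < e := Nat.pos_of_mul_pos_left hn
        rw [Nat.mul_div_cancel_left _ hm, show m * l * e = l * (m * e) by ring,
          Nat.mul_div_cancel_left _ hl, Nat.mul_div_cancel _ (by positivity), mul_comm l m]
    have := mul_le_mul_of_nonneg_left hswap (by positivity : (0:ℝ) ≤ k + 1)
    push_cast
    linarith

end DivisorFunctions

section ShortSums

open ArithmeticFunction
open scoped ArithmeticFunction.zeta

lemma sum_divisorAF_div_le (k : ℕ) {M : ℕ} (hM : 1 ≤ M) :
    ∑ m ∈ Finset.Ioc 0 M, divisorAF k m / m ≤ (1 + Real.log M) ^ k := by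
  have e : ∀ (u : ArithmeticFunction ℝ), ∑ m ∈ Finset.Ioc 0 M, u m / m =
      ∑ m ∈ Finset.Ioc 0 M, twist 1 u m := by
    intro u
    refine Finset.sum_congr rfl fun m _ => ?_
    rw [twist_apply, Real.rpow_neg_one, smul_eq_mul, div_eq_inv_mul]
  induction k with
  | zero =>
    rw [pow_zero, Finset.sum_eq_single_of_mem 1 (Finset.mem_Ioc.mpr ⟨one_pos, hM⟩)]
    · simp [divisorAF]
    · intro m _ hm
      simp [divisorAF, one_apply_ne hm]
  | succ k ih =>
    rw [e, divisorAF_succ, twist_mul, pow_succ']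
    have hz : ∀ n, 0 ≤ (ζ : ArithmeticFunction ℝ) n := fun n => by rw [natCoe_apply]; positivity
    refine (sum_mul_apply_le (twist_nonneg 1 hz) (twist_nonneg 1 (divisorAF_nonneg k)) M).trans ?_
    rw [← e, ← e]
    refine mul_le_mul ?_ ih (Finset.sum_nonneg fun m _ => div_nonneg (divisorAF_nonneg k m)
      (Nat.cast_nonneg m)) (by positivity)
    refine le_trans (le_of_eq (Finset.sum_congr rfl fun m hm => ?_)) (sum_one_div_le hM)
    rw [natCoe_apply, zeta_apply_ne (by have := (Finset.mem_Ioc.mp hm).1; omega), Nat.cast_one]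

lemma sum_range_inv_one_add_le {δ : ℝ} (hδ : 0 < δ) (J : ℕ) :
    ∑ j ∈ Finset.range (J + 1), 1 / (1 + δ * j) ≤ 1 + Real.log (1 + δ * J) / δ := by
  induction J with
  | zero => simp
  | succ J ih =>
    rw [Finset.sum_range_succ]
    have h0 : (0:ℝ) < 1 + δ * J := by positivity
    have h1 : (0:ℝ) < 1 + δ * (J + 1 : ℕ) := by positivity
    have h2 := Real.one_sub_inv_le_log_of_pos (div_pos h1 h0)
    rw [Real.log_div h1.ne' h0.ne', inv_div] at h2
    have h3 : 1 / (1 + δ * (J + 1 : ℕ)) = (1 - (1 + δ * J) / (1 + δ * (J + 1 : ℕ))) / δ := by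
      field_simp
      push_cast
      ring
    have h4 := div_le_div_of_nonneg_right h2 hδ.le
    rw [← h3, sub_div] at h4
    linarith

lemma sum_Ioc_inv_one_add_abs_le {δ X : ℝ} (hδ : 0 < δ) (hX : 0 ≤ X) :
    ∑ k ∈ Finset.Ioc 0 ⌊2 * X⌋₊, 1 / (1 + δ * |(k : ℝ) - X|) ≤
      2 * (1 + Real.log (1 + δ * X) / δ) := by
  have hJ : ∑ j ∈ Finset.range (⌊X⌋₊ + 1), 1 / (1 + δ * j) ≤ 1 + Real.log (1 + δ * X) / δ := by
    refine (sum_range_inv_one_add_le hδ _).trans ?_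
    gcongr
    exact Nat.floor_le hX
  have key : ∀ (A : Finset ℕ) (g : ℕ → ℕ), Set.InjOn g A → (∀ k ∈ A, g k ≤ ⌊X⌋₊) →
      (∀ k ∈ A, (g k : ℝ) ≤ |(k : ℝ) - X|) →
      ∑ k ∈ A, 1 / (1 + δ * |(k : ℝ) - X|) ≤ 1 + Real.log (1 + δ * X) / δ := by
    intro A g hg hgX hgk
    refine le_trans ?_ hJ
    calc _ ≤ ∑ k ∈ A, 1 / (1 + δ * (g k : ℝ)) := by
          refine Finset.sum_le_sum fun k hk => ?_
          have := hgk k hk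
          gcongr
      _ = ∑ j ∈ A.image g, 1 / (1 + δ * (j : ℝ)) := by rw [Finset.sum_image hg]
      _ ≤ _ := Finset.sum_le_sum_of_subset_of_nonneg (fun j hj => by
          obtain ⟨k, hk, rfl⟩ := Finset.mem_image.mp hj
          exact Finset.mem_range_succ_iff.mpr (hgX k hk)) fun j _ _ => by positivity
  rw [← Finset.sum_filter_add_sum_filter_not _ (fun k : ℕ => X ≤ k),
    two_mul (1 + _)]
  refine add_le_add (key _ (fun k => k - ⌈X⌉₊) ?_ ?_ ?_) (key _ (fun k => ⌊X⌋₊ - k) ?_ ?_ ?_)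
  · intro a ha b hb hab
    have h1 := Nat.ceil_le.mpr (Finset.mem_filter.mp ha).2
    have h2 := Nat.ceil_le.mpr (Finset.mem_filter.mp hb).2
    simp only at hab
    omega
  · intro k hk
    obtain ⟨hk1, hk2⟩ := Finset.mem_filter.mp hk
    have h3 : (k : ℝ) ≤ 2 * X :=
      (Nat.cast_le.mpr (Finset.mem_Ioc.mp hk1).2).trans (Nat.floor_le (by linarith))
    refine Nat.le_floor ?_
    rw [Nat.cast_sub (Nat.ceil_le.mpr hk2)]
    linarith [Nat.le_ceil X]
  · intro k hk
    obtain ⟨hk1, hk2⟩ := Finset.mem_filter.mp hk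
    rw [Nat.cast_sub (Nat.ceil_le.mpr hk2), abs_of_nonneg (by linarith)]
    linarith [Nat.le_ceil X]
  · intro a ha b hb hab
    have h1 := Nat.le_floor (not_le.mp (Finset.mem_filter.mp ha).2).le
    have h2 := Nat.le_floor (not_le.mp (Finset.mem_filter.mp hb).2).le
    simp only at hab
    omega
  · intro k _
    exact Nat.sub_le _ _
  · intro k hk
    have hk2 := (not_le.mp (Finset.mem_filter.mp hk).2).le
    rw [Nat.cast_sub (Nat.le_floor hk2), abs_sub_comm, abs_of_nonneg (by linarith)]
    linarith [Nat.floor_le hX]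

lemma abs_sub_div_le_abs_log {x n : ℝ} (hx : 0 < x) (hn : 0 < n) (hnx : n ≤ 2 * x) :
    |n - x| / (2 * x) ≤ |Real.log (x / n)| := by
  rw [div_le_iff₀ (by positivity)]
  rcases le_total n x with h | h
  · rw [abs_of_nonpos (by linarith), abs_of_nonneg (Real.log_nonneg (by rwa [one_le_div hn]))]
    have h1 := Real.one_sub_inv_le_log_of_pos (div_pos hx hn)
    have h2 : (1 - (x / n)⁻¹) * x = x - n := by rw [inv_div]; field_simp
    nlinarith
  · rw [abs_of_nonneg (by linarith), abs_of_nonpos (Real.log_nonpos (by positivity)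
      (by rwa [div_le_one hn])), ← Real.log_inv, inv_div]
    have h1 := Real.one_sub_inv_le_log_of_pos (div_pos hn hx)
    have h2 : (1 - (n / x)⁻¹) * n = n - x := by rw [inv_div]; field_simp
    have h3 : 0 ≤ Real.log (n / x) := Real.log_nonneg (by rwa [one_le_div hx])
    nlinarith

lemma sum_Ioc_sum_divisors (G : ℕ → ℕ → ℝ) (N : ℕ) :
    ∑ n ∈ Finset.Ioc 0 N, ∑ m ∈ n.divisors, G m n =
      ∑ m ∈ Finset.Ioc 0 N, ∑ l ∈ Finset.Ioc 0 (N / m), G m (m * l) := by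
  rw [Finset.sum_sigma', Finset.sum_sigma']
  refine Finset.sum_nbij' (fun q : (_ : ℕ) × ℕ => (⟨q.2, q.1 / q.2⟩ : (_ : ℕ) × ℕ))
    (fun q : (_ : ℕ) × ℕ => (⟨q.1 * q.2, q.1⟩ : (_ : ℕ) × ℕ)) ?_ ?_ ?_ ?_ ?_
  · rintro ⟨n, m⟩ h
    simp only [Finset.mem_sigma, Nat.mem_divisors, Finset.mem_Ioc] at h ⊢
    obtain ⟨⟨h0, hN⟩, ⟨l, rfl⟩, -⟩ := h
    have hm : 0 < m := Nat.pos_of_mul_pos_right h0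
    have hl : 0 < l := Nat.pos_of_mul_pos_left h0
    rw [Nat.mul_div_cancel_left _ hm, Nat.le_div_iff_mul_le hm, mul_comm l]
    exact ⟨⟨hm, (Nat.le_mul_of_pos_right m hl).trans hN⟩, hl, hN⟩
  · rintro ⟨m, l⟩ h
    simp only [Finset.mem_sigma, Nat.mem_divisors, Finset.mem_Ioc] at h ⊢
    obtain ⟨⟨hm, -⟩, hl, hN⟩ := h
    rw [Nat.le_div_iff_mul_le hm, mul_comm l] at hN
    exact ⟨⟨by positivity, hN⟩, dvd_mul_right _ _, by positivity⟩
  · rintro ⟨n, m⟩ h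
    simp only [Finset.mem_sigma, Nat.mem_divisors, Finset.mem_Ioc] at h ⊢
    rw [Nat.mul_div_cancel' h.2.1]
  · rintro ⟨m, l⟩ h
    simp only [Finset.mem_sigma, Finset.mem_Ioc] at h ⊢
    rw [Nat.mul_div_cancel_left _ h.1.1]
  · rintro ⟨n, m⟩ h
    simp only [Finset.mem_sigma, Nat.mem_divisors, Finset.mem_Ioc] at h ⊢
    rw [Nat.mul_div_cancel' h.2.1]

/-- Divisor sums weighted towards the point `x` at scale `x / T`. -/
lemma sum_divisorAF_div_one_add_le (k : ℕ) {x T : ℝ} (hx : 1 ≤ x) (hT : 1 ≤ T) :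
    ∑ n ∈ Finset.Ioc 0 ⌊2 * x⌋₊, divisorAF (k + 1) n / (1 + T * |Real.log (x / n)|) ≤
      (k + 1) * (1 + Real.log (2 * x)) ^ k *
        (2 * (2 * x) ^ ((k : ℝ) / (k + 1)) + 4 * x / T * Real.log (1 + T)) := by
  set N := ⌊2 * x⌋₊ with hN
  have hN1 : 1 ≤ N := Nat.le_floor (by push_cast; linarith)
  have hNx : (N : ℝ) ≤ 2 * x := Nat.floor_le (by linarith)
  set Y : ℝ := (2 * x) ^ ((k : ℝ) / (k + 1)) with hY
  have hY0 : 0 ≤ Y := by positivity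
  have hw : ∀ n ∈ Finset.Ioc 0 N, divisorAF (k + 1) n / (1 + T * |Real.log (x / n)|) ≤
      (k + 1) * ∑ m ∈ n.divisors, (if (m : ℝ) ≤ Y then divisorAF k m else 0) *
        (1 / (1 + T * (|n - x| / (2 * x)))) := by
    intro n hn
    obtain ⟨hn0, hnN⟩ := Finset.mem_Ioc.mp hn
    have hnx : (n : ℝ) ≤ 2 * x := (Nat.cast_le.mpr hnN).trans hNx
    have hl := abs_sub_div_le_abs_log (by linarith) (Nat.cast_pos.mpr hn0) hnx
    rw [← Finset.sum_mul, ← mul_assoc, div_eq_mul_one_div]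
    refine mul_le_mul ?_ (by gcongr) (by positivity) (mul_nonneg (by positivity)
      (Finset.sum_nonneg fun m _ => by split_ifs; exacts [divisorAF_nonneg _ _, le_rfl]))
    refine (divisorAF_succ_le k n).trans (mul_le_mul_of_nonneg_left ?_ (by positivity))
    rw [Finset.sum_filter]
    refine Finset.sum_le_sum fun m _ => ?_
    by_cases hm : m ^ (k + 1) ≤ n ^ k
    · rw [if_pos hm, if_pos]
      have h1 : (m : ℝ) ^ (k + 1) ≤ (2 * x) ^ k := by
        calc (m : ℝ) ^ (k + 1) ≤ (n : ℝ) ^ k := by exact_mod_cast hm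
          _ ≤ _ := by gcongr
      rw [hY, ← Real.rpow_natCast] at *
      refine (Real.pow_rpow_inv_natCast (Nat.cast_nonneg m) (Nat.succ_ne_zero k)).ge.trans ?_
      rw [div_eq_mul_inv, Real.rpow_mul (by linarith), Real.rpow_natCast]
      push_cast
      rw [Real.rpow_natCast] at h1
      gcongr
    · rw [if_neg hm]
      split_ifs; exacts [divisorAF_nonneg _ _, le_rfl]
  refine (Finset.sum_le_sum hw).trans ?_
  rw [← Finset.mul_sum, mul_assoc]
  refine mul_le_mul_of_nonneg_left ?_ (by positivity)
  rw [sum_Ioc_sum_divisors (fun m n => (if (m : ℝ) ≤ Y then divisorAF k m else 0) *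
        (1 / (1 + T * (|n - x| / (2 * x))))) N]
  have hm : ∀ m ∈ Finset.Ioc 0 N, ∑ l ∈ Finset.Ioc 0 (N / m),
      (if (m : ℝ) ≤ Y then divisorAF k m else 0) *
        (1 / (1 + T * (|((m * l : ℕ) : ℝ) - x| / (2 * x)))) ≤
      divisorAF k m / m * (2 * Y + 4 * x / T * Real.log (1 + T)) := by
    intro m hm
    obtain ⟨hm0, hmN⟩ := Finset.mem_Ioc.mp hm
    have hm0' : (0:ℝ) < m := Nat.cast_pos.mpr hm0
    have hlT : 0 ≤ Real.log (1 + T) := Real.log_nonneg (by linarith)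
    have hd := divisorAF_nonneg k m
    split_ifs with h
    swap
    · simp only [zero_mul, Finset.sum_const_zero]
      positivity
    rw [← Finset.mul_sum, div_mul_eq_mul_div, mul_div_assoc]
    refine mul_le_mul_of_nonneg_left ?_ hd
    have h1 := sum_Ioc_inv_one_add_abs_le (δ := T * m / (2 * x)) (X := x / m) (by positivity)
      (by positivity)
    have h2 : N / m ≤ ⌊2 * (x / m)⌋₊ := by
      refine Nat.le_floor ((Nat.cast_div_le).trans ?_)
      rw [← mul_div_assoc]
      gcongr
    have h3 : T * m / (2 * x) * (x / m) ≤ T := by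
      rw [show T * m / (2 * x) * (x / m) = T / 2 by field_simp]; linarith
    calc _ ≤ ∑ l ∈ Finset.Ioc 0 ⌊2 * (x / m)⌋₊, 1 / (1 + T * m / (2 * x) * |(l : ℝ) - x / m|) := by
          refine (le_of_eq (Finset.sum_congr rfl fun l _ => ?_)).trans
            (Finset.sum_le_sum_of_subset_of_nonneg (Finset.Ioc_subset_Ioc_right h2)
              fun _ _ _ => by positivity)
          rw [show ((m * l : ℕ) : ℝ) - x = m * (l - x / m) by push_cast; field_simp, abs_mul,
            abs_of_pos hm0']
          ring_nf
      _ ≤ 2 * (1 + Real.log (1 + T) / (T * m / (2 * x))) := by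
          refine h1.trans ?_
          gcongr
      _ = (2 * m + 4 * x / T * Real.log (1 + T)) / m := by field_simp; ring
      _ ≤ _ := by gcongr
  refine (Finset.sum_le_sum hm).trans ?_
  rw [← Finset.sum_mul]
  refine mul_le_mul_of_nonneg_right ((sum_divisorAF_div_le k hN1).trans ?_) ?_
  · have : (1:ℝ) ≤ N := by exact_mod_cast hN1
    have := Real.log_nonneg this
    gcongr
  · have : 0 ≤ Real.log (1 + T) := Real.log_nonneg (by linarith)
    positivity

lemma rpow_div_mul_pow_log_le (k : ℕ) {x : ℝ} (hx : 1 ≤ x) (hl : 0 < Real.log x) :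
    (2 * x) ^ ((k : ℝ) / (k + 1)) * Real.log x ^ k ≤
      2 * ((k + 1) ^ 2) ^ (k + 1) * (x / Real.log x) := by
  have hx0 : 0 < x := by linarith
  have hk : (0:ℝ) < k + 1 := by positivity
  rw [mul_div_assoc', le_div_iff₀ hl, mul_assoc, ← pow_succ, Real.mul_rpow (by norm_num) hx0.le]
  have h1 : Real.log x ^ (k + 1) ≤ ((k + 1) ^ 2) ^ (k + 1) * x ^ (1 / (k + 1 : ℝ)) := by
    have h := Real.log_le_rpow_div hx0.le (ε := 1 / (k + 1 : ℝ) ^ 2) (by positivity)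
    calc Real.log x ^ (k + 1) ≤ (x ^ (1 / (k + 1 : ℝ) ^ 2) / (1 / (k + 1 : ℝ) ^ 2)) ^ (k + 1) := by
          gcongr
      _ = _ := by
          rw [div_div_eq_mul_div, div_one, mul_pow, mul_comm,
              ← Real.rpow_natCast (x ^ _), ← Real.rpow_mul hx0.le]
          congr 2
          push_cast
          field_simp
  have h2 : (2:ℝ) ^ ((k : ℝ) / (k + 1)) ≤ 2 := by
    refine (Real.rpow_le_rpow_of_exponent_le (by norm_num) (?_ : _ ≤ (1:ℝ))).trans
      (Real.rpow_one 2).le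
    rw [div_le_one hk]; linarith
  calc _ ≤ 2 * x ^ ((k : ℝ) / (k + 1)) * (((k + 1) ^ 2) ^ (k + 1) * x ^ (1 / (k + 1 : ℝ))) := by
        gcongr
    _ = 2 * ((k + 1) ^ 2) ^ (k + 1) * (x ^ ((k : ℝ) / (k + 1)) * x ^ (1 / (k + 1 : ℝ))) := by ring
    _ = _ := by
        rw [← Real.rpow_add hx0, ← add_div, div_self hk.ne', Real.rpow_one]

lemma log_one_add_le {l T ε : ℝ} {k : ℕ} (hl : 1 ≤ l) (hT : 1 ≤ T) (hTl : T ≤ l ^ k)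
    (hε : 0 < ε) : Real.log (1 + T) ≤ (1 + k / ε) * l ^ ε := by
  have h1 : 1 ≤ l ^ ε := Real.one_le_rpow hl hε.le
  have h2 : Real.log (1 + T) ≤ Real.log (2 * l ^ k) := Real.log_le_log (by linarith) (by linarith)
  rw [Real.log_mul (by norm_num) (by positivity), Real.log_pow] at h2
  have h3 := mul_le_mul_of_nonneg_left (Real.log_le_rpow_div (by linarith : 0 ≤ l) hε)
    (Nat.cast_nonneg k : (0:ℝ) ≤ k)
  have h4 : (1 + k / ε) * l ^ ε = l ^ ε + k * (l ^ ε / ε) := by ring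
  linarith [Real.log_two_lt_d9]

/-- The constant in the bound for the short divisor sums. -/
def shortConst (κ : ℝ) (k : ℕ) : ℝ :=
  (k + 1) * 3 ^ k * (4 * ((k + 1) ^ 2) ^ (k + 1) + 8 * (1 + (k + 2) / (κ - k)))

lemma shortConst_nonneg {κ : ℝ} {k : ℕ} (hk : k < κ) : 0 ≤ shortConst κ k := by
  have : 0 < κ - k := by linarith
  unfold shortConst
  positivity

lemma sum_divisorAF_near_le {κ : ℝ} {k : ℕ} (hk : k < κ) (hk1 : κ ≤ k + 1) {x Y T : ℝ}
    (hx : 1 ≤ x) (hl : 1 ≤ Real.log x) (hT : 1 ≤ T) (hY : 1 ≤ Y) :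
    ∑ n ∈ Finset.Ioc 0 ⌊2 * x⌋₊, divisorAF (k + 1) n / (1 + T * |Real.log (x / n)|) ≤
      shortConst κ k * (x * Y ^ κ / Real.log x + x * Real.log x ^ κ / T) := by
  have hx0 : 0 < x := by linarith
  set l := Real.log x with hl_def
  have hl0 : 0 < l := by linarith
  have hε : 0 < κ - k := by linarith
  set T' := min T (l ^ (k + 2)) with hT'
  have hT1 : 1 ≤ T' := le_min hT (one_le_pow₀ hl)
  have h1 : ∑ n ∈ Finset.Ioc 0 ⌊2 * x⌋₊, divisorAF (k + 1) n / (1 + T * |Real.log (x / n)|) ≤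
      ∑ n ∈ Finset.Ioc 0 ⌊2 * x⌋₊, divisorAF (k + 1) n / (1 + T' * |Real.log (x / n)|) := by
    refine Finset.sum_le_sum fun n _ => ?_
    have := divisorAF_nonneg (k + 1) n
    gcongr
    exact min_le_left _ _
  refine (h1.trans (sum_divisorAF_div_one_add_le k hx hT1)).trans ?_
  have h2 : (1 + Real.log (2 * x)) ^ k ≤ 3 ^ k * l ^ k := by
    rw [← mul_pow]
    have := Real.log_two_lt_d9
    have := Real.log_nonneg (by norm_num : (1:ℝ) ≤ 2)
    rw [Real.log_mul (by norm_num) hx0.ne']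
    gcongr
    linarith
  have h3 : Real.log (1 + T') ≤ (1 + (k + 2) / (κ - k)) * l ^ (κ - k) := by
    have := log_one_add_le hl hT1 (min_le_right _ _) hε
    push_cast at this
    exact this
  have hYκ : 1 ≤ Y ^ κ := Real.one_le_rpow hY (by
    have : (0:ℝ) ≤ k := Nat.cast_nonneg k
    linarith)
  have h4 : x * l ^ κ / T' ≤ x * l ^ κ / T + x * Y ^ κ / l := by
    rcases min_cases T (l ^ (k + 2)) with ⟨h, -⟩ | ⟨h, -⟩
    · rw [hT', h]
      have : 0 ≤ x * Y ^ κ / l := by positivity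
      linarith
    · rw [hT', h]
      have h5 : x * l ^ κ / l ^ (k + 2) ≤ x * Y ^ κ / l := by
        rw [div_le_div_iff₀ (by positivity) hl0, mul_assoc, mul_assoc]
        refine mul_le_mul_of_nonneg_left ?_ hx0.le
        calc l ^ κ * l ≤ l ^ ((k + 1 : ℕ) : ℝ) * l := by
              gcongr
              push_cast
              exact hk1
          _ = l ^ (k + 2) := by rw [Real.rpow_natCast, ← pow_succ]
          _ ≤ _ := le_mul_of_one_le_left (by positivity) hYκ
      have : 0 ≤ x * l ^ κ / T := by positivity
      linarith
  have h5 : x / l ≤ x * Y ^ κ / l := by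
    gcongr
    exact le_mul_of_one_le_right hx0.le hYκ
  have h6 := rpow_div_mul_pow_log_le k hx hl0
  have hlog0 : 0 ≤ Real.log (1 + T') := Real.log_nonneg (by linarith)
  have e1 : l ^ k * l ^ (κ - k) = l ^ κ := by
    rw [← Real.rpow_natCast, ← Real.rpow_add hl0]; ring_nf
  have h7 : l ^ k * (2 * (2 * x) ^ ((k : ℝ) / (k + 1)) + 4 * x / T' * Real.log (1 + T')) ≤
      (4 * ((k + 1) ^ 2) ^ (k + 1) + 8 * (1 + (k + 2) / (κ - k))) *
        (x * Y ^ κ / l + x * l ^ κ / T) := by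
    set A : ℝ := ((k + 1) ^ 2) ^ (k + 1) with hA
    set B : ℝ := 1 + (k + 2) / (κ - k) with hB
    have hA0 : 0 ≤ A := by positivity
    have hB0 : 0 ≤ B := by positivity
    have hU : 0 ≤ x * Y ^ κ / l := by positivity
    have hV : 0 ≤ x * l ^ κ / T := by positivity
    calc _ = 2 * ((2 * x) ^ ((k : ℝ) / (k + 1)) * l ^ k) +
        4 * x / T' * (l ^ k * Real.log (1 + T')) := by
          ring
      _ ≤ 2 * (2 * A * (x / l)) + 4 * x / T' * (l ^ k * (B * l ^ (κ - k))) := by gcongr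
      _ = 4 * A * (x / l) + 4 * B * (x * l ^ κ / T') := by rw [← e1]; ring
      _ ≤ 4 * A * (x * Y ^ κ / l) + 4 * B * (x * l ^ κ / T + x * Y ^ κ / l) := by gcongr
      _ ≤ _ := by nlinarith [mul_nonneg hA0 hU, mul_nonneg hA0 hV,
          mul_nonneg hB0 hU, mul_nonneg hB0 hV]
  calc _ ≤ (k + 1) * (3 ^ k * l ^ k) *
        (2 * (2 * x) ^ ((k : ℝ) / (k + 1)) + 4 * x / T' * Real.log (1 + T')) := by gcongr
    _ = (k + 1) * 3 ^ k * (l ^ k *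
        (2 * (2 * x) ^ ((k : ℝ) / (k + 1)) + 4 * x / T' * Real.log (1 + T'))) := by ring
    _ ≤ (k + 1) * 3 ^ k * ((4 * ((k + 1) ^ 2) ^ (k + 1) + 8 * (1 + (k + 2) / (κ - k))) *
        (x * Y ^ κ / l + x * l ^ κ / T)) := by gcongr
    _ = _ := by rw [shortConst]; ring

end ShortSums

section PerronCoefficients

open ArithmeticFunction

lemma continuous_mul_apply {R X : Type*} [NormedCommRing R] [TopologicalSpace X]
    {u : ArithmeticFunction R}
    {g : X → ArithmeticFunction R}
    (hg : ∀ m, Continuous fun α => g α m) (n : ℕ) : Continuous fun α => (u * g α) n := by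
  simp only [mul_apply]
  exact continuous_finsetSum _ fun q _ => continuous_const.mul (hg q.2)

variable {R : Type*} [NormedCommRing R] [NormedAlgebra ℝ R]

/-- The arithmetic function `n ↦ ∫ α in 0..η, n ^ (-a α) • u n`, for `u 1 = 0`. -/
def intTwist (a η : ℝ) (u : ArithmeticFunction R) : ArithmeticFunction R :=
  ⟨fun n => ((1 - (n : ℝ) ^ (-(a * η))) / (a * Real.log n)) • u n, by simp⟩

lemma intTwist_apply (a η : ℝ) (u : ArithmeticFunction R) (n : ℕ) :
    intTwist a η u n = ((1 - (n : ℝ) ^ (-(a * η))) / (a * Real.log n)) • u n := rfl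

lemma intTwist_add (a η : ℝ) (u v : ArithmeticFunction R) :
    intTwist a η (u + v) = intTwist a η u + intTwist a η v := by
  ext n
  simp only [intTwist_apply, ArithmeticFunction.add_apply, smul_add]

lemma continuous_twist_apply (a : ℝ) (u : ArithmeticFunction R) (n : ℕ) :
    Continuous fun α : ℝ => twist (a * α) u n := by
  rcases Nat.eq_zero_or_pos n with rfl | hn
  · simp only [ArithmeticFunction.map_zero]; exact continuous_const
  · simp only [twist_apply]
    refine Continuous.smul ?_ continuous_const
    exact Real.continuous_const_rpow (by positivity) |>.comp (by fun_prop)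

lemma integral_twist_apply [CompleteSpace R] {a : ℝ} (ha : a ≠ 0) (η : ℝ)
    {u : ArithmeticFunction R} (h1 : u 1 = 0)
    (n : ℕ) : ∫ α in (0:ℝ)..η, twist (a * α) u n = intTwist a η u n := by
  by_cases hn : n ≤ 1
  · interval_cases n <;> simp [twist_apply, intTwist_apply, h1]
  have hn0 : (0:ℝ) < n := by exact_mod_cast (by omega : 0 < n)
  have hl : Real.log n ≠ 0 := (Real.log_pos (by exact_mod_cast (by omega : 1 < n))).ne'
  simp only [twist_apply, intTwist_apply]
  rw [intervalIntegral.integral_smul_const]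
  congr 1
  have hd : ∀ α ∈ Set.uIcc 0 η, HasDerivAt (fun α : ℝ => -((n : ℝ) ^ (-(a * α))) / (a * Real.log n))
      ((n : ℝ) ^ (-(a * α))) α := by
    intro α _
    have h := ((((hasDerivAt_id α).const_mul a).neg).const_rpow hn0).neg.div_const (a * Real.log n)
    simp only [id] at h
    refine h.congr_deriv ?_
    field_simp
    rfl
  rw [intervalIntegral.integral_eq_sub_of_hasDerivAt hd]
  · simp only [mul_zero, neg_zero, Real.rpow_zero]
    ring
  · refine Continuous.intervalIntegrable ?_ _ _
    exact Real.continuous_const_rpow hn0.ne' |>.comp (by fun_prop)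

lemma integral_mul_apply [CompleteSpace R] {u : ArithmeticFunction R} {g : ℝ → ArithmeticFunction R}
    (hg : ∀ m, Continuous fun α => g α m) {h : ArithmeticFunction R} {a b : ℝ}
    (H : ∀ m, ∫ α in a..b, g α m = h m) (n : ℕ) :
    ∫ α in a..b, (u * g α) n = (u * h) n := by
  simp only [mul_apply]
  rw [intervalIntegral.integral_finsetSum fun q _ =>
    ((hg q.2).const_mul (u q.1)).intervalIntegrable _ _]
  refine Finset.sum_congr rfl fun q _ => ?_
  rw [← H]
  exact (ContinuousLinearMap.mul ℝ R (u q.1)).intervalIntegral_comp_comm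
    ((hg q.2).intervalIntegrable _ _)

/-- The Dirichlet coefficients of `𝒮(w) ℒ(w + α + 2β) Λ(w + α) Λ(w + α + 2β)`. -/
def perronCoeff (S l V : ArithmeticFunction R) (α β : ℝ) : ArithmeticFunction R :=
  S * twist α (V * twist (2 * β) (l * V))

lemma continuous_perronCoeff (S l V : ArithmeticFunction R) (n : ℕ) :
    Continuous fun q : ℝ × ℝ => perronCoeff S l V q.1 q.2 n := by
  refine continuous_mul_apply (fun m => ?_) n
  simp only [twist_apply]
  rcases Nat.eq_zero_or_pos m with rfl | hm
  · simp only [ArithmeticFunction.map_zero, smul_zero]; exact continuous_const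
  refine Continuous.smul ?_ (continuous_mul_apply (fun k => ?_) m)
  · exact Real.continuous_const_rpow (by positivity) |>.comp (by fun_prop)
  · exact (continuous_twist_apply 2 (l * V) k).comp continuous_snd

lemma integral_perronCoeff [CompleteSpace R] (S l : ArithmeticFunction R)
    {V : ArithmeticFunction R} (hV : V 1 = 0)
    (η : ℝ) (n : ℕ) :
    ∫ α in (0:ℝ)..η, ∫ β in (0:ℝ)..η, perronCoeff S l V α β n =
      (S * intTwist 1 η (V * intTwist 2 η (l * V))) n := by
  have h1 : ∀ α, ∫ β in (0:ℝ)..η, perronCoeff S l V α β n =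
      (S * twist (1 * α) (V * intTwist 2 η (l * V))) n := by
    intro α
    rw [one_mul]
    refine integral_mul_apply (fun m => ?_) (fun m => ?_) n
    · simp only [twist_apply]
      exact (continuous_mul_apply (fun k => continuous_twist_apply 2 (l * V) k) m).const_smul _
    · simp only [twist_apply]
      rw [intervalIntegral.integral_smul]
      congr 1
      exact integral_mul_apply (fun k => continuous_twist_apply 2 (l * V) k)
        (fun k => integral_twist_apply two_ne_zero η (by simp [hV]) k) m
  simp only [h1]
  exact integral_mul_apply (fun m => continuous_twist_apply 1 _ m)
    (fun m => integral_twist_apply one_ne_zero η (by simp [hV]) m) n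

lemma intTwist_one_logMul (η : ℝ) (l : ArithmeticFunction R) :
    intTwist 1 η (logMul l) + twist η l = l := by
  ext n
  by_cases hn : n ≤ 1
  · interval_cases n <;> simp [twist_apply, intTwist_apply, logMul_apply]
  have hl : Real.log n ≠ 0 := (Real.log_pos (by exact_mod_cast (by omega : 1 < n))).ne'
  rw [ArithmeticFunction.add_apply, intTwist_apply,
      logMul_apply, twist_apply, smul_smul, ← add_smul,
    one_mul, one_mul, div_mul_cancel₀ _ hl, sub_add_cancel, one_smul]

lemma two_intTwist_two_logMul (η : ℝ) (l : ArithmeticFunction R) :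
    intTwist 2 η (logMul l) + intTwist 2 η (logMul l) + twist (2 * η) l = l := by
  ext n
  by_cases hn : n ≤ 1
  · interval_cases n <;> simp [twist_apply, intTwist_apply, logMul_apply]
  have hl : Real.log n ≠ 0 := (Real.log_pos (by exact_mod_cast (by omega : 1 < n))).ne'
  rw [ArithmeticFunction.add_apply, ArithmeticFunction.add_apply, intTwist_apply, logMul_apply,
    twist_apply, smul_smul, ← add_smul, ← add_smul]
  convert one_smul ℝ (l n) using 2
  field_simp
  ring

/-- The exact evaluation of the main term. -/
lemma two_intTwist_perron_eq {S l V : ArithmeticFunction R} (hl : logMul l = V * l) (η : ℝ) :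
    S * intTwist 1 η (V * intTwist 2 η (l * V)) + S * intTwist 1 η (V * intTwist 2 η (l * V)) +
      (S * twist η l + S * intTwist 1 η (V * twist (2 * η) l)) = S * l := by
  have h2 := two_intTwist_two_logMul η l
  have h1 := intTwist_one_logMul η l
  rw [mul_comm l V, ← hl]
  have h3 : V * intTwist 2 η (logMul l) + V * intTwist 2 η (logMul l) + V * twist (2 * η) l =
      logMul l := by rw [← mul_add, ← mul_add, h2, hl]
  have h4 := congrArg (intTwist 1 η) h3
  rw [intTwist_add, intTwist_add] at h4
  rw [← mul_add, ← mul_add, ← mul_add]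
  congr 1
  calc _ = _ := add_comm _ _
    _ = twist η l + (intTwist 1 η (V * intTwist 2 η (logMul l)) +
        intTwist 1 η (V * intTwist 2 η (logMul l)) + intTwist 1 η (V * twist (2 * η) l)) := by abel
    _ = l := by rw [h4, add_comm, h1]

end PerronCoefficients

section MainTerm

open ArithmeticFunction

/-- The restriction of an arithmetic function to a finite set. -/
def truncateTo {R : Type*} [Zero R] (I : Finset ℕ) (u : ArithmeticFunction R) :
    ArithmeticFunction R := ⟨fun n => if n ∈ I then u n else 0, by simp⟩

lemma truncateTo_apply {R : Type*} [Zero R] (I : Finset ℕ) (u : ArithmeticFunction R) (n : ℕ) :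
    truncateTo I u n = if n ∈ I then u n else 0 := rfl

lemma mul_apply_congr {R : Type*} [Semiring R] {u v u' v' : ArithmeticFunction R} {n : ℕ}
    (h : ∀ a b, a * b = n → n ≠ 0 → u a * v b = u' a * v' b) : (u * v) n = (u' * v') n := by
  rw [mul_apply, mul_apply]
  refine Finset.sum_congr rfl fun q hq => ?_
  obtain ⟨h1, h2⟩ := Nat.mem_divisorsAntidiagonal.mp hq
  exact h q.1 q.2 h1 h2

/-- Truncating `V` to `y < m < x / y` does not affect the coefficients up to `x`. -/
lemma perronCoeff_truncateTo {S l V : ArithmeticFunction ℂ} {x y : ℝ} (hy : 0 < y)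
    (hV : ∀ n : ℕ, (n : ℝ) ≤ y → V n = 0) (α β : ℝ) {n : ℕ} (hn : (n : ℝ) ≤ x) :
    perronCoeff S l (truncateTo (Finset.Ioo ⌊y⌋₊ ⌈x / y⌉₊) V) α β n = perronCoeff S l V α β n := by
  set Vt := truncateTo (Finset.Ioo ⌊y⌋₊ ⌈x / y⌉₊) V with hVt
  have hlow : ∀ m : ℕ, (m : ℝ) ≤ y → Vt m = 0 := by
    intro m hm
    rw [hVt, truncateTo_apply, hV m hm, ite_self]
  have heq : ∀ m : ℕ, (m : ℝ) < x / y → Vt m = V m := by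
    intro m hm
    by_cases hmy : (m : ℝ) ≤ y
    · rw [hlow m hmy, hV m hmy]
    · rw [hVt, truncateTo_apply, if_pos]
      exact Finset.mem_Ioo.mpr ⟨(Nat.floor_lt hy.le).mpr (not_le.mp hmy), Nat.lt_ceil.mpr hm⟩
  have hmul0 : ∀ W : ArithmeticFunction ℂ, (∀ m : ℕ, (m : ℝ) ≤ y → W m = 0) →
      ∀ m : ℕ, (m : ℝ) ≤ y → (l * W) m = 0 := by
    intro W hW m hm
    rw [mul_apply]
    refine Finset.sum_eq_zero fun q hq => ?_
    obtain ⟨h1, h2⟩ := Nat.mem_divisorsAntidiagonal.mp hq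
    rw [hW q.2, mul_zero]
    exact (Nat.cast_le.mpr (Nat.le_of_dvd (Nat.pos_of_ne_zero h2)
        ⟨q.1, by rw [← h1, mul_comm]⟩)).trans hm
  refine mul_apply_congr fun i j hij hn0 => ?_
  congr 1
  rw [twist_apply, twist_apply]
  congr 1
  refine mul_apply_congr fun a b hab hj0 => ?_
  rw [twist_apply, twist_apply]
  by_cases ha : (a : ℝ) ≤ y
  · rw [hlow a ha, hV a ha, zero_mul, zero_mul]
  by_cases hb : (b : ℝ) ≤ y
  · rw [hmul0 V hV b hb, hmul0 Vt hlow b hb, smul_zero, mul_zero, mul_zero]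
  push Not at ha hb
  have hjx : (a : ℝ) * b ≤ x := by
    refine le_trans ?_ hn
    rw [← Nat.cast_mul, hab]
    exact_mod_cast Nat.le_of_dvd (Nat.pos_of_ne_zero hn0) ⟨i, by rw [← hij, mul_comm]⟩
  have hax : (a : ℝ) < x / y := by rw [lt_div_iff₀ hy]; nlinarith
  have hbx : (b : ℝ) < x / y := by rw [lt_div_iff₀ hy]; nlinarith
  rw [heq a hax]
  congr 2
  refine mul_apply_congr fun c d hcd hb0 => ?_
  rw [heq d]
  refine lt_of_le_of_lt ?_ hbx
  exact_mod_cast Nat.le_of_dvd (Nat.pos_of_ne_zero hb0) ⟨c, by rw [← hcd, mul_comm]⟩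

lemma log_mul_sum_le {g : ArithmeticFunction ℝ} (hg : ∀ n, 0 ≤ g n) {κ x : ℝ} (hκ : 0 ≤ κ)
    (hx : 0 < x) (h : ∀ n, logMul g n ≤ κ * (Λ * g) n) :
    Real.log x * ∑ n ∈ Finset.Ioc 0 ⌊x⌋₊, g n ≤
      (6 * κ + 1) * x * ∑ n ∈ Finset.Ioc 0 ⌊x⌋₊, twist 1 g n := by
  have h1 : ∀ n ∈ Finset.Ioc 0 ⌊x⌋₊, Real.log x * g n ≤ κ * (Λ * g) n + x * twist 1 g n := by
    intro n hn
    have hn0 : (0:ℝ) < n := by exact_mod_cast (Finset.mem_Ioc.mp hn).1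
    have h2 := h n
    rw [logMul_apply, smul_eq_mul] at h2
    rw [twist_apply, Real.rpow_neg_one, smul_eq_mul]
    have h3 : Real.log x ≤ Real.log n + x / n := by
      have := Real.log_le_sub_one_of_pos (div_pos hx hn0)
      rw [Real.log_div hx.ne' hn0.ne'] at this
      linarith
    calc Real.log x * g n ≤ (Real.log n + x / n) * g n := mul_le_mul_of_nonneg_right h3 (hg n)
      _ = Real.log n * g n + x * ((n : ℝ)⁻¹ * g n) := by ring
      _ ≤ _ := by linarith
  have h4 : ∑ n ∈ Finset.Ioc 0 ⌊x⌋₊, (Λ * g) n ≤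
      6 * x * ∑ n ∈ Finset.Ioc 0 ⌊x⌋₊, twist 1 g n := by
    rw [mul_comm, sum_Ioc_mul_eq_sum_sum, Finset.mul_sum]
    refine Finset.sum_le_sum fun n hn => ?_
    have hn0 : (0:ℝ) < n := by exact_mod_cast (Finset.mem_Ioc.mp hn).1
    rw [twist_apply, Real.rpow_neg_one, smul_eq_mul]
    calc _ ≤ g n * (6 * (x / n)) := by
          refine mul_le_mul_of_nonneg_left ((sum_vonMangoldt_le _).trans ?_) (hg n)
          refine mul_le_mul_of_nonneg_left (Nat.cast_div_le.trans ?_) (by norm_num)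
          exact div_le_div_of_nonneg_right (Nat.floor_le hx.le) hn0.le
      _ = _ := by ring
  rw [Finset.mul_sum]
  refine (Finset.sum_le_sum h1).trans ?_
  rw [Finset.sum_add_distrib, ← Finset.mul_sum, ← Finset.mul_sum]
  nlinarith [mul_le_mul_of_nonneg_left h4 hκ]

/-- The arithmetic function `Λ(n) / log n` restricted to `n > y`. -/
def primePowerTail (y : ℝ) : ArithmeticFunction ℝ :=
  ⟨fun n => if y < n then Λ n / Real.log n else 0, by simp⟩

lemma primePowerTail_apply (y : ℝ) (n : ℕ) :
    primePowerTail y n = if y < n then Λ n / Real.log n else 0 := rfl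

lemma primePowerTail_nonneg (y : ℝ) (n : ℕ) : 0 ≤ primePowerTail y n := by
  rw [primePowerTail_apply]
  split_ifs
  exacts [vonMangoldt_div_log_nonneg n, le_rfl]

lemma sum_primePowerTail_mul_le {g : ArithmeticFunction ℝ} (hg : ∀ n, 0 ≤ g n) {x y : ℝ}
    (hy : 10 ≤ y) (hx : 0 < x) :
    Real.log x * ∑ n ∈ Finset.Ioc 0 ⌊x⌋₊, (primePowerTail y * g) n ≤
      14 * x * ∑ n ∈ Finset.Ioc 0 ⌊x⌋₊, twist (1 - 1 / Real.log y) g n := by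
  have hly := log_ge_of_ten_le hy
  rw [mul_comm (primePowerTail y), sum_Ioc_mul_eq_sum_sum, Finset.mul_sum, Finset.mul_sum]
  refine Finset.sum_le_sum fun n hn => ?_
  have hn1 : 1 ≤ n := (Finset.mem_Ioc.mp hn).1
  have hn0 : (0:ℝ) < n := by exact_mod_cast hn1
  rw [twist_apply, smul_eq_mul, neg_sub]
  have hZ : ((⌊x⌋₊ / n : ℕ) : ℝ) ≤ x / n :=
    Nat.cast_div_le.trans (div_le_div_of_nonneg_right (Nat.floor_le hx.le) hn0.le)
  by_cases h : x / n ≤ y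
  · rw [Finset.sum_eq_zero, mul_zero, mul_zero]
    · have := hg n
      positivity
    · intro m hm
      rw [primePowerTail_apply, if_neg]
      refine not_lt.mpr (le_trans ?_ (hZ.trans h))
      exact_mod_cast (Finset.mem_Ioc.mp hm).2
  push Not at h
  have hlZ : Real.log y ≤ Real.log (x / n) := Real.log_le_log (by linarith) h.le
  have hlZ0 : 0 < Real.log (x / n) := by linarith
  have hln : 0 ≤ Real.log n := Real.log_natCast_nonneg n
  have h1 : ∑ m ∈ Finset.Ioc 0 (⌊x⌋₊ / n),
      primePowerTail y m ≤ 14 * (x / n / Real.log (x / n)) := by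
    refine le_trans ?_ (sum_vonMangoldt_div_log_le_div (by linarith))
    refine (Finset.sum_le_sum_of_subset_of_nonneg (Finset.Ioc_subset_Ioc_right (Nat.le_floor hZ))
      fun m _ _ => primePowerTail_nonneg y m).trans (Finset.sum_le_sum fun m _ => ?_)
    rw [primePowerTail_apply]
    split_ifs
    exacts [le_rfl, vonMangoldt_div_log_nonneg m]
  have h2 : Real.log x ≤ (n : ℝ) ^ (1 / Real.log y) * Real.log (x / n) := by
    rw [Real.rpow_def_of_pos hn0]
    have h3 := Real.add_one_le_exp (Real.log n * (1 / Real.log y))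
    have h4 : Real.log x = Real.log n + Real.log (x / n) := by
      rw [Real.log_div hx.ne' hn0.ne']; ring
    have h5 : Real.log n ≤ Real.log n * (1 / Real.log y) * Real.log (x / n) := by
      rw [mul_one_div, div_mul_eq_mul_div, le_div_iff₀ (by linarith)]
      exact mul_le_mul_of_nonneg_left hlZ hln
    nlinarith
  have h6 : 0 ≤ ∑ m ∈ Finset.Ioc 0 (⌊x⌋₊ / n), primePowerTail y m :=
    Finset.sum_nonneg fun m _ => primePowerTail_nonneg y m
  calc _ = g n * (Real.log x * ∑ m ∈ Finset.Ioc 0 (⌊x⌋₊ / n), primePowerTail y m) := by ring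
    _ ≤ g n * ((n : ℝ) ^ (1 / Real.log y) * Real.log (x / n) * (14 * (x / n / Real.log (x / n)))) :=
        mul_le_mul_of_nonneg_left (mul_le_mul h2 h1 h6 (by positivity)) (hg n)
    _ = 14 * x * ((n : ℝ) ^ (1 / Real.log y) / n * g n) := by
        field_simp
    _ = _ := by rw [Real.rpow_sub hn0, Real.rpow_one]

lemma norm_intTwist_one_mul_le {V w : ArithmeticFunction ℂ} {κ y η : ℝ} (hy : 1 ≤ y)
    (hη : 0 ≤ η) (hV : ∀ n, ‖V n‖ ≤ κ * Λ n) (hV0 : ∀ n : ℕ, (n : ℝ) ≤ y → V n = 0) (n : ℕ) :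
    ‖intTwist 1 η (V * w) n‖ ≤ κ * (primePowerTail y * normAF w) n := by
  by_cases hn : n ≤ 1
  · rw [mul_apply]
    interval_cases n
    · simp
    · simp [intTwist_apply, primePowerTail_apply]
  have hl : 0 < Real.log n := Real.log_pos (by exact_mod_cast (by omega : 1 < n))
  have hp : (n : ℝ) ^ (-(1 * η)) ≤ 1 :=
    Real.rpow_le_one_of_one_le_of_nonpos (by exact_mod_cast (by omega : 1 ≤ n)) (by linarith)
  have hp0 : 0 ≤ (n : ℝ) ^ (-(1 * η)) := by positivity
  rw [intTwist_apply, norm_smul, Real.norm_of_nonneg (div_nonneg (by linarith) (by linarith)),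
    mul_apply, mul_apply, Finset.mul_sum]
  calc _ ≤ 1 / Real.log n * ∑ q ∈ n.divisorsAntidiagonal, ‖V q.1 * w q.2‖ := by
        refine mul_le_mul ?_ (norm_sum_le _ _) (norm_nonneg _) (by positivity)
        rw [one_mul (Real.log n)]
        exact div_le_div_of_nonneg_right (by linarith) hl.le
    _ ≤ _ := by
        rw [Finset.mul_sum]
        refine Finset.sum_le_sum fun q hq => ?_
        obtain ⟨h1, h2⟩ := Nat.mem_divisorsAntidiagonal.mp hq
        rw [norm_mul, normAF_apply, ← mul_assoc, ← mul_assoc]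
        refine mul_le_mul_of_nonneg_right ?_ (norm_nonneg _)
        rw [primePowerTail_apply]
        split_ifs with h
        · have hq1 : (1:ℝ) < q.1 := by linarith
          have hlq := Real.log_pos hq1
          have hqn : (q.1 : ℝ) ≤ n := by
            exact_mod_cast Nat.le_of_dvd (Nat.pos_of_ne_zero h2) ⟨q.2, h1.symm⟩
          calc _ ≤ 1 / Real.log q.1 * (κ * Λ q.1) := by
                refine mul_le_mul (one_div_le_one_div_of_le hlq
                  (Real.log_le_log (by linarith) hqn)) (hV _) (norm_nonneg _) (by positivity)
            _ = _ := by ring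
        · rw [hV0 _ (not_lt.mp h)]; simp

variable {κ x y : ℝ} {F L : ArithmeticFunction ℂ}

lemma HalaszPair.logMul_normAF_restrictPrimes_le (h : HalaszPair κ F L) (hκ : 0 ≤ κ)
    (P : ℕ → Prop) (n : ℕ) :
    logMul (normAF (restrictPrimes P F)) n ≤ ((κ • Λ) * normAF (restrictPrimes P F)) n := by
  rw [← normAF_logMul, h.logMul_restrictPrimes_eq, normAF_apply]
  refine (norm_mul_apply_le _ _ n).trans (mul_apply_le_mul_apply (normAF_nonneg _)
    (fun m => mul_nonneg hκ vonMangoldt_nonneg) (fun m => ?_) (fun _ => le_rfl) n)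
  exact (h.norm_restrictPrimes_le P m).trans (mul_le_mul_of_nonneg_left
    (restrictPrimes_le P (fun _ => vonMangoldt_nonneg) m) hκ)

lemma HalaszPair.logMul_smooth_mul_rough_le (h : HalaszPair κ F L) (hκ : 0 ≤ κ) {η : ℝ}
    (hη : 0 ≤ η) (P Q : ℕ → Prop) (n : ℕ) :
    logMul (normAF (restrictPrimes P F) * twist η (normAF (restrictPrimes Q F))) n ≤
      2 * κ * (Λ * (normAF (restrictPrimes P F) * twist η (normAF (restrictPrimes Q F)))) n := by
  set s := normAF (restrictPrimes P F)
  set l := normAF (restrictPrimes Q F)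
  have hs : ∀ n, 0 ≤ s n := normAF_nonneg _
  have hl : ∀ n, 0 ≤ l n := normAF_nonneg _
  have hΛ : ∀ n, 0 ≤ (κ • Λ) n := fun m => mul_nonneg hκ vonMangoldt_nonneg
  have h1 := h.logMul_normAF_restrictPrimes_le hκ P
  have h2 : ∀ n, logMul (twist η l) n ≤ ((κ • Λ) * twist η l) n := by
    intro n
    rw [logMul_twist]
    refine (twist_le_twist η (h.logMul_normAF_restrictPrimes_le hκ Q) n).trans ?_
    rw [twist_mul]
    refine mul_apply_le_mul_apply (twist_nonneg _ hl) hΛ (fun m => ?_) (fun _ => le_rfl) n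
    refine (twist_anti hη hΛ m).trans_eq ?_
    rw [twist_zero]
  have h3 : (κ • Λ) * (s * twist η l) = κ • (Λ * (s * twist η l)) := by
    rw [smul_mul_assoc]
  have h4 : ((κ • Λ) * (s * twist η l)) n = κ * (Λ * (s * twist η l)) n := by
    rw [h3]; rfl
  rw [logMul_mul, ArithmeticFunction.add_apply]
  have h5 : (logMul s * twist η l) n ≤ ((κ • Λ) * (s * twist η l)) n := by
    rw [← mul_assoc]
    exact mul_apply_le_mul_apply (twist_nonneg _ hl) (mul_apply_nonneg hΛ hs) h1
      (fun _ => le_rfl) n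
  have h6 : (s * logMul (twist η l)) n ≤ ((κ • Λ) * (s * twist η l)) n := by
    rw [mul_left_comm]
    exact mul_apply_le_mul_apply (fun m => mul_nonneg (Real.log_natCast_nonneg m)
      (twist_nonneg _ hl m)) hs (fun _ => le_rfl) h2 n
  linarith

lemma HalaszPair.sum_twist_smooth_mul_rough_le (h : HalaszPair κ F L) (hκ : 0 ≤ κ) (hy : 10 ≤ y)
    {θ φ : ℝ} (hθ : 1 - 2 * (1 / Real.log y) ≤ θ) (hφ : θ + φ = 1 + 1 / Real.log y) (N : ℕ) :
    ∑ n ∈ Finset.Ioc 0 N, twist θ (normAF (restrictPrimes (fun p => (p : ℝ) ≤ y) F) *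
      twist φ (normAF (restrictPrimes (fun p => y < (p : ℝ)) F))) n ≤
    halaszConst κ ^ 2 * Real.log y ^ κ := by
  have hA := halaszConst_pos κ
  have hly := log_ge_of_ten_le hy
  rw [twist_mul, twist_twist, hφ]
  refine (sum_mul_apply_le (twist_nonneg _ (normAF_nonneg _)) (twist_nonneg _ (normAF_nonneg _))
    N).trans ?_
  calc _ ≤ (halaszConst κ * Real.log y ^ κ) * halaszConst κ := by
        refine mul_le_mul ((Finset.sum_le_sum fun n _ => twist_anti hθ (normAF_nonneg _) n).trans
          (h.sum_smooth_le hκ hy N)) (h.sum_rough_le hκ hy N)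
          (Finset.sum_nonneg fun n _ => twist_nonneg _ (normAF_nonneg _) n) (by positivity)
    _ = _ := by ring

lemma HalaszPair.restrictPrimes_apply_eq_zero (h : HalaszPair κ F L) {n : ℕ}
    (hn : (n : ℝ) ≤ y) : restrictPrimes (fun p => y < (p : ℝ)) L n = 0 := by
  by_cases h0 : n ≤ 1
  · have := h.norm_restrictPrimes_le (fun p => y < (p : ℝ)) n
    rw [← norm_le_zero_iff]
    refine this.trans (le_of_eq ?_)
    interval_cases n <;> simp [restrictPrimes_apply]
  · rw [restrictPrimes_apply, if_neg]
    exact fun hc => absurd (lt_of_rough (by omega) (by omega) hc) hn.not_gt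

/-- The main term. -/
lemma HalaszPair.norm_sum_integral_perronCoeff_sub_le (h : HalaszPair κ F L) (hκ : 0 ≤ κ)
    (hy : 10 ≤ y) (hx : 1 < x) :
    ‖∑ n ∈ Finset.Ioc 0 ⌊x⌋₊, 2 * (∫ α in (0:ℝ)..(1 / Real.log y), ∫ β in (0:ℝ)..(1 / Real.log y),
        perronCoeff (restrictPrimes (fun p => (p : ℝ) ≤ y) F)
          (restrictPrimes (fun p => y < (p : ℝ)) F)
          (restrictPrimes (fun p => y < (p : ℝ)) L) α β n) - ∑ n ∈ Finset.Ioc 0 ⌊x⌋₊, F n‖ ≤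
      (26 * κ + 1) * halaszConst κ ^ 2 * (x * Real.log y ^ κ / Real.log x) := by
  have hly := log_ge_of_ten_le hy
  have hlx := Real.log_pos hx
  set η := 1 / Real.log y with hη
  have hη0 : 0 ≤ η := by positivity
  set S := restrictPrimes (fun p => (p : ℝ) ≤ y) F with hS
  set l := restrictPrimes (fun p => y < (p : ℝ)) F with hl
  set V := restrictPrimes (fun p => y < (p : ℝ)) L with hV
  have hV0 : ∀ n : ℕ, (n : ℝ) ≤ y → V n = 0 :=
    fun n hn => h.restrictPrimes_apply_eq_zero hn
  have hVn : ∀ n, ‖V n‖ ≤ κ * Λ n := fun n => (h.norm_restrictPrimes_le _ n).trans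
    (mul_le_mul_of_nonneg_left (restrictPrimes_le _ (fun _ => vonMangoldt_nonneg) n) hκ)
  have hSl : S * l = F := by
    have := restrictPrimes_mul_restrictPrimes_not (fun p => (p : ℝ) ≤ y) h.mult
    simpa only [not_le] using this
  have hmain := two_intTwist_perron_eq (S := S) (h.logMul_restrictPrimes_eq fun p => y < (p : ℝ)) η
  rw [← hl, ← hV, hSl] at hmain
  have hA := halaszConst_pos κ
  set B := halaszConst κ ^ 2 * Real.log y ^ κ with hB
  have e1 : Real.log x * ∑ n ∈ Finset.Ioc 0 ⌊x⌋₊, ‖(S * twist η l) n‖ ≤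
      (12 * κ + 1) * x * B := by
    calc _ ≤ Real.log x * ∑ n ∈ Finset.Ioc 0 ⌊x⌋₊, (normAF S * twist η (normAF l)) n := by
          refine mul_le_mul_of_nonneg_left (Finset.sum_le_sum fun n _ => ?_) hlx.le
          exact (norm_mul_apply_le _ _ n).trans_eq (by rw [normAF_twist])
      _ ≤ (6 * (2 * κ) + 1) * x * ∑ n ∈ Finset.Ioc 0 ⌊x⌋₊,
            twist 1 (normAF S * twist η (normAF l)) n :=
          log_mul_sum_le (mul_apply_nonneg (normAF_nonneg _) (twist_nonneg _ (normAF_nonneg _)))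
            (by positivity) (by linarith) (h.logMul_smooth_mul_rough_le hκ hη0 _ _)
      _ ≤ (6 * (2 * κ) + 1) * x * B := by
          refine mul_le_mul_of_nonneg_left ?_ (by positivity)
          exact h.sum_twist_smooth_mul_rough_le hκ hy (by linarith) rfl _
      _ = _ := by ring
  have e2 : Real.log x * ∑ n ∈ Finset.Ioc 0 ⌊x⌋₊, ‖(S * intTwist 1 η (V * twist (2 * η) l)) n‖ ≤
      14 * κ * x * B := by
    set g := normAF S * twist (2 * η) (normAF l) with hg
    calc _ ≤ Real.log x * ∑ n ∈ Finset.Ioc 0 ⌊x⌋₊, κ * (primePowerTail y * g) n := by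
          refine mul_le_mul_of_nonneg_left (Finset.sum_le_sum fun n _ => ?_) hlx.le
          refine (norm_mul_apply_le _ _ n).trans ?_
          calc _ ≤ (normAF S * (κ • (primePowerTail y * normAF (twist (2 * η) l)))) n := by
                refine mul_apply_le_mul_apply (normAF_nonneg _) (normAF_nonneg _)
                  (fun _ => le_rfl) (fun m => ?_) n
                exact norm_intTwist_one_mul_le (by linarith) hη0 hVn hV0 m
            _ = (κ • (primePowerTail y * g)) n := by
                rw [hg, mul_left_comm, mul_smul_comm, normAF_twist]
            _ = _ := rfl
      _ = κ * (Real.log x * ∑ n ∈ Finset.Ioc 0 ⌊x⌋₊, (primePowerTail y * g) n) := by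
          rw [← Finset.mul_sum]; ring
      _ ≤ κ * (14 * x * B) := by
          refine mul_le_mul_of_nonneg_left ((sum_primePowerTail_mul_le
            (mul_apply_nonneg (normAF_nonneg _) (twist_nonneg _ (normAF_nonneg _))) hy
            (by linarith)).trans ?_) hκ
          refine mul_le_mul_of_nonneg_left ?_ (by linarith)
          exact h.sum_twist_smooth_mul_rough_le hκ hy (by linarith) (by ring) _
      _ = _ := by ring
  have hrw : ∀ n, 2 * (∫ α in (0:ℝ)..η, ∫ β in (0:ℝ)..η, perronCoeff S l V α β n) - F n =
      -((S * twist η l) n + (S * intTwist 1 η (V * twist (2 * η) l)) n) := by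
    intro n
    rw [integral_perronCoeff S l (hV0 1 (by push_cast; linarith))]
    have := congrArg (fun u : ArithmeticFunction ℂ => u n) hmain
    simp only [ArithmeticFunction.add_apply] at this
    rw [← this]
    ring
  rw [← Finset.sum_sub_distrib]
  simp only [hrw]
  refine (norm_sum_le _ _).trans ((Finset.sum_le_sum fun n _ =>
    (norm_neg _).trans_le (norm_add_le _ _)).trans ?_)
  rw [Finset.sum_add_distrib]
  have : (26 * κ + 1) * halaszConst κ ^ 2 * (x * Real.log y ^ κ / Real.log x) =
      ((12 * κ + 1) * x * B + 14 * κ * x * B) / Real.log x := by rw [hB]; ring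
  rw [this, le_div_iff₀ hlx]
  linarith

end MainTerm

section Majorant

open ArithmeticFunction

lemma norm_perronCoeff_le {S l V : ArithmeticFunction ℂ} {S' l' V' : ArithmeticFunction ℝ}
    (hS : ∀ n, ‖S n‖ ≤ S' n) (hl : ∀ n, ‖l n‖ ≤ l' n) (hV : ∀ n, ‖V n‖ ≤ V' n) (α β : ℝ) (n : ℕ) :
    ‖perronCoeff S l V α β n‖ ≤ perronCoeff S' l' V' α β n := by
  have hS0 : ∀ n, 0 ≤ S' n := fun n => (norm_nonneg _).trans (hS n)
  have hl0 : ∀ n, 0 ≤ l' n := fun n => (norm_nonneg _).trans (hl n)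
  have hV0 : ∀ n, 0 ≤ V' n := fun n => (norm_nonneg _).trans (hV n)
  have key : ∀ {u v : ArithmeticFunction ℂ} {u' v' : ArithmeticFunction ℝ}, (∀ n, ‖u n‖ ≤ u' n) →
      (∀ n, ‖v n‖ ≤ v' n) → ∀ n, ‖(u * v) n‖ ≤ (u' * v') n := fun hu hv n =>
    (norm_mul_apply_le _ _ n).trans (mul_apply_le_mul_apply (normAF_nonneg _)
      (fun m => (norm_nonneg _).trans (hu m)) hu hv n)
  have tw : ∀ {u : ArithmeticFunction ℂ} {u' : ArithmeticFunction ℝ} (θ : ℝ), (∀ n, ‖u n‖ ≤ u' n) →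
      ∀ n, ‖twist θ u n‖ ≤ twist θ u' n := fun θ hu n => by
    have := twist_le_twist (u := normAF _) θ hu n
    rwa [← normAF_twist] at this
  exact key hS (tw α (key hV (tw (2 * β) (key hl hV)))) n

lemma intTwist_le_intTwist {a η : ℝ} (ha : 0 ≤ a) (hη : 0 ≤ η) {u v : ArithmeticFunction ℝ}
    (h : ∀ n, u n ≤ v n) (n : ℕ) : intTwist a η u n ≤ intTwist a η v n := by
  rcases Nat.eq_zero_or_pos n with rfl | hn
  · simp
  · have : (n : ℝ) ^ (-(a * η)) ≤ 1 := Real.rpow_le_one_of_one_le_of_nonpos (by exact_mod_cast hn)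
      (by have := mul_nonneg ha hη; linarith)
    exact mul_le_mul_of_nonneg_left (h n) (div_nonneg (by linarith)
      (mul_nonneg ha (Real.log_natCast_nonneg n)))

lemma intTwist_logMul_le {a : ℝ} (ha : 1 ≤ a) (η : ℝ) {u : ArithmeticFunction ℝ}
    (hu : ∀ n, 0 ≤ u n) (n : ℕ) : intTwist a η (logMul u) n ≤ u n := by
  by_cases hn : n ≤ 1
  · interval_cases n
    · simp
    · simpa [intTwist_apply] using hu 1
  · have hl : 0 < Real.log n := Real.log_pos (by exact_mod_cast (by omega : 1 < n))
    have hp : 0 ≤ (n : ℝ) ^ (-(a * η)) := by positivity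
    rw [intTwist_apply, logMul_apply, smul_eq_mul, smul_eq_mul, ← mul_assoc]
    refine mul_le_of_le_one_left (hu n) ?_
    rw [div_mul_eq_mul_div, mul_div_mul_right _ _ hl.ne', div_le_one (by linarith)]
    linarith

/-- The majorant of the Perron coefficients integrates to at most a divisor function. -/
lemma integral_perronCoeff_divisorAF_le (k : ℕ) {y η : ℝ} (hη : 0 ≤ η) (n : ℕ) :
    ∫ α in (0:ℝ)..η, ∫ β in (0:ℝ)..η,
      perronCoeff (restrictPrimes (fun p => (p : ℝ) ≤ y) (divisorAF k))
        (restrictPrimes (fun p => y < (p : ℝ)) (divisorAF k))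
        (restrictPrimes (fun p => y < (p : ℝ)) (k • Λ)) α β n ≤ divisorAF k n := by
  have hD := divisorAF_nonneg k
  have hΛ : ∀ n, 0 ≤ (k • Λ) n := fun m => by
    rw [nsmul_arithmeticFunction_apply]
    exact mul_nonneg (Nat.cast_nonneg k) vonMangoldt_nonneg
  have h1 : restrictPrimes (fun p => y < (p : ℝ)) (k • Λ) 1 = 0 := by
    rw [restrictPrimes_apply, nsmul_arithmeticFunction_apply]
    simp
  rw [integral_perronCoeff _ _ h1]
  set s := restrictPrimes (fun p => (p : ℝ) ≤ y) (divisorAF k)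
  set l := restrictPrimes (fun p => y < (p : ℝ)) (divisorAF k)
  set W := restrictPrimes (fun p => y < (p : ℝ)) (k • Λ)
  have hs : ∀ n, 0 ≤ s n := restrictPrimes_nonneg _ hD
  have hl : ∀ n, 0 ≤ l n := restrictPrimes_nonneg _ hD
  have hW : ∀ n, 0 ≤ W n := restrictPrimes_nonneg _ hΛ
  have hlog : logMul l = W * l := by
    rw [logMul_restrictPrimes, logMul_divisorAF, restrictPrimes_mul]
  have hsl : s * l = divisorAF k := by
    have := restrictPrimes_mul_restrictPrimes_not (fun p => (p : ℝ) ≤ y)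
      (isMultiplicative_divisorAF k)
    simpa only [not_le] using this
  have hi : ∀ a, 0 ≤ a →
      ∀ u : ArithmeticFunction ℝ, (∀ n, 0 ≤ u n) → ∀ n, 0 ≤ intTwist a η u n := by
    intro a ha u hu n
    refine le_trans (le_of_eq ?_) (intTwist_le_intTwist ha hη (u := 0) hu n)
    simp [intTwist_apply]
  rw [mul_comm l W, ← hlog]
  have hll : ∀ n, 0 ≤ logMul l n := fun n => mul_nonneg (Real.log_natCast_nonneg n) (hl n)
  calc _ ≤ (s * intTwist 1 η (W * l)) n := by
        refine mul_apply_le_mul_apply (hi 1 (by norm_num) _ (mul_apply_nonneg hW (hi 2 (by norm_num)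
          _ hll))) hs (fun _ => le_rfl) (intTwist_le_intTwist (by norm_num) hη ?_) n
        exact mul_apply_le_mul_apply (hi 2 (by norm_num) _ hll) hW (fun _ => le_rfl)
          (intTwist_logMul_le (by norm_num) η hl)
    _ ≤ (s * l) n := by
        rw [← hlog]
        exact mul_apply_le_mul_apply (hi 1 (by norm_num) _ hll) hs (fun _ => le_rfl)
          (intTwist_logMul_le (by norm_num) η hl) n
    _ = _ := by rw [hsl]

end Majorant

section Perron

open ArithmeticFunction

lemma sum_range_le_sum_Ioc {u : ArithmeticFunction ℝ} (hu : ∀ n, 0 ≤ u n) (N : ℕ) :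
    ∑ n ∈ Finset.range N, u n ≤ ∑ n ∈ Finset.Ioc 0 N, u n := by
  rw [← Finset.sum_filter_ne_zero]
  refine Finset.sum_le_sum_of_subset_of_nonneg (fun n hn => ?_) fun n _ _ => hu n
  obtain ⟨h1, h2⟩ := Finset.mem_filter.mp hn
  refine Finset.mem_Ioc.mpr ⟨Nat.pos_of_ne_zero ?_, (Finset.mem_range.mp h1).le⟩
  rintro rfl
  exact h2 u.map_zero

lemma summable_of_sum_Ioc_le {u : ArithmeticFunction ℝ} (hu : ∀ n, 0 ≤ u n) {B : ℝ}
    (h : ∀ N, ∑ n ∈ Finset.Ioc 0 N, u n ≤ B) : Summable u :=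
  summable_of_sum_range_le hu fun N => (sum_range_le_sum_Ioc hu N).trans (h N)

lemma tsum_le_of_sum_Ioc_le {u : ArithmeticFunction ℝ} (hu : ∀ n, 0 ≤ u n) {B : ℝ}
    (h : ∀ N, ∑ n ∈ Finset.Ioc 0 N, u n ≤ B) : ∑' n, u n ≤ B :=
  (summable_of_sum_Ioc_le hu h).tsum_le_of_sum_range_le fun N =>
    (sum_range_le_sum_Ioc hu N).trans (h N)

lemma norm_LSeries_term_eq_twist (u : ArithmeticFunction ℂ) (s : ℂ) (n : ℕ) :
    ‖LSeries.term (fun n => u n) s n‖ = twist s.re (normAF u) n := by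
  rcases Nat.eq_zero_or_pos n with rfl | hn
  · simp
  · rw [LSeries.norm_term_eq, if_neg hn.ne', twist_apply, normAF_apply, smul_eq_mul,
      Real.rpow_neg (Nat.cast_nonneg n)]
    ring

lemma lseriesSummable_of_summable_twist {u : ArithmeticFunction ℂ} {s : ℂ}
    (h : Summable (twist s.re (normAF u))) : LSeriesSummable (fun n => u n) s := by
  refine Summable.of_norm ?_
  simpa only [norm_LSeries_term_eq_twist] using h

lemma LSeries_term_mul_cpow_div {x : ℝ} (hx : 0 < x) (u : ArithmeticFunction ℂ) {s : ℂ} (n : ℕ) :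
    LSeries.term (fun n => u n) s n * ((x : ℂ) ^ s / s) =
      u n * (Complex.exp (s * (Real.log (x / n) : ℝ)) / s) := by
  rcases Nat.eq_zero_or_pos n with rfl | hn
  · simp
  have hn0 : (0:ℝ) < n := by exact_mod_cast hn
  have hnc : (n : ℂ) ≠ 0 := by exact_mod_cast hn.ne'
  rw [LSeries.term_of_ne_zero hn.ne', Complex.cpow_def_of_ne_zero hnc,
    Complex.cpow_def_of_ne_zero (by exact_mod_cast hx.ne'), Real.log_div hx.ne' hn0.ne',
    Complex.ofReal_sub, mul_sub, Complex.exp_sub, Complex.ofReal_log hx.le,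
    ← Complex.natCast_log, mul_comm s, mul_comm s]
  ring

lemma far_weight_le {q T : ℝ} (hq : 0 < q) (hT : 1 ≤ T) (h : q ≤ 1 / 2 ∨ 2 ≤ q) :
    1 / (1 + T * |Real.log q|) ≤ 2 / T := by
  have hl : 1 / 2 ≤ |Real.log q| := by
    have h2 : 0.5 ≤ Real.log 2 := by have := Real.log_two_gt_d9; linarith
    rcases h with h | h
    · have := Real.log_le_log hq h
      rw [Real.log_div (by norm_num) (by norm_num), Real.log_one] at this
      exact le_trans (by linarith) (neg_le_abs _)
    · have := Real.log_le_log (by norm_num) h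
      exact le_trans (by linarith) (le_abs_self _)
  rw [div_le_div_iff₀ (by positivity) (by linarith)]
  nlinarith

/-- A truncated Perron formula. -/
lemma norm_perron_sub_le {u : ArithmeticFunction ℂ} {c x T B : ℝ} (hc : 0 < c) (hc2 : c ≤ 2)
    (hx : 1 ≤ x) (hT : 1 ≤ T) (hB : ∀ N, ∑ n ∈ Finset.Ioc 0 N, twist c (normAF u) n ≤ B) :
    ‖(∫ t in (-T)..T, LSeries (fun n => u n) (c + t * I) * ((x : ℂ) ^ (c + t * I) / (c + t * I))) -
        2 * Real.pi * ∑ n ∈ Finset.Ioc 0 ⌊x⌋₊, u n‖ ≤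
      28 * (4 * ∑ n ∈ Finset.Ioc 0 ⌊2 * x⌋₊, ‖u n‖ / (1 + T * |Real.log (x / n)|) +
        2 / T * x ^ c * B) := by
  have hx0 : 0 < x := by linarith
  have hT0 : 0 < T := by linarith
  have htw0 := twist_nonneg c (normAF_nonneg u)
  have hsum := summable_of_sum_Ioc_le htw0 hB
  have hre : ∀ t : ℝ, ((c : ℂ) + t * I).re = c := fun t => by simp
  have hne : ∀ t : ℝ, (c : ℂ) + t * I ≠ 0 := fun t h => by
    have := congrArg Complex.re h
    rw [hre] at this
    exact hc.ne' this
  set K : ℕ → ℂ := fun n => ∫ t in (-T)..T,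
    Complex.exp ((c + t * I) * (Real.log (x / n) : ℝ)) / (c + t * I) with hK
  set ind : ℕ → ℂ := fun n => ((if 0 ≤ Real.log (x / n) then 2 * Real.pi else 0 : ℝ) : ℂ) with hind
  have h1 : HasSum (fun n => u n * K n)
      (∫ t in (-T)..T, LSeries (fun n => u n) (c + t * I) *
        ((x : ℂ) ^ (c + t * I) / (c + t * I))) := by
    have hterm : ∀ n, u n * K n = ∫ t in (-T)..T, LSeries.term (fun n => u n) (c + t * I) n *
        ((x : ℂ) ^ (c + t * I) / (c + t * I)) := by
      intro n
      simp only [LSeries_term_mul_cpow_div hx0]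
      rw [intervalIntegral.integral_const_mul]
    simp only [hterm]
    refine intervalIntegral.hasSum_integral_of_dominated_convergence
      (fun n _ => twist c (normAF u) n * (x ^ c / c)) (fun n => ?_) (fun n => ?_) ?_ ?_ ?_
    · simp only [LSeries_term_mul_cpow_div hx0]
      refine Continuous.aestronglyMeasurable ?_
      refine continuous_const.mul (Continuous.div (by fun_prop) (by fun_prop) hne)
    · refine Filter.Eventually.of_forall fun t _ => ?_
      rw [norm_mul, norm_LSeries_term_eq_twist, hre, norm_div,
        Complex.norm_cpow_eq_rpow_re_of_pos hx0, hre]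
      refine mul_le_mul_of_nonneg_left ?_ (htw0 n)
      refine div_le_div_of_nonneg_left (by positivity) hc ?_
      calc c = |((c : ℂ) + t * I).re| := by rw [hre, abs_of_pos hc]
        _ ≤ _ := Complex.abs_re_le_norm _
    · exact Filter.Eventually.of_forall fun t _ => hsum.mul_right _
    · exact intervalIntegrable_const
    · refine Filter.Eventually.of_forall fun t _ => ?_
      have := lseriesSummable_of_summable_twist (u := u) (s := c + t * I) (by rwa [hre])
      exact this.LSeriesHasSum.mul_right _
  have h2 : HasSum (fun n => u n * ind n) (2 * Real.pi * ∑ n ∈ Finset.Ioc 0 ⌊x⌋₊, u n) := by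
    have : 2 * (Real.pi : ℂ) * ∑ n ∈ Finset.Ioc 0 ⌊x⌋₊, u n =
        ∑ n ∈ Finset.Ioc 0 ⌊x⌋₊, u n * ind n := by
      rw [Finset.mul_sum]
      refine Finset.sum_congr rfl fun n hn => ?_
      obtain ⟨hn0, hnx⟩ := Finset.mem_Ioc.mp hn
      have hn0' : (0:ℝ) < n := by exact_mod_cast hn0
      rw [hind]
      simp only
      rw [if_pos (Real.log_nonneg ((one_le_div hn0').mpr ((Nat.le_floor_iff hx0.le).mp hnx)))]
      push_cast
      ring
    rw [this]
    refine hasSum_sum_of_ne_finset_zero fun n hn => ?_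
    rcases Nat.eq_zero_or_pos n with rfl | hn0
    · simp
    have hn0' : (0:ℝ) < n := by exact_mod_cast hn0
    have hnx : x < n := by
      by_contra h
      exact hn (Finset.mem_Ioc.mpr ⟨hn0, Nat.le_floor (not_lt.mp h)⟩)
    rw [hind]
    simp only
    rw [if_neg (not_le.mpr (Real.log_neg (by positivity) ((div_lt_one hn0').mpr hnx)))]
    simp
  rw [← (h1.sub h2).tsum_eq]
  set near : ℕ → ℝ := fun n => if n ∈ Finset.Ioc 0 ⌊2 * x⌋₊ then
    ‖u n‖ / (1 + T * |Real.log (x / n)|) else 0 with hnear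
  have h3 : HasSum near (∑ n ∈ Finset.Ioc 0 ⌊2 * x⌋₊, ‖u n‖ / (1 + T * |Real.log (x / n)|)) := by
    have : ∑ n ∈ Finset.Ioc 0 ⌊2 * x⌋₊, ‖u n‖ / (1 + T * |Real.log (x / n)|) =
        ∑ n ∈ Finset.Ioc 0 ⌊2 * x⌋₊, near n :=
      Finset.sum_congr rfl fun n hn => by rw [hnear]; simp only; rw [if_pos hn]
    rw [this]
    exact hasSum_sum_of_ne_finset_zero fun n hn => by rw [hnear]; simp only; rw [if_neg hn]
  have h4 : HasSum (fun n => 28 * (4 * near n + 2 / T * x ^ c * twist c (normAF u) n))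
      (28 * (4 * ∑ n ∈ Finset.Ioc 0 ⌊2 * x⌋₊, ‖u n‖ / (1 + T * |Real.log (x / n)|) +
        2 / T * x ^ c * ∑' n, twist c (normAF u) n)) :=
    ((h3.mul_left 4).add (hsum.hasSum.mul_left _)).mul_left 28
  refine (tsum_of_norm_bounded h4 fun n => ?_).trans ?_
  · have hnear0 : 0 ≤ near n := by
      rw [hnear]; simp only
      split_ifs
      · positivity
      · exact le_rfl
    rcases Nat.eq_zero_or_pos n with rfl | hn0
    · simp [hnear]
    have hn0' : (0:ℝ) < n := by exact_mod_cast hn0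
    have hq : 0 < x / n := by positivity
    rw [← mul_sub, norm_mul]
    have hexp : Real.exp (c * Real.log (x / n)) = (x / n) ^ c := by
      rw [Real.rpow_def_of_pos hq, mul_comm]
    have h5 := mul_le_mul_of_nonneg_left
      (norm_perron_kernel_sub_le (Real.log (x / n)) hc hT0) (norm_nonneg (u n))
    rw [hexp] at h5
    refine h5.trans ?_
    have hw : 0 < 1 + T * |Real.log (x / n)| := by positivity
    have hfar : 0 ≤ 2 / T * x ^ c * twist c (normAF u) n := mul_nonneg (by positivity) (htw0 n)
    by_cases h : x / n ≤ 1 / 2 ∨ 2 ≤ x / n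
    · have h6 := far_weight_le hq hT h
      have h7 : ‖u n‖ * (28 * (x / n) ^ c / (1 + T * |Real.log (x / n)|)) ≤
          28 * (2 / T * x ^ c * twist c (normAF u) n) := by
        rw [twist_apply, normAF_apply, smul_eq_mul, Real.div_rpow hx0.le hn0'.le,
          Real.rpow_neg hn0'.le]
        calc _ = 28 * (‖u n‖ * (x ^ c / n ^ c)) * (1 / (1 + T * |Real.log (x / n)|)) := by ring
          _ ≤ 28 * (‖u n‖ * (x ^ c / n ^ c)) * (2 / T) :=
              mul_le_mul_of_nonneg_left h6 (by positivity)
          _ = _ := by ring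
      linarith
    · push Not at h
      have hmem : n ∈ Finset.Ioc 0 ⌊2 * x⌋₊ := by
        refine Finset.mem_Ioc.mpr ⟨hn0, Nat.le_floor ?_⟩
        have := h.1
        rw [div_lt_div_iff₀ (by norm_num) hn0'] at this
        linarith
      have h8 : (x / n) ^ c ≤ 4 := by
        calc (x / n) ^ c ≤ 2 ^ c := Real.rpow_le_rpow hq.le h.2.le hc.le
          _ ≤ 2 ^ (2:ℝ) := Real.rpow_le_rpow_of_exponent_le (by norm_num) hc2
          _ = 4 := by norm_num
      have h9 : ‖u n‖ * (28 * (x / n) ^ c / (1 + T * |Real.log (x / n)|)) ≤ 28 * (4 * near n) := by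
        rw [hnear]
        simp only
        rw [if_pos hmem]
        calc _ = 28 * ((x / n) ^ c * (‖u n‖ / (1 + T * |Real.log (x / n)|))) := by ring
          _ ≤ _ := by gcongr
      linarith
  · have := tsum_le_of_sum_Ioc_le htw0 hB
    gcongr

end Perron

section FarTerms

open ArithmeticFunction

lemma normAF_mul_le (u v : ArithmeticFunction ℂ) (n : ℕ) :
    normAF (u * v) n ≤ (normAF u * normAF v) n := norm_mul_apply_le u v n

lemma sum_twist_mul_le (θ : ℝ) (u v : ArithmeticFunction ℂ) (N : ℕ) :
    ∑ n ∈ Finset.Ioc 0 N, twist θ (normAF (u * v)) n ≤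
      (∑ n ∈ Finset.Ioc 0 N, twist θ (normAF u) n) *
        ∑ n ∈ Finset.Ioc 0 N, twist θ (normAF v) n := by
  refine (Finset.sum_le_sum fun n _ => twist_le_twist θ (normAF_mul_le u v) n).trans ?_
  rw [twist_mul]
  exact sum_mul_apply_le (twist_nonneg θ (normAF_nonneg u)) (twist_nonneg θ (normAF_nonneg v)) N

lemma sum_twist_perronCoeff_le (S l V : ArithmeticFunction ℂ) (α β c : ℝ) (N : ℕ) :
    ∑ n ∈ Finset.Ioc 0 N, twist c (normAF (perronCoeff S l V α β)) n ≤
      (∑ n ∈ Finset.Ioc 0 N, twist c (normAF S) n) *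
      ((∑ n ∈ Finset.Ioc 0 N, twist (c + α) (normAF V) n) *
      ((∑ n ∈ Finset.Ioc 0 N, twist (c + α + 2 * β) (normAF l) n) *
      ∑ n ∈ Finset.Ioc 0 N, twist (c + α + 2 * β) (normAF V) n)) := by
  have h0 : ∀ (θ : ℝ) (u : ArithmeticFunction ℂ), 0 ≤ ∑ n ∈ Finset.Ioc 0 N, twist θ (normAF u) n :=
    fun θ u => Finset.sum_nonneg fun n _ => twist_nonneg θ (normAF_nonneg u) n
  refine (sum_twist_mul_le c S _ N).trans (mul_le_mul_of_nonneg_left ?_ (h0 c S))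
  rw [normAF_twist, twist_twist]
  refine (sum_twist_mul_le _ V _ N).trans (mul_le_mul_of_nonneg_left ?_ (h0 _ V))
  rw [normAF_twist, twist_twist]
  exact sum_twist_mul_le _ l V N

variable {κ x y : ℝ} {F L V : ArithmeticFunction ℂ}

lemma sum_twist_le_of_le_vonMangoldt {θ : ℝ} (hκ : 0 ≤ κ) (hθ : 0 ≤ θ)
    (hV : ∀ n, ‖V n‖ ≤ κ * Λ n) (N : ℕ) :
    ∑ n ∈ Finset.Ioc 0 N, twist θ (normAF V) n ≤
      6 * κ * ∑ n ∈ Finset.Ioc 0 N, (n : ℝ) ^ (-θ) := by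
  calc _ ≤ κ * ∑ n ∈ Finset.Ioc 0 N, Λ n * (n : ℝ) ^ (-θ) := by
        rw [Finset.mul_sum]
        refine Finset.sum_le_sum fun n _ => ?_
        rw [twist_apply, smul_eq_mul, normAF_apply, mul_comm, ← mul_assoc]
        exact mul_le_mul_of_nonneg_right (hV n) (by positivity)
    _ ≤ κ * (6 * ∑ n ∈ Finset.Ioc 0 N, (n : ℝ) ^ (-θ)) := by
        refine mul_le_mul_of_nonneg_left (sum_vonMangoldt_mul_le (fun n hn => ?_)
          (fun n => by positivity) N) hκ
        exact Real.rpow_le_rpow_of_nonpos (by exact_mod_cast hn) (by push_cast; linarith)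
          (by linarith)
    _ = _ := by ring

lemma sum_twist_truncated_le {β : ℝ} (hκ : 0 ≤ κ) (hV : ∀ n, ‖V n‖ ≤ κ * Λ n)
    (hVx : ∀ n : ℕ, x < n → V n = 0) (hl : 1 ≤ Real.log x) (hx : 1 ≤ x) (hβ : 0 ≤ β)
    (hβ1 : β ≤ 1) (N : ℕ) :
    ∑ n ∈ Finset.Ioc 0 N, twist (1 + 1 / Real.log x - β) (normAF V) n ≤
      24 * κ * (x ^ β / (β + 1 / Real.log x)) := by
  have hx0 : 0 < x := by linarith
  have h0 := twist_nonneg (1 - β) (normAF_nonneg V)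
  have hl0 : 0 ≤ 1 / Real.log x := by positivity
  have hf : 1 ≤ ⌊x⌋₊ := Nat.one_le_floor_iff x |>.mpr hx
  calc _ ≤ ∑ n ∈ Finset.Ioc 0 N, twist (1 - β) (normAF V) n :=
        Finset.sum_le_sum fun n _ => twist_anti (by linarith) (normAF_nonneg V) n
    _ ≤ ∑ n ∈ Finset.Ioc 0 ⌊x⌋₊, twist (1 - β) (normAF V) n := by
        rw [← Finset.sum_filter_ne_zero]
        refine Finset.sum_le_sum_of_subset_of_nonneg (fun n hn => ?_) fun n _ _ => h0 n
        obtain ⟨h1, h2⟩ := Finset.mem_filter.mp hn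
        refine Finset.mem_Ioc.mpr ⟨(Finset.mem_Ioc.mp h1).1, Nat.le_floor ?_⟩
        by_contra h
        refine h2 ?_
        rw [twist_apply, normAF_apply, hVx n (not_le.mp h), norm_zero, smul_zero]
    _ ≤ 6 * κ * ∑ n ∈ Finset.Ioc 0 ⌊x⌋₊, (n : ℝ) ^ (-(1 - β)) :=
        sum_twist_le_of_le_vonMangoldt hκ (by linarith) hV _
    _ ≤ 6 * κ * (4 * (⌊x⌋₊ : ℝ) ^ β / (β + 1 / Real.log x)) := by
        refine mul_le_mul_of_nonneg_left ?_ (by positivity)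
        have := sum_rpow_neg_one_add_le hβ hβ1 hl hf
          (Real.log_le_log (by exact_mod_cast hf) (Nat.floor_le hx0.le))
        simpa only [neg_sub, neg_add_eq_sub] using this
    _ ≤ 6 * κ * (4 * x ^ β / (β + 1 / Real.log x)) := by
        have := Nat.floor_le hx0.le
        gcongr
    _ = _ := by ring

lemma sum_twist_one_add_le {θ : ℝ} (hκ : 0 ≤ κ) (hV : ∀ n, ‖V n‖ ≤ κ * Λ n) (hθ : 0 < θ)
    (hθ1 : θ ≤ 1) (N : ℕ) :
    ∑ n ∈ Finset.Ioc 0 N, twist (1 + θ) (normAF V) n ≤ 12 * κ / θ := by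
  calc _ ≤ 6 * κ * ∑ n ∈ Finset.Ioc 0 N, (n : ℝ) ^ (-(1 + θ)) :=
        sum_twist_le_of_le_vonMangoldt hκ (by linarith) hV N
    _ ≤ 6 * κ * (1 + 1 / θ) := by
        refine mul_le_mul_of_nonneg_left ?_ (by positivity)
        rw [neg_add']
        exact sum_rpow_neg_one_sub_le hθ N
    _ ≤ 6 * κ * (1 / θ + 1 / θ) := by
        have : 1 ≤ 1 / θ := (one_le_div hθ).mpr hθ1
        gcongr
    _ = _ := by ring

lemma HalaszPair.sum_twist_perronCoeff_le (h : HalaszPair κ F L) (hκ : 0 ≤ κ) (hy : 10 ≤ y)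
    (hyx : 2 * Real.log y ≤ Real.log x) (hx : 1 ≤ x) (hV : ∀ n, ‖V n‖ ≤ κ * Λ n)
    (hVx : ∀ n : ℕ, x < n → V n = 0) {α β : ℝ} (hα : α ∈ Set.Icc 0 (1 / Real.log y))
    (hβ : β ∈ Set.Icc 0 (1 / Real.log y)) (N : ℕ) :
    ∑ n ∈ Finset.Ioc 0 N, twist (1 + 1 / Real.log x - α - β)
      (normAF (perronCoeff (restrictPrimes (fun p => (p : ℝ) ≤ y) F)
        (restrictPrimes (fun p => y < (p : ℝ)) F) V α β)) n ≤
      288 * κ ^ 2 * halaszConst κ * Real.log x ^ κ * (x ^ β / (β + 1 / Real.log x) ^ 2) := by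
  have hly := log_ge_of_ten_le hy
  have hη := inv_log_le hy
  have hx0 : 0 < x := by linarith
  have hlx : 0 < Real.log x := by linarith
  have hi : 0 < 1 / Real.log x := by positivity
  have hi1 : 1 / Real.log x ≤ 0.435 := le_trans
    (one_div_le_one_div_of_le (by linarith) (by linarith)) hη
  obtain ⟨hα0, hα1⟩ := hα
  obtain ⟨hβ0, hβ1⟩ := hβ
  have hlogyx : y ≤ x := by
    rw [← Real.log_le_log_iff (by linarith) hx0]; linarith
  set S := restrictPrimes (fun p => (p : ℝ) ≤ y) F
  set l := restrictPrimes (fun p => y < (p : ℝ)) F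
  have h0 : ∀ (θ : ℝ) (u : ArithmeticFunction ℂ), 0 ≤ ∑ n ∈ Finset.Ioc 0 N, twist θ (normAF u) n :=
    fun θ u => Finset.sum_nonneg fun n _ => twist_nonneg θ (normAF_nonneg u) n
  refine (_root_.sum_twist_perronCoeff_le S l V α β _ N).trans ?_
  rw [show 1 + 1 / Real.log x - α - β + α + 2 * β = 1 + (β + 1 / Real.log x) by ring,
    show 1 + 1 / Real.log x - α - β + α = 1 + 1 / Real.log x - β by ring]
  have e1 : (∑ n ∈ Finset.Ioc 0 N, twist (1 + 1 / Real.log x - α - β) (normAF S) n) *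
      (∑ n ∈ Finset.Ioc 0 N, twist (1 + (β + 1 / Real.log x)) (normAF l) n) ≤
      halaszConst κ * Real.log x ^ κ := by
    refine le_trans (mul_le_mul (Finset.sum_le_sum fun n _ => twist_anti ?_ (normAF_nonneg S) n)
      (Finset.sum_le_sum fun n _ => twist_anti ?_ (normAF_nonneg l) n) (h0 _ l) (h0 _ S))
      (h.sum_smooth_mul_sum_rough_le hκ hy hlogyx N)
    · linarith
    · linarith
  have e2 := sum_twist_truncated_le hκ hV hVx (by linarith) hx hβ0 (by linarith) N
  have e3 := sum_twist_one_add_le hκ hV (θ := β + 1 / Real.log x) (by linarith) (by linarith) N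
  have hA := halaszConst_pos κ
  set a := ∑ n ∈ Finset.Ioc 0 N, twist (1 + 1 / Real.log x - α - β) (normAF S) n
  set b := ∑ n ∈ Finset.Ioc 0 N, twist (1 + 1 / Real.log x - β) (normAF V) n
  set d := ∑ n ∈ Finset.Ioc 0 N, twist (1 + (β + 1 / Real.log x)) (normAF l) n
  set e := ∑ n ∈ Finset.Ioc 0 N, twist (1 + (β + 1 / Real.log x)) (normAF V) n
  calc a * (b * (d * e)) = (a * d) * (b * e) := by ring
    _ ≤ (halaszConst κ * Real.log x ^ κ) *
          (24 * κ * (x ^ β / (β + 1 / Real.log x)) * (12 * κ / (β + 1 / Real.log x))) := by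
        refine mul_le_mul e1 (mul_le_mul e2 e3 (h0 _ V) ?_) (mul_nonneg (h0 _ V) (h0 _ V))
          (by positivity)
        positivity
    _ = _ := by
        generalize β + 1 / Real.log x = θ
        ring

lemma integral_rpow_neg_le (hx : 1 < x) (η : ℝ) :
    ∫ α in (0:ℝ)..η, x ^ (-α) ≤ 1 / Real.log x := by
  have hx0 : 0 < x := by linarith
  have hl := Real.log_pos hx
  have hd : ∀ α ∈ Set.uIcc 0 η,
      HasDerivAt (fun α : ℝ => -(x ^ (-α)) / Real.log x) (x ^ (-α)) α := by
    intro α _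
    refine (((hasDerivAt_id α).neg.const_rpow hx0).neg.div_const (Real.log x)).congr_deriv ?_
    field_simp
    rfl
  rw [intervalIntegral.integral_eq_sub_of_hasDerivAt hd]
  · have : 0 ≤ x ^ (-η) / Real.log x := by positivity
    simp only [neg_zero, Real.rpow_zero]
    rw [neg_div, neg_div]
    linarith
  · exact (Real.continuous_const_rpow hx0.ne' |>.comp continuous_neg).intervalIntegrable _ _

lemma integral_inv_add_sq_le {ε η : ℝ} (hε : 0 < ε) (hη : 0 ≤ η) :
    ∫ β in (0:ℝ)..η, 1 / (β + ε) ^ 2 ≤ 1 / ε := by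
  have hpos : ∀ β ∈ Set.uIcc 0 η, 0 < β + ε := by
    intro β hβ
    rw [Set.uIcc_of_le hη] at hβ
    linarith [hβ.1]
  have hd : ∀ β ∈ Set.uIcc 0 η, HasDerivAt (fun β : ℝ => -(β + ε)⁻¹) (1 / (β + ε) ^ 2) β := by
    intro β hβ
    refine (((hasDerivAt_id β).add_const ε).inv (hpos β hβ).ne').neg.congr_deriv ?_
    simp
    rw [neg_div, neg_neg, one_div]
  rw [intervalIntegral.integral_eq_sub_of_hasDerivAt hd]
  · have : 0 < (η + ε)⁻¹ := by positivity
    rw [zero_add, one_div]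
    linarith
  · refine ContinuousOn.intervalIntegrable fun β hβ => ?_
    refine ContinuousAt.continuousWithinAt ?_
    have := (pow_pos (hpos β hβ) 2).ne'
    fun_prop (disch := assumption)

end FarTerms

section DoubleIntegrals

variable {𝕜 : Type*} [RCLike 𝕜]

lemma continuous_integral_of_continuous_uncurry {E : Type*} [NormedAddCommGroup E] [NormedSpace ℝ E]
    {G : ℝ → ℝ → E} (hG : Continuous (Function.uncurry G)) (a b : ℝ) :
    Continuous fun α => ∫ β in a..b, G α β :=
  intervalIntegral.continuous_parametric_intervalIntegral_of_continuous' hG a b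

lemma integral_integral_finsetSum {s : Finset ℕ} {P : ℕ → ℝ → ℝ → 𝕜}
    (hP : ∀ n, Continuous (Function.uncurry (P n))) (c : ℕ → 𝕜) (η : ℝ) :
    ∫ α in (0:ℝ)..η, ∫ β in (0:ℝ)..η, ∑ n ∈ s, c n * P n α β =
      ∑ n ∈ s, c n * ∫ α in (0:ℝ)..η, ∫ β in (0:ℝ)..η, P n α β := by
  have h1 : ∀ α, ∫ β in (0:ℝ)..η, ∑ n ∈ s, c n * P n α β =
      ∑ n ∈ s, c n * ∫ β in (0:ℝ)..η, P n α β := by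
    intro α
    rw [intervalIntegral.integral_finsetSum]
    · exact Finset.sum_congr rfl fun n _ => intervalIntegral.integral_const_mul _ _
    · intro n _
      exact (((hP n).uncurry_left α).const_mul (c n)).intervalIntegrable _ _
  simp only [h1]
  rw [intervalIntegral.integral_finsetSum]
  · exact Finset.sum_congr rfl fun n _ => intervalIntegral.integral_const_mul _ _
  · intro n _
    exact ((continuous_integral_of_continuous_uncurry (hP n) 0 η).const_mul
      (c n)).intervalIntegrable _ _

lemma norm_integral_integral_sub_le {η : ℝ} (hη : 0 ≤ η) {G M : ℝ → ℝ → ℂ} {b : ℝ → ℝ → ℝ}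
    (hG : Continuous (Function.uncurry G)) (hM : Continuous (Function.uncurry M))
    (hb : Continuous (Function.uncurry b))
    (h : ∀ α ∈ Set.Icc 0 η, ∀ β ∈ Set.Icc 0 η, ‖G α β - M α β‖ ≤ b α β) :
    ‖(∫ α in (0:ℝ)..η, ∫ β in (0:ℝ)..η, G α β) - ∫ α in (0:ℝ)..η, ∫ β in (0:ℝ)..η, M α β‖ ≤
      ∫ α in (0:ℝ)..η, ∫ β in (0:ℝ)..η, b α β := by
  rw [← intervalIntegral.integral_sub
    ((continuous_integral_of_continuous_uncurry hG 0 η).intervalIntegrable _ _)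
    ((continuous_integral_of_continuous_uncurry hM 0 η).intervalIntegrable _ _)]
  refine intervalIntegral.norm_integral_le_of_norm_le hη (Filter.Eventually.of_forall
    fun α hα => ?_) ((continuous_integral_of_continuous_uncurry hb 0 η).intervalIntegrable _ _)
  rw [← intervalIntegral.integral_sub ((hG.uncurry_left α).intervalIntegrable _ _)
    ((hM.uncurry_left α).intervalIntegrable _ _)]
  exact intervalIntegral.norm_integral_le_of_norm_le hη (Filter.Eventually.of_forall
    fun β hβ => h α (Set.Ioc_subset_Icc_self hα) β (Set.Ioc_subset_Icc_self hβ))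
    ((hb.uncurry_left α).intervalIntegrable _ _)

lemma integral_integral_congr {E : Type*} [NormedAddCommGroup E] [NormedSpace ℝ E] {η : ℝ}
    (hη : 0 ≤ η) {G M : ℝ → ℝ → E}
    (h : ∀ α ∈ Set.Icc 0 η, ∀ β ∈ Set.Icc 0 η, G α β = M α β) :
    ∫ α in (0:ℝ)..η, ∫ β in (0:ℝ)..η, G α β = ∫ α in (0:ℝ)..η, ∫ β in (0:ℝ)..η, M α β := by
  refine intervalIntegral.integral_congr fun α hα => ?_
  rw [Set.uIcc_of_le hη] at hα
  refine intervalIntegral.integral_congr fun β hβ => ?_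
  rw [Set.uIcc_of_le hη] at hβ
  exact h α hα β hβ

end DoubleIntegrals

section DirichletSeries

open ArithmeticFunction

lemma continuousOn_LSeries_of_summable_twist {u : ArithmeticFunction ℂ} {σ : ℝ}
    (h : Summable (twist σ (normAF u))) :
    ContinuousOn (LSeries fun n => u n) {s | σ ≤ s.re} := by
  refine continuousOn_tsum (fun n => ?_) h fun n s hs => ?_
  · rcases Nat.eq_zero_or_pos n with rfl | hn
    · simp only [LSeries.term_zero]; exact continuousOn_const
    · have hn0 : (n : ℂ) ≠ 0 := by exact_mod_cast hn.ne'
      simp only [LSeries.term_of_ne_zero hn.ne']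
      refine Continuous.continuousOn (continuous_const.div ?_ fun s => ?_)
      · exact continuous_const.cpow continuous_id fun s => Or.inl (by simpa using hn)
      exact Complex.cpow_ne_zero_iff.mpr (Or.inl hn0)
  · rw [norm_LSeries_term_eq_twist]
    exact twist_anti hs (normAF_nonneg u) n

lemma LSeries_term_twist (θ : ℝ) (u : ArithmeticFunction ℂ) (s : ℂ) :
    LSeries.term (fun n => twist θ u n) s = LSeries.term (fun n => u n) (s + θ) := by
  ext n
  rcases Nat.eq_zero_or_pos n with rfl | hn
  · simp
  have hn0 : (n : ℂ) ≠ 0 := by exact_mod_cast hn.ne'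
  rw [LSeries.term_of_ne_zero hn.ne', LSeries.term_of_ne_zero hn.ne', twist_apply,
    Complex.real_smul, Complex.ofReal_cpow (Nat.cast_nonneg n), Complex.ofReal_neg,
    Complex.cpow_add _ _ hn0, Complex.ofReal_natCast, Complex.cpow_neg]
  ring

lemma lseriesSummable_twist_iff (θ : ℝ) (u : ArithmeticFunction ℂ) (s : ℂ) :
    LSeriesSummable (fun n => twist θ u n) s ↔ LSeriesSummable (fun n => u n) (s + θ) := by
  unfold LSeriesSummable
  rw [LSeries_term_twist]

lemma LSeries_twist (θ : ℝ) (u : ArithmeticFunction ℂ) (s : ℂ) :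
    LSeries (fun n => twist θ u n) s = LSeries (fun n => u n) (s + θ) := by
  unfold LSeries
  rw [LSeries_term_twist]

lemma LSeries_perronCoeff {S l V : ArithmeticFunction ℂ} {α β : ℝ} {s : ℂ}
    (hS : LSeriesSummable (fun n => S n) s) (hV : LSeriesSummable (fun n => V n) (s + α))
    (hl : LSeriesSummable (fun n => l n) (s + α + (2 * β : ℝ)))
    (hV' : LSeriesSummable (fun n => V n) (s + α + (2 * β : ℝ))) :
    LSeries (fun n => perronCoeff S l V α β n) s =
      LSeries (fun n => S n) s * (LSeries (fun n => V n) (s + α) *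
        (LSeries (fun n => l n) (s + α + (2 * β : ℝ)) *
          LSeries (fun n => V n) (s + α + (2 * β : ℝ)))) := by
  have h1 := (lseriesSummable_twist_iff (2 * β) (l * V) (s + α)).mpr (LSeriesSummable_mul hl hV')
  have h2 := (lseriesSummable_twist_iff α (V * twist (2 * β) (l * V)) s).mpr
    (LSeriesSummable_mul hV h1)
  rw [perronCoeff, LSeries_mul' hS h2, LSeries_twist, LSeries_mul' hV h1, LSeries_twist,
    LSeries_mul' hl hV']

lemma summable_twist_truncateTo (θ : ℝ) (I : Finset ℕ) (u : ArithmeticFunction ℂ) :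
    Summable (twist θ (normAF (truncateTo I u))) := by
  refine summable_of_ne_finset_zero (s := I) fun n hn => ?_
  rw [twist_apply, normAF_apply, truncateTo_apply, if_neg hn, norm_zero, smul_zero]

lemma LSeries_truncateTo {I : Finset ℕ} (hI : 0 ∉ I) (u : ArithmeticFunction ℂ) (s : ℂ) :
    LSeries (fun n => truncateTo I u n) s = ∑ n ∈ I, u n / (n : ℂ) ^ s := by
  rw [LSeries, tsum_eq_sum (s := I)]
  · refine Finset.sum_congr rfl fun n hn => ?_
    rw [LSeries.term_of_ne_zero (fun h => hI (h ▸ hn)), truncateTo_apply, if_pos hn]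
  · intro n hn
    rw [LSeries.term_def, truncateTo_apply, if_neg hn, zero_div, ite_self]

end DirichletSeries

section KeyIntegral

open ArithmeticFunction

/-- The integrand of the key integral representation, with general Dirichlet series. -/
def keyIntegrand (S l V : ArithmeticFunction ℂ) (x : ℝ) (s : ℂ) (α β : ℝ) : ℂ :=
  LSeries (fun n => S n) (s - α - β) * LSeries (fun n => l n) (s + β) *
    LSeries (fun n => V n) (s - β) * LSeries (fun n => V n) (s + β) *
    (x : ℂ) ^ (s - α - β) / (s - α - β)

lemma keyIntegrand_eq {S l V : ArithmeticFunction ℂ} {x α β c : ℝ} (t : ℝ)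
    (hS : Summable (twist (c - α - β) (normAF S))) (hl : Summable (twist (c + β) (normAF l)))
    (hV : ∀ θ, Summable (twist θ (normAF V))) :
    keyIntegrand S l V x (c + t * I) α β =
      LSeries (fun n => perronCoeff S l V α β n) ((c - α - β : ℝ) + t * I) *
        ((x : ℂ) ^ (((c - α - β : ℝ) : ℂ) + t * I) / (((c - α - β : ℝ) : ℂ) + t * I)) := by
  have e0 : ((c - α - β : ℝ) : ℂ) + t * I = c + t * I - α - β := by push_cast; ring
  have e1 : (c : ℂ) + t * I - α - β + α = c + t * I - β := by ring
  have e2 : (c : ℂ) + t * I - α - β + α + (2 * β : ℝ) = c + t * I + β := by push_cast; ring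
  have hS' : LSeriesSummable (fun n => S n) (c + t * I - α - β) :=
    lseriesSummable_of_summable_twist (by simpa using hS)
  have hl' : LSeriesSummable (fun n => l n) (c + t * I - α - β + α + (2 * β : ℝ)) := by
    rw [e2]
    exact lseriesSummable_of_summable_twist (by simpa using hl)
  rw [e0, LSeries_perronCoeff hS' (lseriesSummable_of_summable_twist (hV _)) hl'
    (lseriesSummable_of_summable_twist (hV _)), e2, e1, keyIntegrand]
  ring

lemma continuous_keyIntegrand {S l V : ArithmeticFunction ℂ} {x c η : ℝ} (hx : 0 < x)
    (hη : 0 ≤ η) (hc : 0 < c - 2 * η) (hS : Summable (twist (c - 2 * η) (normAF S)))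
    (hl : Summable (twist c (normAF l))) (hV : ∀ θ, Summable (twist θ (normAF V))) :
    Continuous fun q : (ℝ × ℝ) × ℝ => keyIntegrand S l V x (c + q.2 * I)
      (Set.projIcc 0 η hη q.1.1) (Set.projIcc 0 η hη q.1.2) := by
  have hα : Continuous fun q : (ℝ × ℝ) × ℝ => (((Set.projIcc 0 η hη q.1.1 : ℝ)) : ℂ) :=
    Complex.continuous_ofReal.comp (continuous_subtype_val.comp (continuous_projIcc.comp
      (continuous_fst.comp continuous_fst)))
  have hβ : Continuous fun q : (ℝ × ℝ) × ℝ => (((Set.projIcc 0 η hη q.1.2 : ℝ)) : ℂ) :=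
    Complex.continuous_ofReal.comp (continuous_subtype_val.comp (continuous_projIcc.comp
      (continuous_snd.comp continuous_fst)))
  have hs : Continuous fun q : (ℝ × ℝ) × ℝ => (c : ℂ) + q.2 * I := by fun_prop
  have hm := fun a => (Set.projIcc 0 η hη a).2
  have hre : ∀ q : (ℝ × ℝ) × ℝ, c - 2 * η ≤ ((c : ℂ) + q.2 * I -
      ((Set.projIcc 0 η hη q.1.1 : ℝ) : ℂ) - ((Set.projIcc 0 η hη q.1.2 : ℝ) : ℂ)).re := by
    intro q
    have h1 := (hm q.1.1).2
    have h2 := (hm q.1.2).2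
    simp only [Complex.sub_re, Complex.add_re, Complex.ofReal_re, Complex.mul_re, Complex.I_re,
      Complex.ofReal_im, Complex.I_im]
    linarith
  have hVc : Continuous (LSeries fun n => V n) := by
    refine continuous_iff_continuousAt.mpr fun s => ?_
    refine (continuousOn_LSeries_of_summable_twist (hV (s.re - 1))).continuousAt ?_
    exact (continuous_re.isOpen_preimage _ isOpen_Ioi).mem_nhds (show s.re - 1 < s.re by linarith)
      |> Filter.mem_of_superset <| fun z (hz : s.re - 1 < z.re) => hz.le
  unfold keyIntegrand
  refine Continuous.div₀ ((((Continuous.mul ?_ ?_).mul ?_).mul ?_).mul ?_) ((hs.sub hα).sub hβ) ?_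
  · exact (continuousOn_LSeries_of_summable_twist hS).comp_continuous ((hs.sub hα).sub hβ) hre
  · refine (continuousOn_LSeries_of_summable_twist hl).comp_continuous (hs.add hβ) fun q => ?_
    have h2 := (hm q.1.2).1
    simpa using h2
  · exact hVc.comp (hs.sub hβ)
  · exact hVc.comp (hs.add hβ)
  · exact continuous_const.cpow ((hs.sub hα).sub hβ) fun q => Or.inl (by simpa using hx)
  · intro q h0
    have := hre q
    rw [h0, Complex.zero_re] at this
    linarith

variable {κ x y T : ℝ} {F L : ArithmeticFunction ℂ}

lemma HalaszPair.summable_smooth (h : HalaszPair κ F L) (hκ : 0 ≤ κ) (hy : 10 ≤ y) {θ : ℝ}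
    (hθ : 1 - 2 * (1 / Real.log y) ≤ θ) :
    Summable (twist θ (normAF (restrictPrimes (fun p => (p : ℝ) ≤ y) F))) :=
  (summable_of_sum_Ioc_le (twist_nonneg _ (normAF_nonneg _))
    (h.sum_smooth_le hκ hy)).of_nonneg_of_le (twist_nonneg _ (normAF_nonneg _)) (twist_anti hθ (normAF_nonneg _))

lemma HalaszPair.summable_rough (h : HalaszPair κ F L) (hκ : 0 ≤ κ) (hy : 10 ≤ y) (hyx : y ≤ x)
    {θ : ℝ} (hθ : 1 + 1 / Real.log x ≤ θ) :
    Summable (twist θ (normAF (restrictPrimes (fun p => y < (p : ℝ)) F))) := by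
  have hl0 := twist_nonneg (1 + 1 / Real.log x)
    (normAF_nonneg (restrictPrimes (fun p => y < (p : ℝ)) F))
  refine (summable_of_sum_Ioc_le hl0 (B := halaszConst κ * Real.log x ^ κ)
      fun N => ?_).of_nonneg_of_le
    (twist_nonneg _ (normAF_nonneg _)) (twist_anti hθ (normAF_nonneg _))
  refine le_trans ?_ (h.sum_smooth_mul_sum_rough_le hκ hy hyx N)
  rcases Nat.eq_zero_or_pos N with rfl | hN
  · simp
  refine le_mul_of_one_le_left (Finset.sum_nonneg fun n _ => hl0 n) ?_
  have := Finset.single_le_sum (f := fun n => twist (1 - 2 * (1 / Real.log y))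
    (normAF (restrictPrimes (fun p => (p : ℝ) ≤ y) F)) n)
    (fun n _ => twist_nonneg _ (normAF_nonneg _) n) (Finset.mem_Ioc.mpr ⟨Nat.one_pos, hN⟩)
  refine le_trans (le_of_eq ?_) this
  simp [twist_apply_one, restrictPrimes_apply, h.mult.1]

end KeyIntegral

section KeyIntegralBound

open ArithmeticFunction

variable {κ x y T : ℝ} {F L : ArithmeticFunction ℂ}

lemma HalaszPair.norm_integral_keyIntegrand_sub_le (h : HalaszPair κ F L) (hκ : 0 ≤ κ)
    (hy : 10 ≤ y) (hyx : 2 * Real.log y ≤ Real.log x) (hx : y ≤ x) (hT : 1 ≤ T) {k : ℕ}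
    (hk : κ ≤ k) {α β : ℝ} (hα : α ∈ Set.Icc 0 (1 / Real.log y))
    (hβ : β ∈ Set.Icc 0 (1 / Real.log y)) :
    ‖1 / (Real.pi : ℂ) * (∫ t in (-T)..T, keyIntegrand (restrictPrimes (fun p => (p : ℝ) ≤ y) F)
        (restrictPrimes (fun p => y < (p : ℝ)) F) (truncateTo (Finset.Ioo ⌊y⌋₊ ⌈x / y⌉₊)
          (restrictPrimes (fun p => y < (p : ℝ)) L)) x ((1 + 1 / Real.log x : ℝ) + t * I) α β) -
      ∑ n ∈ Finset.Ioc 0 ⌊x⌋₊, 2 * perronCoeff (restrictPrimes (fun p => (p : ℝ) ≤ y) F)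
        (restrictPrimes (fun p => y < (p : ℝ)) F) (restrictPrimes (fun p => y < (p : ℝ)) L) α β n‖ ≤
      28 * (4 * ∑ n ∈ Finset.Ioc 0 ⌊2 * x⌋₊, 1 / (1 + T * |Real.log (x / n)|) *
          perronCoeff (restrictPrimes (fun p => (p : ℝ) ≤ y) (divisorAF k))
            (restrictPrimes (fun p => y < (p : ℝ)) (divisorAF k))
            (restrictPrimes (fun p => y < (p : ℝ)) (k • Λ)) α β n +
        2 / T * (Real.exp 1 * x * (288 * κ ^ 2 * halaszConst κ * Real.log x ^ κ)) *
          (x ^ (-α) * (1 / (β + 1 / Real.log x) ^ 2))) := by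
  have hly := log_ge_of_ten_le hy
  have hη := inv_log_le hy
  have hx0 : 0 < x := by linarith
  have hlx : 0 < Real.log x := by linarith
  have hi : 0 < 1 / Real.log x := by positivity
  have hi1 : 1 / Real.log x ≤ 0.435 := le_trans
    (one_div_le_one_div_of_le (by linarith) (by linarith)) hη
  obtain ⟨hα0, hα1⟩ := hα
  obtain ⟨hβ0, hβ1⟩ := hβ
  set S := restrictPrimes (fun p => (p : ℝ) ≤ y) F with hSdef
  set l := restrictPrimes (fun p => y < (p : ℝ)) F with hldef
  set V := restrictPrimes (fun p => y < (p : ℝ)) L with hVdef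
  set W := truncateTo (Finset.Ioo ⌊y⌋₊ ⌈x / y⌉₊) V with hWdef
  have hWV : ∀ n, ‖W n‖ ≤ ‖V n‖ := fun n => by
    rw [hWdef, truncateTo_apply]
    split_ifs
    · exact le_rfl
    · simp
  have hVn : ∀ n, ‖V n‖ ≤ κ * Λ n := fun n => (h.norm_restrictPrimes_le _ n).trans
    (mul_le_mul_of_nonneg_left (restrictPrimes_le _ (fun _ => vonMangoldt_nonneg) n) hκ)
  have hVk : ∀ n, ‖V n‖ ≤ restrictPrimes (fun p => y < (p : ℝ)) (k • Λ) n := fun n => by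
    refine (h.norm_restrictPrimes_le _ n).trans ?_
    rw [restrictPrimes_apply, restrictPrimes_apply]
    split_ifs
    · rw [nsmul_arithmeticFunction_apply]
      exact mul_le_mul_of_nonneg_right hk vonMangoldt_nonneg
    · simp
  have hWx : ∀ n : ℕ, x < n → W n = 0 := fun n hn => by
    rw [hWdef, truncateTo_apply, if_neg]
    intro hmem
    have h1 := Nat.lt_ceil.mp (Finset.mem_Ioo.mp hmem).2
    have h2 : x / y ≤ x := div_le_self hx0.le (by linarith)
    linarith
  have hrp : ∀ P : ℕ → Prop, ∀ n, ‖restrictPrimes P F n‖ ≤ restrictPrimes P (divisorAF k) n :=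
    fun P n => by
      rw [restrictPrimes_apply, restrictPrimes_apply]
      split_ifs
      · exact h.norm_le_divisorAF hk n
      · simp
  have hB := h.sum_twist_perronCoeff_le (x := x) hκ hy hyx (by linarith)
    (fun n => (hWV n).trans (hVn n)) hWx ⟨hα0, hα1⟩ ⟨hβ0, hβ1⟩
  have hperron := norm_perron_sub_le (c := 1 + 1 / Real.log x - α - β) (x := x) (by linarith)
    (by linarith) (by linarith) hT hB
  have hint : ∫ t in (-T)..T, keyIntegrand S l W x ((1 + 1 / Real.log x : ℝ) + t * I) α β =
      ∫ t in (-T)..T, LSeries (fun n => perronCoeff S l W α β n)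
        ((1 + 1 / Real.log x - α - β : ℝ) + t * I) *
            ((x : ℂ) ^ (((1 + 1 / Real.log x - α - β : ℝ) : ℂ)
          + t * I) / (((1 + 1 / Real.log x - α - β : ℝ) : ℂ) + t * I)) :=
    intervalIntegral.integral_congr fun t _ => keyIntegrand_eq t
      (h.summable_smooth hκ hy (by linarith)) (h.summable_rough hκ hy hx (by linarith))
      fun θ => summable_twist_truncateTo θ _ _
  have hcoeff : ∀ n ∈ Finset.Ioc 0 ⌊x⌋₊, perronCoeff S l W α β n = perronCoeff S l V α β n :=
    fun n hn => perronCoeff_truncateTo (by linarith)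
      (fun m hm => h.restrictPrimes_apply_eq_zero hm) α β
      ((Nat.le_floor_iff hx0.le).mp (Finset.mem_Ioc.mp hn).2)
  have hpi : (Real.pi : ℂ) ≠ 0 := by exact_mod_cast Real.pi_ne_zero
  rw [hint, ← Finset.mul_sum, ← Finset.sum_congr rfl hcoeff]
  set J := ∫ t in (-T)..T, LSeries (fun n => perronCoeff S l W α β n)
        ((1 + 1 / Real.log x - α - β : ℝ) + t * I) *
            ((x : ℂ) ^ (((1 + 1 / Real.log x - α - β : ℝ) : ℂ)
          + t * I) / (((1 + 1 / Real.log x - α - β : ℝ) : ℂ) + t * I)) with hJ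
  set Q := ∑ n ∈ Finset.Ioc 0 ⌊x⌋₊, perronCoeff S l W α β n with hQ
  have e1 : 1 / (Real.pi : ℂ) * J - 2 * Q = 1 / (Real.pi : ℂ) * (J - 2 * Real.pi * Q) := by
    field_simp
  rw [e1, norm_mul]
  have e2 : ‖1 / (Real.pi : ℂ)‖ ≤ 1 := by
    rw [norm_div, norm_one, Complex.norm_real, Real.norm_of_nonneg Real.pi_pos.le,
      div_le_one Real.pi_pos]
    linarith [Real.pi_gt_three]
  refine (mul_le_of_le_one_left (norm_nonneg _) e2).trans (hperron.trans ?_)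
  have hxc : x ^ (1 + 1 / Real.log x - α - β) * x ^ β = Real.exp 1 * x * x ^ (-α) := by
    have : x ^ (1 / Real.log x) = Real.exp 1 := by
      rw [Real.rpow_def_of_pos hx0, mul_one_div_cancel hlx.ne']
    rw [← Real.rpow_add hx0, ← this, ← Real.rpow_add_one hx0.ne', ← Real.rpow_add hx0]
    ring_nf
  have hfar : 2 / T * x ^ (1 + 1 / Real.log x - α - β) *
      (288 * κ ^ 2 * halaszConst κ * Real.log x ^ κ * (x ^ β / (β + 1 / Real.log x) ^ 2)) =
      2 / T * (Real.exp 1 * x * (288 * κ ^ 2 * halaszConst κ * Real.log x ^ κ)) *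
          (x ^ (-α) * (1 / (β + 1 / Real.log x) ^ 2)) := by
    linear_combination 2 / T * (288 * κ ^ 2 * halaszConst κ * Real.log x ^ κ) *
      (1 / (β + 1 / Real.log x) ^ 2) * hxc
  rw [hfar]
  gcongr with n hn
  rw [div_eq_mul_one_div, mul_comm]
  gcongr
  exact norm_perronCoeff_le (hrp _) (hrp _) (fun n => (hWV n).trans (hVk n)) α β n

end KeyIntegralBound

section KeyIntegralTotal

open ArithmeticFunction

variable {κ x y T : ℝ} {F L : ArithmeticFunction ℂ}

lemma integral_integral_add_of_continuous {η : ℝ} {f g : ℝ → ℝ → ℝ}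
    (hf : Continuous (Function.uncurry f))
    (hg : Continuous (Function.uncurry g)) :
    ∫ α in (0:ℝ)..η, ∫ β in (0:ℝ)..η, f α β + g α β =
      (∫ α in (0:ℝ)..η, ∫ β in (0:ℝ)..η, f α β) + ∫ α in (0:ℝ)..η, ∫ β in (0:ℝ)..η, g α β := by
  rw [← intervalIntegral.integral_add
    ((continuous_integral_of_continuous_uncurry hf 0 η).intervalIntegrable _ _)
    ((continuous_integral_of_continuous_uncurry hg 0 η).intervalIntegrable _ _)]
  exact intervalIntegral.integral_congr fun α _ => intervalIntegral.integral_add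
    ((hf.uncurry_left α).intervalIntegrable _ _) ((hg.uncurry_left α).intervalIntegrable _ _)

lemma integral_integral_rpow_mul_le {x η : ℝ} (hx : 1 < x) (hη : 0 ≤ η) :
    ∫ α in (0:ℝ)..η, ∫ β in (0:ℝ)..η, x ^ (-α) * (1 / (|β| + 1 / Real.log x) ^ 2) ≤ 1 := by
  have hl := Real.log_pos hx
  have h1 := integral_rpow_neg_le hx η
  have h2 := integral_inv_add_sq_le (one_div_pos.mpr hl) hη
  have h3 : ∫ β in (0:ℝ)..η, 1 / (|β| + 1 / Real.log x) ^ 2 =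
      ∫ β in (0:ℝ)..η, 1 / (β + 1 / Real.log x) ^ 2 := by
    refine intervalIntegral.integral_congr fun β hβ => ?_
    rw [Set.uIcc_of_le hη] at hβ
    simp only [abs_of_nonneg hβ.1]
  have h4 : 0 ≤ ∫ β in (0:ℝ)..η, 1 / (β + 1 / Real.log x) ^ 2 :=
    intervalIntegral.integral_nonneg hη fun β _ => by positivity
  simp only [intervalIntegral.integral_const_mul, intervalIntegral.integral_mul_const, h3]
  calc _ ≤ 1 / Real.log x * (1 / (1 / Real.log x)) := by
        exact mul_le_mul h1 h2 h4 (by positivity)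
    _ = 1 := by field_simp

/-- The constant in the key integral representation. -/
def keyConst (κ : ℝ) (k : ℕ) : ℝ :=
  28 * (4 * shortConst κ k + 2 * (Real.exp 1 * (288 * κ ^ 2 * halaszConst κ))) +
    (26 * κ + 1) * halaszConst κ ^ 2

lemma HalaszPair.norm_integral_integral_keyIntegrand_sub_le (h : HalaszPair κ F L) {k : ℕ}
    (hk : k < κ) (hk1 : κ ≤ k + 1) (hy : 10 ≤ y) (hyx : 2 * Real.log y ≤ Real.log x) (hx : y ≤ x)
    (hT : 1 ≤ T) :
    ‖(∫ α in (0:ℝ)..(1 / Real.log y), ∫ β in (0:ℝ)..(1 / Real.log y),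
        1 / (Real.pi : ℂ) * ∫ t in (-T)..T, keyIntegrand (restrictPrimes (fun p => (p : ℝ) ≤ y) F)
          (restrictPrimes (fun p => y < (p : ℝ)) F) (truncateTo (Finset.Ioo ⌊y⌋₊ ⌈x / y⌉₊)
            (restrictPrimes (fun p => y < (p : ℝ)) L)) x ((1 + 1 / Real.log x : ℝ) + t * I) α β) -
      ∑ n ∈ Finset.Ioc 0 ⌊x⌋₊, F n‖ ≤
      keyConst κ k * (x * Real.log y ^ κ / Real.log x + x * Real.log x ^ κ / T) := by
  have hκ : 0 ≤ κ := (Nat.cast_nonneg k).trans hk.le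
  have hly := log_ge_of_ten_le hy
  have hη := inv_log_le hy
  have hη0 : 0 ≤ 1 / Real.log y := one_div_nonneg.mpr (by linarith)
  have hx0 : 0 < x := by linarith
  have hlx : 0 < Real.log x := by linarith
  have hi : 0 < 1 / Real.log x := by positivity
  set η := 1 / Real.log y with hηdef
  set S := restrictPrimes (fun p => (p : ℝ) ≤ y) F with hSdef
  set l := restrictPrimes (fun p => y < (p : ℝ)) F with hldef
  set V := restrictPrimes (fun p => y < (p : ℝ)) L with hVdef
  set W := truncateTo (Finset.Ioo ⌊y⌋₊ ⌈x / y⌉₊) V with hWdef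
  set G : ℝ → ℝ → ℂ := fun α β => 1 / (Real.pi : ℂ) * ∫ t in (-T)..T,
    keyIntegrand S l W x ((1 + 1 / Real.log x : ℝ) + t * I) α β with hG
  set G' : ℝ → ℝ → ℂ := fun α β => 1 / (Real.pi : ℂ) * ∫ t in (-T)..T,
    keyIntegrand S l W x ((1 + 1 / Real.log x : ℝ) + t * I) (Set.projIcc 0 η hη0 α)
      (Set.projIcc 0 η hη0 β) with hG'
  have hGG' : ∀ α ∈ Set.Icc 0 η, ∀ β ∈ Set.Icc 0 η, G α β = G' α β := by
    intro α hα β hβ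
    simp only [hG, hG', Set.projIcc_of_mem hη0 hα, Set.projIcc_of_mem hη0 hβ]
  have hG'c : Continuous (Function.uncurry G') := by
    have h1 := continuous_keyIntegrand (c := 1 + 1 / Real.log x) hx0 hη0 (by linarith)
      (h.summable_smooth hκ hy (by linarith)) (h.summable_rough hκ hy hx le_rfl)
      (fun θ => summable_twist_truncateTo θ (Finset.Ioo ⌊y⌋₊ ⌈x / y⌉₊) V)
    exact continuous_const.mul
      (intervalIntegral.continuous_parametric_intervalIntegral_of_continuous' (μ := volume)
        (f := fun (q : ℝ × ℝ) (t : ℝ) => keyIntegrand S l W x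
          ((1 + 1 / Real.log x : ℝ) + t * I) (Set.projIcc 0 η hη0 q.1) (Set.projIcc 0 η hη0 q.2))
        h1 (-T) T)
  set M : ℝ → ℝ → ℂ := fun α β => ∑ n ∈ Finset.Ioc 0 ⌊x⌋₊, 2 * perronCoeff S l V α β n with hM
  have hMc : Continuous (Function.uncurry M) := continuous_finsetSum _ fun n _ =>
    continuous_const.mul (continuous_perronCoeff S l V n)
  set P := perronCoeff (restrictPrimes (fun p => (p : ℝ) ≤ y) (divisorAF (k + 1)))
    (restrictPrimes (fun p => y < (p : ℝ)) (divisorAF (k + 1)))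
    (restrictPrimes (fun p => y < (p : ℝ)) ((k + 1) • Λ)) with hP
  have hPc : ∀ n, Continuous (Function.uncurry fun α β => P α β n) := fun n =>
    continuous_perronCoeff _ _ _ n
  set w : ℕ → ℝ := fun n => 1 / (1 + T * |Real.log (x / n)|) with hw
  have hw0 : ∀ n, 0 ≤ w n := fun n => by positivity
  set D := 2 / T * (Real.exp 1 * x * (288 * κ ^ 2 * halaszConst κ * Real.log x ^ κ)) with hD
  have hA := halaszConst_pos κ
  have hD0 : 0 ≤ D := by positivity
  set b₁ : ℝ → ℝ → ℝ := fun α β => ∑ n ∈ Finset.Ioc 0 ⌊2 * x⌋₊, w n * P α β n with hb₁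
  set b₂ : ℝ → ℝ → ℝ := fun α β => x ^ (-α) * (1 / (|β| + 1 / Real.log x) ^ 2) with hb₂
  have hb₁c : Continuous (Function.uncurry b₁) := continuous_finsetSum _ fun n _ =>
    continuous_const.mul (hPc n)
  have hb₂c : Continuous (Function.uncurry b₂) := by
    refine ((Real.continuous_const_rpow hx0.ne').comp continuous_fst.neg).mul ?_
    refine Continuous.div₀ continuous_const (by fun_prop) fun q => ?_
    positivity
  have hb₁c' : Continuous (Function.uncurry fun α β => 28 * (4 * b₁ α β)) :=
    (hb₁c.const_mul 4).const_mul 28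
  have hb₂c' : Continuous (Function.uncurry fun α β => 28 * (D * b₂ α β)) :=
    (hb₂c.const_mul D).const_mul 28
  have hbc : Continuous (Function.uncurry fun α β => 28 * (4 * b₁ α β) + 28 * (D * b₂ α β)) :=
    hb₁c'.add hb₂c'
  have hmain := norm_integral_integral_sub_le hη0 hG'c hMc hbc fun α hα β hβ => by
    have := h.norm_integral_keyIntegrand_sub_le hκ hy hyx hx hT (k := k + 1)
      (by exact_mod_cast hk1) hα hβ
    rw [← hGG' α hα β hβ, ← mul_add]
    simpa only [hb₁, hb₂, abs_of_nonneg hβ.1] using this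
  rw [integral_integral_add_of_continuous hb₁c' hb₂c'] at hmain
  simp only [intervalIntegral.integral_const_mul] at hmain
  have hMi := integral_integral_finsetSum (s := Finset.Ioc 0 ⌊x⌋₊)
    (P := fun n α β => perronCoeff S l V α β n) (continuous_perronCoeff S l V) (fun _ => (2 : ℂ)) η
  have hb₁i := integral_integral_finsetSum (s := Finset.Ioc 0 ⌊2 * x⌋₊)
    (P := fun n α β => P α β n) hPc w η
  rw [← integral_integral_congr hη0 hGG', hMi, hb₁i] at hmain
  have hnear : ∑ n ∈ Finset.Ioc 0 ⌊2 * x⌋₊, w n *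
      (∫ α in (0:ℝ)..η, ∫ β in (0:ℝ)..η, P α β n) ≤
      shortConst κ k * (x * Real.log y ^ κ / Real.log x + x * Real.log x ^ κ / T) := by
    refine le_trans (Finset.sum_le_sum fun n _ => ?_) (sum_divisorAF_near_le hk hk1 (by linarith)
      (by linarith) hT (by linarith))
    rw [div_eq_mul_one_div, mul_comm (divisorAF (k + 1) n)]
    exact mul_le_mul_of_nonneg_left (integral_perronCoeff_divisorAF_le (k + 1) hη0 n) (hw0 n)
  have hfar := mul_le_mul_of_nonneg_left
    (integral_integral_rpow_mul_le (x := x) (by linarith) hη0) hD0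
  have hmid := h.norm_sum_integral_perronCoeff_sub_le (x := x) hκ hy (by linarith)
  have htri := (norm_sub_le_norm_sub_add_norm_sub _ _ _).trans (add_le_add hmain hmid)
  refine htri.trans ?_
  have hU : 0 ≤ x * Real.log y ^ κ / Real.log x := by positivity
  have hE : 0 ≤ x * Real.log x ^ κ / T := by positivity
  have hD' : D = 2 * (Real.exp 1 * (288 * κ ^ 2 * halaszConst κ)) * (x * Real.log x ^ κ / T) := by
    rw [hD]; ring
  have hc1 : 0 ≤ 2 * (Real.exp 1 * (288 * κ ^ 2 * halaszConst κ)) := by positivity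
  have hc2 : 0 ≤ (26 * κ + 1) * halaszConst κ ^ 2 := by positivity
  have h5 := mul_nonneg hc1 hU
  have h6 := mul_nonneg hc2 hE
  rw [keyConst]
  rw [mul_one] at hfar
  simp only [hb₂]
  nlinarith [hnear, hfar, hD', h5, h6]

end KeyIntegralTotal

section HalaszClass

open ArithmeticFunction

/-- The arithmetic function agreeing with `f` away from `0`. -/
def toAF (f : ℕ → ℂ) : ArithmeticFunction ℂ := ⟨fun n => if n = 0 then 0 else f n, by simp⟩

lemma toAF_apply (f : ℕ → ℂ) {n : ℕ} (hn : n ≠ 0) : toAF f n = f n := if_neg hn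

variable {κ y : ℝ} {f Λf : ℕ → ℂ}

lemma IsHalaszClass.halaszPair (h : IsHalaszClass κ f Λf) : HalaszPair κ (toAF f) (toAF Λf) where
  mult := IsMultiplicative.iff_ne_zero.mpr ⟨by rw [toAF_apply f one_ne_zero, h.map_one],
    fun {m n} hm hn hmn => by
      rw [toAF_apply f (mul_ne_zero hm hn), toAF_apply f hm, toAF_apply f hn, h.mult m n hmn]⟩
  logMul_eq := by
    ext n
    rcases Nat.eq_zero_or_pos n with rfl | hn
    · simp
    rw [logMul_apply, toAF_apply f hn.ne', Complex.real_smul, mul_comm, h.conv n hn, mul_apply,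
      Nat.sum_divisorsAntidiagonal fun a b => toAF Λf a * toAF f b]
    refine Finset.sum_congr rfl fun d hd => ?_
    have hd' := Nat.dvd_of_mem_divisors hd
    rw [toAF_apply _ (Nat.pos_of_mem_divisors hd).ne',
      toAF_apply _ (Nat.div_pos (Nat.le_of_dvd hn hd') (Nat.pos_of_mem_divisors hd)).ne']
  norm_le n := by
    rcases Nat.eq_zero_or_pos n with rfl | hn
    · simp
    · rw [toAF_apply _ hn.ne']
      exact h.bound n hn

lemma LSeries_restrictPrimes_toAF (f : ℕ → ℂ) (P : ℕ → Prop) {w : ℂ} (hw : w ≠ 0) :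
    LSeries (fun n => restrictPrimes P (toAF f) n) w =
      ∑' n : ℕ, (if ∀ p ∈ n.primeFactors, P p then f n else 0) / (n : ℂ) ^ w := by
  refine tsum_congr fun n => ?_
  rcases Nat.eq_zero_or_pos n with rfl | hn
  · simp [Complex.zero_cpow hw]
  · rw [LSeries.term_of_ne_zero hn.ne', restrictPrimes_apply, toAF_apply f hn.ne']

lemma keyIntegrand_toAF (f Λf : ℕ → ℂ) (x : ℝ) (I : Finset ℕ) (hI : 0 ∉ I) {s : ℂ} {α β : ℝ}
    (h1 : s - α - β ≠ 0) (h2 : s + β ≠ 0) :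
    keyIntegrand (restrictPrimes (fun p => (p : ℝ) ≤ y) (toAF f))
      (restrictPrimes (fun p => y < (p : ℝ)) (toAF f))
      (truncateTo I (restrictPrimes (fun p => y < (p : ℝ)) (toAF Λf))) x s α β =
    Sdir f y (s - α - β) * Ldir f y (s + β) * (∑ m ∈ I, ΛlPart Λf y m / (m : ℂ) ^ (s - β)) *
      (∑ n ∈ I, ΛlPart Λf y n / (n : ℂ) ^ (s + β)) * (x : ℂ) ^ (s - α - β) / (s - α - β) := by
  have hV : ∀ w : ℂ, ∑ n ∈ I, restrictPrimes (fun p => y < (p : ℝ)) (toAF Λf) n / (n : ℂ) ^ w =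
      ∑ n ∈ I, ΛlPart Λf y n / (n : ℂ) ^ w := fun w =>
    Finset.sum_congr rfl fun n hn => by
      rw [restrictPrimes_apply, toAF_apply _ fun h0 => hI (h0 ▸ hn), ΛlPart]
  rw [keyIntegrand, LSeries_restrictPrimes_toAF f _ h1, LSeries_restrictPrimes_toAF f _ h2,
    LSeries_truncateTo hI, LSeries_truncateTo hI, hV, hV]
  rfl

end HalaszClass

theorem key_integral_representation (κ : ℝ) (hκ : 0 < κ) :
    ∃ C : ℝ, 0 < C ∧ ∀ f Λf : ℕ → ℂ, IsHalaszClass κ f Λf →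
    ∀ x y T : ℝ, C ≤ x → 10 ≤ y → y ≤ Real.sqrt x → 1 ≤ T → T ≤ x ^ ((9 : ℝ) / 10) →
    ‖(∫ α in (0:ℝ)..(1 / Real.log y), ∫ β in (0:ℝ)..(1 / Real.log y),
        (1 / (Real.pi : ℂ)) * ∫ t in (-T)..T,
          Sdir f y (((1 + 1 / Real.log x : ℝ) : ℂ) + (t : ℂ) * Complex.I - (α : ℂ) - (β : ℂ)) *
          Ldir f y (((1 + 1 / Real.log x : ℝ) : ℂ) + (t : ℂ) * Complex.I + (β : ℂ)) *
          (∑ m ∈ Finset.Ioo ⌊y⌋₊ ⌈x / y⌉₊,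
            ΛlPart Λf y m /
              (m : ℂ) ^ (((1 + 1 / Real.log x : ℝ) : ℂ) + (t : ℂ) * Complex.I - (β : ℂ))) *
          (∑ n ∈ Finset.Ioo ⌊y⌋₊ ⌈x / y⌉₊,
            ΛlPart Λf y n /
              (n : ℂ) ^ (((1 + 1 / Real.log x : ℝ) : ℂ) + (t : ℂ) * Complex.I + (β : ℂ))) *
          (x : ℂ) ^ (((1 + 1 / Real.log x : ℝ) : ℂ) + (t : ℂ) * Complex.I - (α : ℂ) - (β : ℂ)) /
          (((1 + 1 / Real.log x : ℝ) : ℂ) + (t : ℂ) * Complex.I - (α : ℂ) - (β : ℂ)))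
      - ∑ n ∈ Finset.Icc 1 ⌊x⌋₊, f n‖ ≤
      C * (x * Real.log y ^ κ / Real.log x + x * Real.log x ^ κ / T) := by
  obtain ⟨k, hk, hk1⟩ : ∃ k : ℕ, (k : ℝ) < κ ∧ κ ≤ k + 1 := by
    have h1 := Nat.ceil_pos.mpr hκ
    refine ⟨⌈κ⌉₊ - 1, ?_, ?_⟩
    · exact Nat.lt_ceil.mp (by omega)
    · have := Nat.le_ceil κ
      rw [Nat.cast_sub h1]
      simpa using this
  have hC : 0 < keyConst κ k := by
    have := shortConst_nonneg hk
    have := halaszConst_pos κ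
    unfold keyConst
    positivity
  refine ⟨keyConst κ k, hC, fun f Λf h x y T _ hy hyx hT _ => ?_⟩
  have hly := log_ge_of_ten_le hy
  have hη := inv_log_le hy
  have hy0 : 0 < y := by linarith
  have hx0 : 0 < x := Real.sqrt_pos.mp (hy0.trans_le hyx)
  have hyx2 : y ^ 2 ≤ x := (Real.le_sqrt' hy0).mp hyx
  have hlog : 2 * Real.log y ≤ Real.log x := by
    rw [← Real.log_rpow hy0]
    exact Real.log_le_log (by positivity) (by exact_mod_cast hyx2)
  have hlx : 0 < Real.log x := by linarith
  have hi : 0 < 1 / Real.log x := by positivity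
  have hmain := h.halaszPair.norm_integral_integral_keyIntegrand_sub_le hk hk1 hy hlog
    (by nlinarith) hT
  have hsum : ∑ n ∈ Finset.Ioc 0 ⌊x⌋₊, toAF f n = ∑ n ∈ Finset.Icc 1 ⌊x⌋₊, f n :=
    Finset.sum_congr rfl fun n hn => toAF_apply f
        (Nat.one_le_iff_ne_zero.mp (Finset.mem_Icc.mp hn).1)
  rw [hsum] at hmain
  refine le_of_eq_of_le ?_ hmain
  congr 2
  refine integral_integral_congr (by positivity) fun α hα β hβ => ?_
  congr 1
  refine intervalIntegral.integral_congr fun t _ =>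
      (keyIntegrand_toAF f Λf x _ (by simp) ?_ ?_).symm
  · intro h0
    have := congrArg Complex.re h0
    simp only [Complex.sub_re, Complex.add_re, Complex.ofReal_re, Complex.re_ofReal_mul,
      Complex.I_re, mul_zero, Complex.zero_re] at this
    linarith [hα.2, hβ.2]
  · intro h0
    have := congrArg Complex.re h0
    simp only [Complex.add_re, Complex.ofReal_re, Complex.re_ofReal_mul, Complex.I_re, mul_zero,
      Complex.zero_re] at this
    linarith [hβ.1]
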